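/- arXiv:1702.03340 — 4 statements merged into one kernel-verified Lean document; each statement's English description precedes it below -/
import Mathlib

section
/- Let (V, Φ) be a 3-dimensional Banach–Minkowski space and S ⊆ V*∖{0} an open set such that for every g ∈ S there exists τ ∈ V∖{0} with DΦ_v(τ) = 0 for every v ∈ ker g with Φ(v) = 1. Then for every g ∈ S the restriction of Φ to ker g is a Euclidean norm: there is a positive definite quadratic form q on ker g with Φ(v)² = q(v) for all v ∈ ker g. -/
noncomputable section

def IsBanachMinkowski {V : Type*} [NormedAddCommGroup V] [NormedSpace ℝ V] (Φ : V → ℝ) : Prop :=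
  Φ 0 = 0 ∧
  (∀ v : V, v ≠ 0 → 0 < Φ v) ∧
  (∀ t : ℝ, 0 ≤ t → ∀ v : V, Φ (t • v) = t * Φ v) ∧
  (∀ v w : V, Φ (v + w) ≤ Φ v + Φ w) ∧
  ContDiffOn ℝ (⊤ : ℕ∞) Φ {(0 : V)}ᶜ ∧
  (∀ v : V, v ≠ 0 → ∀ w : V, w ≠ 0 →
    0 < iteratedFDeriv ℝ 2 (fun u => Φ u ^ 2) v ![w, w])

lemma circle_aux (φ h : ℝ → ℝ) (a b c : ℝ)
    (hd : ∀ t, HasDerivAt φ (h t * (-Real.sin t * (a * Real.cos t + b * Real.sin t)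
      + Real.cos t * (c * Real.sin t))) t)
    (hh : ∀ t, 0 < h t) (hpos : ∀ t, 0 < φ t)
    (hE : ∀ t, 2 * φ t = h t * (a * Real.cos t ^ 2 + b * Real.cos t * Real.sin t
      + c * Real.sin t ^ 2))
    (hper : φ (2 * Real.pi) = φ 0) :
    b = 0 ∧ ∃ k, ∀ t, φ t = k * (a * Real.cos t ^ 2 + c * Real.sin t ^ 2) := by
  set Q : ℝ → ℝ := fun t => a * Real.cos t ^ 2 + b * Real.cos t * Real.sin t
      + c * Real.sin t ^ 2 with hQ
  have hQpos : ∀ t, 0 < Q t := by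
    intro t
    have h1 : 0 < h t * Q t := by
      have := hE t
      have := hpos t
      simp only [hQ]; linarith
    exact (pos_iff_pos_of_mul_pos h1).1 (hh t)
  have hQd : ∀ t, HasDerivAt Q (-2 * a * Real.sin t * Real.cos t
      + b * (Real.cos t ^ 2 - Real.sin t ^ 2) + 2 * c * Real.sin t * Real.cos t) t := by
    intro t
    have hs := Real.hasDerivAt_sin t
    have hc := Real.hasDerivAt_cos t
    have := (((hc.pow 2).const_mul a).add ((hc.const_mul b).mul hs)).add ((hs.pow 2).const_mul c)
    refine this.congr_deriv ?_
    simp; ring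
  have hr : ∀ t, HasDerivAt (fun t => φ t / Q t) (-(h t * b) / (2 * Q t)) t := by
    intro t
    have := (hd t).div (hQd t) (hQpos t).ne'
    refine this.congr_deriv ?_
    have h0 := (hQpos t).ne'
    have hφ : φ t = h t * Q t / 2 := by have := hE t; simp only [hQ]; linarith
    rw [hφ]
    field_simp
    have := Real.sin_sq_add_cos_sq t
    linear_combination (-(h t * b)) * this
  have hb : b = 0 := by
    have hpi : (0:ℝ) < 2 * Real.pi := by positivity
    obtain ⟨t, -, ht⟩ := exists_hasDerivAt_eq_zero hpi
      (f := fun t => φ t / Q t) (f' := fun t => -(h t * b) / (2 * Q t))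
      (fun t _ => (hr t).continuousAt.continuousWithinAt)
      (by simp [hper, hQ]) (fun t _ => hr t)
    have h1 := (hQpos t).ne'
    have h2 := (hh t).ne'
    simpa [h1, h2] using ht
  refine ⟨hb, φ 0 / Q 0, fun t => ?_⟩
  have hconst : φ t / Q t = φ 0 / Q 0 := by
    apply is_const_of_deriv_eq_zero (f := fun t => φ t / Q t)
    · exact fun t => (hr t).differentiableAt
    · intro t; rw [(hr t).deriv, hb]; simp
  rw [← hconst]
  have h1 : a * Real.cos t ^ 2 + c * Real.sin t ^ 2 = Q t := by simp [hQ, hb]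
  rw [h1, div_mul_cancel₀ _ (hQpos t).ne']

lemma det_aux (a1 b1 c1 a2 b2 c2 a3 b3 c3 x y z : ℝ) (h : ¬ (x = 0 ∧ y = 0 ∧ z = 0))
    (h1 : x * a1 + y * b1 + z * c1 = 0) (h2 : x * a2 + y * b2 + z * c2 = 0)
    (h3 : x * a3 + y * b3 + z * c3 = 0) :
    a1 * (b2 * c3 - c2 * b3) - b1 * (a2 * c3 - c2 * a3) + c1 * (a2 * b3 - b2 * a3) = 0 := by
  by_contra hD
  apply h
  refine ⟨?_, ?_, ?_⟩ <;> apply (mul_eq_zero.1 (?_ : _ * _ = (0:ℝ))).resolve_left hD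
  · linear_combination (b2 * c3 - c2 * b3) * h1 - (b1 * c3 - c1 * b3) * h2
      + (b1 * c2 - c1 * b2) * h3
  · linear_combination -(a2 * c3 - c2 * a3) * h1 + (a1 * c3 - c1 * a3) * h2
      - (a1 * c2 - c1 * a2) * h3
  · linear_combination (a2 * b3 - b2 * a3) * h1 - (a1 * b3 - b1 * a3) * h2
      + (a1 * b2 - b1 * a2) * h3

section
variable {V : Type*} [NormedAddCommGroup V] [NormedSpace ℝ V]

lemma det_deriv (F : V → ℝ) (hF : ∀ v : V, v ≠ 0 → DifferentiableAt ℝ (fderiv ℝ F) v)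
    (e1 e2 τ : V) (hspan : ∀ w : V, ∃ x y z : ℝ, w = x • e1 + y • e2 + z • τ)
    (S : Set (V →L[ℝ] ℝ)) (hSopen : IsOpen S) (g : V →L[ℝ] ℝ) (hg : g ∈ S)
    (ht : ∀ v, g v = 0 → v ≠ 0 → fderiv ℝ F v τ = 0)
    (htau : ∀ g ∈ S, ∃ σ : V, σ ≠ 0 ∧ ∀ v, g v = 0 → v ≠ 0 → fderiv ℝ F v σ = 0)
    (l : V →L[ℝ] ℝ) (hl : l τ = 0)
    (v : Fin 3 → V) (hv : ∀ i, g (v i) = 0) (hv0 : ∀ i, v i ≠ 0)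
    (A B H : Fin 3 → ℝ) (hA : ∀ i, A i = fderiv ℝ F (v i) e1)
    (hB : ∀ i, B i = fderiv ℝ F (v i) e2)
    (hH : ∀ i, H i = l (v i) * fderiv ℝ (fderiv ℝ F) (v i) τ τ) :
    A 0 * (B 1 * H 2 - H 1 * B 2) - B 0 * (A 1 * H 2 - H 1 * A 2)
      + H 0 * (A 1 * B 2 - B 1 * A 2) = 0 := by
  have hcurve : ∀ i, HasDerivAt (fun s : ℝ => v i + s • (l (v i) • τ)) (l (v i) • τ) 0 := by
    intro i
    simpa using ((hasDerivAt_id (0:ℝ)).smul_const (l (v i) • τ)).const_add (v i)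
  have hG : ∀ i (w : V), HasDerivAt (fun s : ℝ => fderiv ℝ F (v i + s • (l (v i) • τ)) w)
      (fderiv ℝ (fderiv ℝ F) (v i) (l (v i) • τ) w) 0 := by
    intro i w
    have h1 : HasFDerivAt (fderiv ℝ F) (fderiv ℝ (fderiv ℝ F) (v i))
        (v i + (0:ℝ) • (l (v i) • τ)) := by
      simpa using (hF _ (hv0 i)).hasFDerivAt
    have h2 := h1.comp_hasDerivAt (0:ℝ) (hcurve i)
    exact (ContinuousLinearMap.apply ℝ ℝ w).hasFDerivAt.comp_hasDerivAt (0:ℝ) h2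
  have hA' := fun i => hG i e1
  have hB' := fun i => hG i e2
  have hC' := fun i => hG i τ
  have hD := (((hA' 0).mul (((hB' 1).mul (hC' 2)).sub ((hC' 1).mul (hB' 2)))).sub
    ((hB' 0).mul (((hA' 1).mul (hC' 2)).sub ((hC' 1).mul (hA' 2))))).add
    ((hC' 0).mul (((hA' 1).mul (hB' 2)).sub ((hB' 1).mul (hA' 2))))
  have hS : ∀ᶠ s : ℝ in nhds 0, g - (s * g τ) • l ∈ S := by
    have hc : Continuous (fun s : ℝ => g - (s * g τ) • l) := by fun_prop
    have : (fun s : ℝ => g - (s * g τ) • l) 0 ∈ S := by simpa using hg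
    exact hc.continuousAt.eventually (hSopen.mem_nhds this)
  have hne : ∀ i, ∀ᶠ s : ℝ in nhds 0, v i + s • (l (v i) • τ) ≠ 0 := by
    intro i
    apply (hcurve i).continuousAt.eventually_ne
    simpa using hv0 i
  have hz := hD.congr_of_eventuallyEq (f₁ := fun _ => 0) (by
    filter_upwards [hS, hne 0, hne 1, hne 2] with s hs h0 h1 h2
    obtain ⟨σ, hσ, hσ'⟩ := htau _ hs
    obtain ⟨x, y, z, hw⟩ := hspan σ
    have key : ∀ i, v i + s • (l (v i) • τ) ≠ 0 →
        x * fderiv ℝ F (v i + s • (l (v i) • τ)) e1 + y * fderiv ℝ F (v i + s • (l (v i) • τ)) e2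
        + z * fderiv ℝ F (v i + s • (l (v i) • τ)) τ = 0 := by
      intro i hi
      have := hσ' (v i + s • (l (v i) • τ)) (by simp [hv i, hl]; ring) hi
      rw [hw] at this
      simpa using this
    exact (det_aux _ _ _ _ _ _ _ _ _ x y z (by
      rintro ⟨rfl, rfl, rfl⟩; apply hσ; simp [hw]) (key 0 h0) (key 1 h1) (key 2 h2)).symm)
  have := hz.unique (hasDerivAt_const (0:ℝ) (0:ℝ))
  have ht' : ∀ i, fderiv ℝ F (v i) τ = 0 := fun i => ht _ (hv i) (hv0 i)
  simp only [zero_smul, add_zero, Pi.mul_apply, Pi.sub_apply, ht', ← hA, ← hB, map_smul,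
    smul_apply, smul_eq_mul, ← hH] at this
  linear_combination this
end


section
variable {V : Type*} [NormedAddCommGroup V] [NormedSpace ℝ V]

lemma hom_fderiv (Φ : V → ℝ) (hhom : ∀ t : ℝ, 0 ≤ t → ∀ v : V, Φ (t • v) = t * Φ v)
    (t : ℝ) (ht : 0 < t) (v : V) (hd : DifferentiableAt ℝ Φ v) :
    fderiv ℝ Φ (t • v) = fderiv ℝ Φ v := by
  have h1 : fderiv ℝ (fun x => Φ (t • x)) v = t • fderiv ℝ Φ (t • v) := by
    have := fderiv_comp_smul (𝕜 := ℝ) (f := Φ) (x := v) t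
    exact this
  have h2 : (fun x => Φ (t • x)) = fun x => t • Φ x := by
    funext x; simp [hhom t ht.le x]
  rw [h2, fderiv_fun_const_smul hd] at h1
  exact (smul_right_injective _ ht.ne' h1).symm

lemma euler_aux (Φ : V → ℝ) (hhom : ∀ t : ℝ, 0 ≤ t → ∀ v : V, Φ (t • v) = t * Φ v)
    (v : V) (hd : DifferentiableAt ℝ Φ v) : fderiv ℝ Φ v v = Φ v := by
  have h1 : HasDerivAt (fun t : ℝ => t • v) v 1 := by
    simpa using (hasDerivAt_id (1:ℝ)).smul_const v
  have h2 : HasFDerivAt Φ (fderiv ℝ Φ v) ((1:ℝ) • v) := by simpa using hd.hasFDerivAt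
  have h3 := h2.comp_hasDerivAt (1:ℝ) h1
  have h4 : HasDerivAt (fun t : ℝ => t * Φ v) (Φ v) 1 := by
    simpa using (hasDerivAt_id (1:ℝ)).mul_const (Φ v)
  refine h3.unique (h4.congr_of_eventuallyEq ?_)
  filter_upwards [lt_mem_nhds (zero_lt_one' ℝ)] with t ht
  exact hhom t ht.le v

lemma exists_ker_two [FiniteDimensional ℝ V] (hdim : Module.finrank ℝ V = 3)
    (g k : V →L[ℝ] ℝ) : ∃ e : V, e ≠ 0 ∧ g e = 0 ∧ k e = 0 := by
  have := LinearMap.ker_ne_bot_of_finrank_lt (f := (g : V →ₗ[ℝ] ℝ).prod (k : V →ₗ[ℝ] ℝ))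
    (by simp [hdim])
  obtain ⟨e, he, he0⟩ := (Submodule.ne_bot_iff _).1 this
  refine ⟨e, he0, ?_⟩
  simpa using he
end

/-- Proposition: localized Blaschke–Kakutani characterization: if for
every `g` in an open set `S` of nonzero functionals there is `τ ≠ 0` tangent to the unit
sphere of `Φ` at every point of `ker g ∩ {Φ = 1}`, then the restriction of `Φ` to each
plane `ker g`, `g ∈ S`, is a Euclidean norm. -/
theorem statement12 (V : Type*) [NormedAddCommGroup V] [NormedSpace ℝ V]
    [FiniteDimensional ℝ V] (hdim : Module.finrank ℝ V = 3)
    (Φ : V → ℝ) (hΦ : IsBanachMinkowski Φ)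
    (S : Set (V →L[ℝ] ℝ)) (hSopen : IsOpen S) (hS0 : ∀ g ∈ S, g ≠ 0)
    (htau : ∀ g ∈ S, ∃ τ : V, τ ≠ 0 ∧
      ∀ v : V, v ∈ LinearMap.ker (g : V →ₗ[ℝ] ℝ) → Φ v = 1 → fderiv ℝ Φ v τ = 0) :
    ∀ g ∈ S, ∃ q : QuadraticForm ℝ (LinearMap.ker (g : V →ₗ[ℝ] ℝ)), q.PosDef ∧
      ∀ v : LinearMap.ker (g : V →ₗ[ℝ] ℝ), Φ (v : V) ^ 2 = q v := by
  obtain ⟨hΦ0, hpos, hhom, -, hsm, hconv⟩ := hΦ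
  intro g hg
  set F : V → ℝ := fun u => Φ u ^ 2 with hFdef
  have hΦc : ∀ v : V, v ≠ 0 → ContDiffAt ℝ (⊤ : ℕ∞) Φ v := fun v hv =>
    hsm.contDiffAt (isOpen_compl_singleton.mem_nhds hv)
  have hΦd : ∀ v : V, v ≠ 0 → DifferentiableAt ℝ Φ v := fun v hv =>
    (hΦc v hv).differentiableAt (by simp)
  have hFc : ∀ v : V, v ≠ 0 → ContDiffAt ℝ (⊤ : ℕ∞) F v := fun v hv => (hΦc v hv).pow 2
  have hFd : ∀ v : V, v ≠ 0 → DifferentiableAt ℝ F v := fun v hv =>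
    (hFc v hv).differentiableAt (by simp)
  have hF2 : ∀ v : V, v ≠ 0 → DifferentiableAt ℝ (fderiv ℝ F) v := fun v hv =>
    ((hFc v hv).fderiv_right (m := 1) (by norm_cast)).differentiableAt (by simp)
  have hFf : ∀ v : V, v ≠ 0 → ∀ w, fderiv ℝ F v w = 2 * Φ v * fderiv ℝ Φ v w := by
    intro v hv w
    have := ((hΦd v hv).hasFDerivAt.pow 2).fderiv
    rw [show F = fun x => Φ x ^ 2 from rfl]
    rw [this]; simp
  have hE : ∀ v : V, v ≠ 0 → fderiv ℝ F v v = 2 * F v := by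
    intro v hv
    rw [hFf v hv, euler_aux Φ hhom v (hΦd v hv)]; simp only [hFdef]; ring
  have hFpos : ∀ v : V, v ≠ 0 → 0 < F v := fun v hv => pow_pos (hpos v hv) 2
  have hH : ∀ v : V, v ≠ 0 → ∀ w : V, w ≠ 0 → 0 < fderiv ℝ (fderiv ℝ F) v w w := by
    intro v hv w hw
    have := hconv v hv w hw
    rw [iteratedFDeriv_two_apply] at this
    simpa using this
  have htau' : ∀ g ∈ S, ∃ σ : V, σ ≠ 0 ∧ ∀ v, g v = 0 → v ≠ 0 → fderiv ℝ F v σ = 0 := by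
    intro g hg
    obtain ⟨σ, h0, h1⟩ := htau g hg
    refine ⟨σ, h0, fun v hgv hv => ?_⟩
    have hp := hpos v hv
    have := h1 ((Φ v)⁻¹ • v) (by simp [hgv])
      (by rw [hhom _ (inv_pos.2 hp).le, inv_mul_cancel₀ hp.ne'])
    rw [hom_fderiv Φ hhom _ (inv_pos.2 hp) v (hΦd v hv)] at this
    rw [hFf v hv, this, mul_zero]
  obtain ⟨τ, hτ0, hτ⟩ := htau' g hg
  have hgτ : g τ ≠ 0 := by
    intro h
    have h1 := hτ τ h hτ0
    rw [hE τ hτ0] at h1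
    linarith [hFpos τ hτ0]
  obtain ⟨e1, he1, hge1, -⟩ := exists_ker_two hdim g 0
  obtain ⟨e2, he2, hge2, hGe⟩ := exists_ker_two hdim g (fderiv ℝ F e1)
  have hα : 0 < fderiv ℝ F e1 e1 := by rw [hE e1 he1]; linarith [hFpos e1 he1]
  have hγ : 0 < fderiv ℝ F e2 e2 := by rw [hE e2 he2]; linarith [hFpos e2 he2]
  have hind : ∀ x y z : ℝ, x • e1 + y • e2 + z • τ = 0 → x = 0 ∧ y = 0 ∧ z = 0 := by
    intro x y z h
    have hz : z = 0 := by
      have := congrArg g h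
      simpa [hge1, hge2, hgτ] using this
    subst hz
    have hx : x = 0 := by
      have := congrArg (fderiv ℝ F e1) h
      simpa [hGe, hα.ne'] using this
    subst hx
    exact ⟨rfl, by simpa [he2] using h, rfl⟩
  have hli : LinearIndependent ℝ ![e1, e2, τ] := by
    rw [Fintype.linearIndependent_iff]
    intro c hc
    rw [Fin.sum_univ_three] at hc
    obtain ⟨h0, h1, h2⟩ := hind _ _ _ hc
    intro i; fin_cases i <;> assumption
  let b := basisOfLinearIndependentOfCardEqFinrank hli (by simp [hdim])
  have hb0 : b 0 = e1 := by simp [b]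
  have hb1 : b 1 = e2 := by simp [b]
  have hb2 : b 2 = τ := by simp [b]
  have hrep : ∀ w : V, w = b.coord 0 w • e1 + b.coord 1 w • e2 + b.coord 2 w • τ := by
    intro w
    have := b.sum_repr w
    rw [Fin.sum_univ_three, hb0, hb1, hb2] at this
    exact this.symm
  have hspan : ∀ w : V, ∃ x y z : ℝ, w = x • e1 + y • e2 + z • τ := fun w => ⟨_, _, _, hrep w⟩
  let X : V →L[ℝ] ℝ := LinearMap.toContinuousLinearMap (b.coord 0)
  let Y : V →L[ℝ] ℝ := LinearMap.toContinuousLinearMap (b.coord 1)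
  have hX1 : X e1 = 1 := by simp [X, ← hb0]
  have hX2 : X e2 = 0 := by simp [X, ← hb1]
  have hXτ : X τ = 0 := by simp [X, ← hb2]
  have hY1 : Y e1 = 0 := by simp [Y, ← hb0]
  have hY2 : Y e2 = 1 := by simp [Y, ← hb1]
  have hYτ : Y τ = 0 := by simp [Y, ← hb2]
  have hker : ∀ v : V, g v = 0 → v = X v • e1 + Y v • e2 := by
    intro v hv
    have h1 := hrep v
    have h2 := congrArg g h1
    have h3 : b.coord 2 v = 0 := by
      simpa [hv, hge1, hge2, hgτ] using h2
    rw [h3] at h1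
    simpa [X, Y] using h1
  set h : V → ℝ := fun v => fderiv ℝ (fderiv ℝ F) v τ τ with hh
  have hhpos : ∀ v : V, v ≠ 0 → 0 < h v := fun v hv => hH v hv τ hτ0
  set α := fderiv ℝ F e1 e1
  set β := fderiv ℝ F e2 e1 with hβ
  set γ := fderiv ℝ F e2 e2
  have hh1 := (hhpos e1 he1).ne'
  have hh2 := (hhpos e2 he2).ne'
  have hdet : ∀ l : V →L[ℝ] ℝ, l τ = 0 → ∀ v : V, g v = 0 → v ≠ 0 →
      α * (γ * (l v * h v) - (l e2 * h e2) * fderiv ℝ F v e2)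
        + (l e1 * h e1) * (β * fderiv ℝ F v e2 - γ * fderiv ℝ F v e1) = 0 := by
    intro l hl v hv hv0
    have := det_deriv F hF2 e1 e2 τ hspan S hSopen g hg hτ htau' l hl ![e1, e2, v]
      (by intro i; fin_cases i <;> simp [hge1, hge2, hv])
      (by intro i; fin_cases i <;> simp [he1, he2, hv0])
      _ _ _ (fun i => rfl) (fun i => rfl) (fun i => rfl)
    simp only [Matrix.cons_val] at this
    rw [hGe] at this
    linear_combination this
  have hy : ∀ v : V, g v = 0 → v ≠ 0 → fderiv ℝ F v e2 = h v * (γ / h e2 * Y v) := by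
    intro v hv hv0
    have := hdet Y hYτ v hv hv0
    rw [hY1, hY2] at this
    field_simp
    apply mul_left_cancel₀ hα.ne'
    linear_combination -this
  have hx : ∀ v : V, g v = 0 → v ≠ 0 →
      fderiv ℝ F v e1 = h v * (α / h e1 * X v + β / h e2 * Y v) := by
    intro v hv hv0
    have h1 := hdet X hXτ v hv hv0
    have h2 := hy v hv hv0
    rw [hX1, hX2, h2] at h1
    field_simp
    field_simp at h1
    apply mul_left_cancel₀ hγ.ne'
    linear_combination -h1
  have hgu : ∀ x y : ℝ, g (x • e1 + y • e2) = 0 := by intro x y; simp [hge1, hge2]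
  have hXu : ∀ x y : ℝ, X (x • e1 + y • e2) = x := by intro x y; simp [hX1, hX2]
  have hYu : ∀ x y : ℝ, Y (x • e1 + y • e2) = y := by intro x y; simp [hY1, hY2]
  let u : ℝ → V := fun t => Real.cos t • e1 + Real.sin t • e2
  have hu0 : ∀ t, u t ≠ 0 := by
    intro t ht
    have h1 : Real.cos t = 0 := by rw [← hXu (Real.cos t) (Real.sin t)]; simp [u] at ht; simp [ht]
    have h2 : Real.sin t = 0 := by rw [← hYu (Real.cos t) (Real.sin t)]; simp [u] at ht; simp [ht]
    have := Real.sin_sq_add_cos_sq t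
    rw [h1, h2] at this
    norm_num at this
  have hud : ∀ t, HasDerivAt u (-Real.sin t • e1 + Real.cos t • e2) t := by
    intro t
    exact ((Real.hasDerivAt_cos t).smul_const e1).add ((Real.hasDerivAt_sin t).smul_const e2)
  obtain ⟨hb, k, hk⟩ := circle_aux (fun t => F (u t)) (fun t => h (u t))
    (α / h e1) (β / h e2) (γ / h e2)
    (by
      intro t
      have h1 := (hFd _ (hu0 t)).hasFDerivAt.comp_hasDerivAt t (hud t)
      refine h1.congr_deriv ?_
      rw [map_add, map_smul, map_smul, hx _ (hgu _ _) (hu0 t), hy _ (hgu _ _) (hu0 t), hXu, hYu]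
      simp only [smul_eq_mul]; ring)
    (fun t => hhpos _ (hu0 t)) (fun t => hFpos _ (hu0 t))
    (by
      intro t
      have h1 := hE _ (hu0 t)
      have h2 : fderiv ℝ F (u t) (u t) = Real.cos t * fderiv ℝ F (u t) e1
          + Real.sin t * fderiv ℝ F (u t) e2 := by
        conv_lhs => arg 2; simp only [u]
        rw [map_add, map_smul, map_smul]; rfl
      rw [h2, hx _ (hgu _ _) (hu0 t), hy _ (hgu _ _) (hu0 t), hXu, hYu] at h1
      rw [← h1]; ring)
    (by simp [u])
  have hFin : ∀ v : V, g v = 0 → F v = k * (α / h e1 * X v ^ 2 + γ / h e2 * Y v ^ 2) := by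
    intro v hv
    obtain ⟨r, hr, t, hc, hs⟩ : ∃ r : ℝ, 0 ≤ r ∧ ∃ t : ℝ,
        X v = r * Real.cos t ∧ Y v = r * Real.sin t := by
      refine ⟨‖(⟨X v, Y v⟩ : ℂ)‖, norm_nonneg _, Complex.arg ⟨X v, Y v⟩, ?_, ?_⟩
      · exact (Complex.norm_mul_cos_arg ⟨X v, Y v⟩).symm
      · exact (Complex.norm_mul_sin_arg ⟨X v, Y v⟩).symm
    have h1 : v = r • u t := by
      rw [hker v hv, hc, hs]; simp only [u, smul_add, smul_smul]
    have h2 : F v = r ^ 2 * F (u t) := by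
      rw [h1]; simp only [hFdef]; rw [hhom r hr]; ring
    have h3 := hk t
    rw [h2, h3, hc, hs]; ring
  let p : LinearMap.ker (g : V →ₗ[ℝ] ℝ) →ₗ[ℝ] V := (LinearMap.ker (g : V →ₗ[ℝ] ℝ)).subtype
  let q : QuadraticForm ℝ (LinearMap.ker (g : V →ₗ[ℝ] ℝ)) :=
    (k * (α / h e1)) • QuadraticMap.linMulLin ((X : V →ₗ[ℝ] ℝ) ∘ₗ p) ((X : V →ₗ[ℝ] ℝ) ∘ₗ p)
    + (k * (γ / h e2)) • QuadraticMap.linMulLin ((Y : V →ₗ[ℝ] ℝ) ∘ₗ p) ((Y : V →ₗ[ℝ] ℝ) ∘ₗ p)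
  have hq : ∀ v : LinearMap.ker (g : V →ₗ[ℝ] ℝ), Φ (v : V) ^ 2 = q v := by
    intro v
    have h1 := hFin v v.2
    have h2 : q v = (k * (α / h e1)) * (X v * X v) + (k * (γ / h e2)) * (Y v * Y v) := rfl
    rw [h2, show Φ (v : V) ^ 2 = F v from rfl, h1]; ring
  refine ⟨q, ?_, hq⟩
  intro v hv
  rw [← hq v]
  exact hFpos _ (by simpa using hv)
end
end

section
/- Let (V, Φ) be a 3-dimensional Banach–Minkowski space and Γ a set of 2-dimensional linear subspaces of V such that the union ⋃_{H∈Γ} H has nonempty interior in V. Suppose that for every H ∈ Γ the restriction Φ|_H is a Euclidean norm. Then there exists a positive definite quadratic form Q on V such that Φ(v)² = Q(v) for every v ∈ ⋃_{H∈Γ} H. -/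
noncomputable section

/-- `D` behaves like a quadratic form on `H`. -/
def QuadOn {V : Type*} [AddCommGroup V] [Module ℝ V] (D : V → ℝ) (H : Submodule ℝ V) : Prop :=
  ∀ v ∈ H, ∀ w ∈ H, ∀ a b : ℝ,
    D (a • v + b • w) = a ^ 2 * D v + b ^ 2 * D w + a * b * (D (v + w) - D v - D w)

lemma quadOn_form {V : Type*} [AddCommGroup V] [Module ℝ V] (Q : QuadraticForm ℝ V)
    (v w : V) (a b : ℝ) :
    Q (a • v + b • w) = a ^ 2 * Q v + b ^ 2 * Q w + a * b * (Q (v + w) - Q v - Q w) := by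
  have h : QuadraticMap.polar Q (a • v) (b • w) = a * (b * QuadraticMap.polar Q v w) := by
    rw [QuadraticMap.polar_smul_left, QuadraticMap.polar_smul_right]; simp
  have h1 : Q (a • v) = a * a * Q v := by rw [QuadraticMap.map_smul]; simp
  have h2 : Q (b • w) = b * b * Q w := by rw [QuadraticMap.map_smul]; simp
  simp only [QuadraticMap.polar] at h
  rw [h1, h2] at h
  linarith

lemma span_of_two {V : Type*} [AddCommGroup V] [Module ℝ V] [FiniteDimensional ℝ V]
    (H : Submodule ℝ V) (hH : Module.finrank ℝ H = 2) (a b : V) (ha : a ∈ H) (hb : b ∈ H)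
    (hab : LinearIndependent ℝ ![a, b]) (v : V) (hv : v ∈ H) :
    ∃ s t : ℝ, v = s • a + t • b := by
  have hle : Submodule.span ℝ (Set.range ![a, b]) ≤ H := by
    rw [Submodule.span_le]; rintro _ ⟨i, rfl⟩; fin_cases i <;> simpa
  have heq := Submodule.eq_of_le_of_finrank_eq hle (by
    rw [finrank_span_eq_card hab, hH]; simp)
  rw [← heq] at hv
  simp only [Matrix.range_cons, Matrix.range_empty, Set.union_empty, Set.singleton_union] at hv
  obtain ⟨s, t, h⟩ := Submodule.mem_span_pair.1 hv
  exact ⟨s, t, h.symm⟩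

lemma exists_inter {V : Type*} [AddCommGroup V] [Module ℝ V] [FiniteDimensional ℝ V]
    (hdim : Module.finrank ℝ V = 3) (H K : Submodule ℝ V) (hH : Module.finrank ℝ H = 2)
    (hK : Module.finrank ℝ K = 2) : ∃ v : V, v ≠ 0 ∧ v ∈ H ∧ v ∈ K := by
  have h1 := Submodule.finrank_sup_add_finrank_inf_eq H K
  have h2 := Submodule.finrank_le (H ⊔ K)
  have h3 : H ⊓ K ≠ ⊥ := by
    intro h; rw [h, finrank_bot] at h1; omega
  obtain ⟨v, hv, hv0⟩ := Submodule.exists_mem_ne_zero_of_ne_bot h3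
  exact ⟨v, hv0, hv.1, hv.2⟩

lemma second_deriv {V : Type*} [NormedAddCommGroup V] [NormedSpace ℝ V]
    (f : V → ℝ) (e v : V) (hf : ContDiffAt ℝ 2 f e) (A B C : ℝ)
    (h : ∀ᶠ t : ℝ in nhds 0, f (e + t • v) = A + t * B + t ^ 2 * C) :
    fderiv ℝ (fderiv ℝ f) e v v = 2 * C := by
  have hl : ∀ t : ℝ, HasDerivAt (fun t : ℝ => e + t • v) v t := by
    intro t
    simpa using ((hasDerivAt_id t).smul_const v).const_add e
  have hc : Filter.Tendsto (fun t : ℝ => e + t • v) (nhds 0) (nhds e) := by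
    have := (hl 0).continuousAt.tendsto
    simpa using this
  have hd : ∀ᶠ x in nhds e, DifferentiableAt ℝ f x := by
    filter_upwards [hf.eventually (by simp)] with x hx
    exact hx.differentiableAt (by simp)
  have h1 : (fun t : ℝ => fderiv ℝ f (e + t • v) v) =ᶠ[nhds 0] fun t => B + 2 * t * C := by
    filter_upwards [hc.eventually hd, h.eventually_nhds] with t ht ht2
    have a1 : HasDerivAt (fun t : ℝ => f (e + t • v)) (fderiv ℝ f (e + t • v) v) t :=
      ht.hasFDerivAt.comp_hasDerivAt t (hl t)
    have a2 : HasDerivAt (fun t : ℝ => A + t * B + t ^ 2 * C) (B + 2 * t * C) t := by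
      have := (((hasDerivAt_id t).mul_const B).const_add A).add
        (((hasDerivAt_id t).pow 2).mul_const C)
      refine this.congr_deriv ?_
      simp
    exact a1.unique (a2.congr_of_eventuallyEq ht2)
  have hdd : DifferentiableAt ℝ (fderiv ℝ f) e :=
    (hf.fderiv_right (m := 1) (by norm_num)).differentiableAt (by simp)
  have a1 : HasDerivAt (fun t : ℝ => fderiv ℝ f (e + t • v) v)
      (fderiv ℝ (fderiv ℝ f) e v v) 0 := by
    have h0 : HasFDerivAt (fderiv ℝ f) (fderiv ℝ (fderiv ℝ f) e) (e + (0 : ℝ) • v) := by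
      simpa using hdd.hasFDerivAt
    have := h0.comp_hasDerivAt (0 : ℝ) (hl 0)
    simpa using this.clm_apply (hasDerivAt_const (0 : ℝ) v)
  have a2 : HasDerivAt (fun t : ℝ => B + 2 * t * C) (2 * C) 0 := by
    have := (((hasDerivAt_id (0 : ℝ)).const_mul 2).mul_const C).const_add B
    simpa using this
  exact a1.unique (a2.congr_of_eventuallyEq h1)

/-- Half of the second derivative, as a quadratic form. -/
def hessForm {V : Type*} [NormedAddCommGroup V] [NormedSpace ℝ V]
    (f : V → ℝ) (e : V) : QuadraticForm ℝ V :=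
  (1 / 2 : ℝ) • LinearMap.BilinMap.toQuadraticMap
    (LinearMap.mk₂ ℝ (fun v w => fderiv ℝ (fderiv ℝ f) e v w) (by simp) (by simp) (by simp)
      (by simp))

lemma hessForm_apply {V : Type*} [NormedAddCommGroup V] [NormedSpace ℝ V]
    (f : V → ℝ) (e v : V) : hessForm f e v = 1 / 2 * fderiv ℝ (fderiv ℝ f) e v v := by
  simp [hessForm]

/-- Planes through `e`. -/
lemma hess_plane {V : Type*} [NormedAddCommGroup V] [NormedSpace ℝ V]
    (f : V → ℝ) (e : V) (hf : ContDiffAt ℝ 2 f e) (H : Submodule ℝ V) (hq : QuadOn f H)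
    (he : e ∈ H) (v : V) (hv : v ∈ H) : f v = hessForm f e v := by
  rw [hessForm_apply, second_deriv f e v hf (f e) (f (e + v) - f e - f v) (f v)]
  · ring
  · refine Filter.Eventually.of_forall fun t => ?_
    have := hq e he v hv 1 t
    rw [one_smul] at this
    rw [this]; ring

lemma basis_case1 {V : Type*} [AddCommGroup V] [Module ℝ V] (f : V → ℝ) (Q R : QuadraticForm ℝ V)
    (H : Submodule ℝ V) [FiniteDimensional ℝ V] (hH : Module.finrank ℝ H = 2)
    (hdim : Module.finrank ℝ V = 3)
    (e u w : V) (hli : LinearIndependent ℝ ![e, u, w])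
    (H1 H2 H3 : Submodule ℝ V) (e1 : e ∈ H1) (u1 : u ∈ H1) (e2 : e ∈ H2) (w2 : w ∈ H2)
    (u3 : u ∈ H3) (w3 : w ∈ H3) (d3 : Module.finrank ℝ H3 = 2)
    (Q1 : ∀ v ∈ H1, f v = Q v) (Q2 : ∀ v ∈ H2, f v = Q v) (Q3 : ∀ v ∈ H3, f v = Q v)
    (R1 : ∀ v ∈ H1, f v = R v) (R2 : ∀ v ∈ H2, f v = R v) (RH : ∀ v ∈ H, f v = R v)
    (eH : e ∈ H) : ∀ v ∈ H, f v = Q v := by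
  have hli' := Fintype.linearIndependent_iff.1 hli
  simp only [Fin.sum_univ_three, Matrix.cons_val_zero, Matrix.cons_val_one, Matrix.cons_val] at hli'
  have key : ∀ x y z : ℝ, x • e + y • u + z • w = 0 → x = 0 ∧ y = 0 ∧ z = 0 := by
    intro x y z h
    have := hli' ![x, y, z] (by simpa using h)
    exact ⟨this 0, this 1, this 2⟩
  have huw : LinearIndependent ℝ ![u, w] := by
    rw [LinearIndependent.pair_iff]; intro s t h
    exact (key 0 s t (by simpa using h)).2
  obtain ⟨p, p0, pH, p3⟩ := exists_inter hdim H H3 hH d3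
  obtain ⟨s, t, hp⟩ := span_of_two H3 d3 u w u3 w3 huw p p3
  have hep : LinearIndependent ℝ ![e, p] := by
    rw [LinearIndependent.pair_iff]; intro x y h
    have h' := key x (y * s) (y * t) (by rw [← h, hp]; module)
    refine ⟨h'.1, ?_⟩
    by_contra hy
    have hs : s = 0 := by simpa [hy] using h'.2.1
    have ht : t = 0 := by simpa [hy] using h'.2.2
    apply p0; rw [hp, hs, ht]; simp
  intro v hv
  obtain ⟨a, b, rfl⟩ := span_of_two H hH e p eH pH hep v hv
  have gQ1 := quadOn_form Q e u 1 s
  have gR1 := quadOn_form R e u 1 s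
  have E1 := (Q1 e e1).symm.trans (R1 e e1)
  have E2 := (Q1 u u1).symm.trans (R1 u u1)
  have E3 := (Q2 w w2).symm.trans (R2 w w2)
  have E4 := (Q1 _ (H1.add_mem e1 u1)).symm.trans (R1 _ (H1.add_mem e1 u1))
  have E5 := (Q2 _ (H2.add_mem e2 w2)).symm.trans (R2 _ (H2.add_mem e2 w2))
  have E6 := (Q3 _ p3).symm.trans (RH _ pH)
  have pol : ∀ S : QuadraticForm ℝ V, S (e + p) - S e - S p
      = s * (S (e + u) - S e - S u) + t * (S (e + w) - S e - S w) := by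
    intro S
    have : QuadraticMap.polar S e p = s * QuadraticMap.polar S e u + t * QuadraticMap.polar S e w := by
      rw [hp, QuadraticMap.polar_add_right, QuadraticMap.polar_smul_right,
        QuadraticMap.polar_smul_right]; simp
    simpa [QuadraticMap.polar] using this
  rw [RH _ hv, quadOn_form R, quadOn_form Q, pol Q, pol R, E1, E2, E3, E4, E5, E6]

lemma basis_case2 {V : Type*} [AddCommGroup V] [Module ℝ V] (f : V → ℝ) (Q : QuadraticForm ℝ V)
    (H : Submodule ℝ V) [FiniteDimensional ℝ V] (hH : Module.finrank ℝ H = 2)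
    (hdim : Module.finrank ℝ V = 3)
    (e u w : V) (hli : LinearIndependent ℝ ![e, u, w])
    (H1 H2 H3 : Submodule ℝ V) (e1 : e ∈ H1) (u1 : u ∈ H1) (e2 : e ∈ H2) (w2 : w ∈ H2)
    (u3 : u ∈ H3) (w3 : w ∈ H3) (d1 : Module.finrank ℝ H1 = 2) (d2 : Module.finrank ℝ H2 = 2)
    (d3 : Module.finrank ℝ H3 = 2)
    (Q1 : ∀ v ∈ H1, f v = Q v) (Q2 : ∀ v ∈ H2, f v = Q v) (Q3 : ∀ v ∈ H3, f v = Q v)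
    (fH : QuadOn f H)
    (eH : e ∉ H) (uH : u ∉ H) (wH : w ∉ H) : ∀ v ∈ H, f v = Q v := by
  have hli' := Fintype.linearIndependent_iff.1 hli
  simp only [Fin.sum_univ_three, Matrix.cons_val_zero, Matrix.cons_val_one, Matrix.cons_val] at hli'
  have key : ∀ x y z : ℝ, x • e + y • u + z • w = 0 → x = 0 ∧ y = 0 ∧ z = 0 := by
    intro x y z h
    have := hli' ![x, y, z] (by simpa using h)
    exact ⟨this 0, this 1, this 2⟩
  have huw : LinearIndependent ℝ ![u, w] := by
    rw [LinearIndependent.pair_iff]; intro s t h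
    exact (key 0 s t (by simpa using h)).2
  have heu : LinearIndependent ℝ ![e, u] := by
    rw [LinearIndependent.pair_iff]; intro s t h
    have := (key s t 0 (by simpa using h)); tauto
  have hew : LinearIndependent ℝ ![e, w] := by
    rw [LinearIndependent.pair_iff]; intro s t h
    have := (key s 0 t (by simpa using h)); tauto
  have nz : ∀ (x y p : V) (a b : ℝ), p = a • x + b • y → p ≠ 0 → p ∈ H → x ∉ H → b ≠ 0 := by
    rintro x y p a b rfl h0 hp hx rfl
    simp only [zero_smul, add_zero] at hp h0
    have ha : a ≠ 0 := by rintro rfl; simp at h0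
    exact hx ((H.smul_mem_iff ha).1 hp)
  obtain ⟨p, p0, pH, p1⟩ := exists_inter hdim H H1 hH d1
  obtain ⟨q, q0, qH, q2⟩ := exists_inter hdim H H2 hH d2
  obtain ⟨r, r0, rH, r3⟩ := exists_inter hdim H H3 hH d3
  obtain ⟨a, b, hp⟩ := span_of_two H1 d1 e u e1 u1 heu p p1
  obtain ⟨c, d, hq⟩ := span_of_two H2 d2 e w e2 w2 hew q q2
  obtain ⟨g, h, hr⟩ := span_of_two H3 d3 u w u3 w3 huw r r3
  have hb := nz _ _ _ _ _ hp p0 pH eH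
  have hd := nz _ _ _ _ _ hq q0 qH eH
  have hh := nz _ _ _ _ _ hr r0 rH uH
  have hg := nz _ _ _ _ _ (hr.trans (add_comm _ _)) r0 rH wH
  have hpq : LinearIndependent ℝ ![p, q] := by
    rw [LinearIndependent.pair_iff]; intro s t hst
    have := key (s * a + t * c) (s * b) (t * d) (by rw [← hst, hp, hq]; module)
    simpa [hb, hd] using this.2
  obtain ⟨s, t, hst⟩ := span_of_two H hH p q pH qH hpq r rH
  have k := key (s * a + t * c) (s * b - g) (t * d - h) (by
    have : s • p + t • q - r = 0 := by rw [hst]; simp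
    rw [← this, hp, hq, hr]; module)
  have hs : s ≠ 0 := by rintro rfl; apply hg; linarith [k.2.1]
  have ht : t ≠ 0 := by rintro rfl; apply hh; linarith [k.2.2]
  have F := fH p pH q qH s t
  have G := quadOn_form Q p q s t
  rw [← hst, Q3 r r3] at F
  rw [← hst, F, Q1 p p1, Q2 q q2] at G
  have G' : f (p + q) - Q p - Q q = Q (p + q) - Q p - Q q := by
    have := add_left_cancel G
    exact mul_left_cancel₀ (mul_ne_zero hs ht) this
  intro v hv
  obtain ⟨x, y, rfl⟩ := span_of_two H hH p q pH qH hpq v hv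
  rw [fH p pH q qH, quadOn_form Q, Q1 p p1, Q2 q q2, G']

lemma main_exists {V : Type*} [NormedAddCommGroup V] [NormedSpace ℝ V]
    [FiniteDimensional ℝ V] (hdim : Module.finrank ℝ V = 3)
    (f : V → ℝ) (hf : ∀ e : V, e ≠ 0 → ContDiffAt ℝ 2 f e)
    (Γ : Set (Submodule ℝ V)) (hd : ∀ H ∈ Γ, Module.finrank ℝ H = 2)
    (hq : ∀ H ∈ Γ, QuadOn f H) :
    ∃ Q : QuadraticForm ℝ V, ∀ H ∈ Γ, ∀ v ∈ H, f v = Q v := by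
  by_cases hcom : ∃ e : V, e ≠ 0 ∧ ∀ H ∈ Γ, e ∈ H
  · obtain ⟨e, e0, he⟩ := hcom
    exact ⟨hessForm f e, fun H hH v hv => hess_plane f e (hf e e0) H (hq H hH) (he H hH) v hv⟩
  push Not at hcom
  have hnt : Nontrivial V := Module.nontrivial_of_finrank_pos (R := ℝ) (by omega)
  obtain ⟨x, x0⟩ := exists_ne (0 : V)
  obtain ⟨H1, G1, -⟩ := hcom x x0
  obtain ⟨y, y0, hy, -⟩ := exists_inter hdim H1 H1 (hd _ G1) (hd _ G1)
  obtain ⟨H2, G2, hy2⟩ := hcom y y0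
  obtain ⟨e, e0, e1, e2⟩ := exists_inter hdim H1 H2 (hd _ G1) (hd _ G2)
  obtain ⟨H3, G3, e3⟩ := hcom e e0
  obtain ⟨u, u0, u1, u3⟩ := exists_inter hdim H1 H3 (hd _ G1) (hd _ G3)
  obtain ⟨w, w0, w2, w3⟩ := exists_inter hdim H2 H3 (hd _ G2) (hd _ G3)
  have pr : ∀ p : V, p ≠ 0 → p ∈ H3 → LinearIndependent ℝ ![e, p] := by
    intro p p0 p3
    rw [LinearIndependent.pair_iff]; intro s t h
    have hs : s = 0 := by
      by_contra hs
      apply e3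
      rw [← H3.smul_mem_iff hs, eq_neg_of_add_eq_zero_left h]
      exact H3.neg_mem (H3.smul_mem _ p3)
    subst hs
    simpa [p0] using h
  have u2 : u ∉ H2 := by
    intro u2
    obtain ⟨s, t, rfl⟩ := span_of_two H1 (hd _ G1) e u e1 u1 (pr u u0 u3) y hy
    exact hy2 (H2.add_mem (H2.smul_mem _ e2) (H2.smul_mem _ u2))
  have key : ∀ x y z : ℝ, x • e + y • u + z • w = 0 → x = 0 ∧ y = 0 ∧ z = 0 := by
    intro x y z h
    have hy : y = 0 := by
      by_contra hy
      apply u2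
      rw [← H2.smul_mem_iff hy]
      have : y • u = -(x • e + z • w) := by
        rw [eq_neg_iff_add_eq_zero, ← h]; module
      rw [this]
      exact H2.neg_mem (H2.add_mem (H2.smul_mem _ e2) (H2.smul_mem _ w2))
    subst hy
    have := LinearIndependent.pair_iff.1 (pr w w0 w3) x z (by simpa using h)
    tauto
  have hli : LinearIndependent ℝ ![e, u, w] := by
    rw [Fintype.linearIndependent_iff]
    intro g hg
    simp only [Fin.sum_univ_three, Matrix.cons_val_zero, Matrix.cons_val_one,
      Matrix.cons_val] at hg
    have := key _ _ _ hg
    intro i; fin_cases i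
    exacts [this.1, this.2.1, this.2.2]
  have hli2 : LinearIndependent ℝ ![u, e, w] := by
    rw [Fintype.linearIndependent_iff]
    intro g hg
    simp only [Fin.sum_univ_three, Matrix.cons_val_zero, Matrix.cons_val_one,
      Matrix.cons_val] at hg
    have := key (g 1) (g 0) (g 2) (by rw [← hg]; module)
    intro i; fin_cases i
    exacts [this.2.1, this.1, this.2.2]
  have hli3 : LinearIndependent ℝ ![w, e, u] := by
    rw [Fintype.linearIndependent_iff]
    intro g hg
    simp only [Fin.sum_univ_three, Matrix.cons_val_zero, Matrix.cons_val_one,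
      Matrix.cons_val] at hg
    have := key (g 1) (g 2) (g 0) (by rw [← hg]; module)
    intro i; fin_cases i
    exacts [this.2.2, this.1, this.2.1]
  have huw : LinearIndependent ℝ ![u, w] := by
    rw [LinearIndependent.pair_iff]; intro s t h
    exact (key 0 s t (by simpa using h)).2
  let B : Module.Basis (Fin 3) ℝ V := basisOfLinearIndependentOfCardEqFinrank hli (by simp [hdim])
  have B0 : B 0 = e := by simp [B]
  have B1 : B 1 = u := by simp [B]
  have B2 : B 2 = w := by simp [B]
  have cu : ∀ x y z : ℝ, B.coord 1 (x • e + y • u + z • w) = y := by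
    intro x y z; rw [← B0, ← B1, ← B2]; simp [Finsupp.single_apply]
  have cw : ∀ x y z : ℝ, B.coord 2 (x • e + y • u + z • w) = z := by
    intro x y z; rw [← B0, ← B1, ← B2]; simp [Finsupp.single_apply]
  set R := hessForm f e with hR
  have RG : ∀ H ∈ Γ, e ∈ H → ∀ v ∈ H, f v = R v :=
    fun H hH he v hv => hess_plane f e (hf e e0) H (hq H hH) he v hv
  let Q : QuadraticForm ℝ V :=
    R + (f (u + w) - R (u + w)) • QuadraticMap.linMulLin (B.coord 1) (B.coord 2)
  have Qv : ∀ x y z : ℝ, Q (x • e + y • u + z • w) =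
      R (x • e + y • u + z • w) + (f (u + w) - R (u + w)) * (y * z) := by
    intro x y z
    have : ∀ v, Q v = R v + (f (u + w) - R (u + w)) * (B.coord 1 v * B.coord 2 v) := by
      intro v; simp [Q]
    rw [this, cu, cw]
  have Q1 : ∀ v ∈ H1, f v = Q v := by
    intro v hv
    rw [RG H1 G1 e1 v hv]
    obtain ⟨s, t, rfl⟩ := span_of_two H1 (hd _ G1) e u e1 u1 (pr u u0 u3) v hv
    have := Qv s t 0
    simp only [zero_smul, add_zero, mul_zero] at this
    exact this.symm
  have Q2 : ∀ v ∈ H2, f v = Q v := by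
    intro v hv
    rw [RG H2 G2 e2 v hv]
    obtain ⟨s, t, rfl⟩ := span_of_two H2 (hd _ G2) e w e2 w2 (pr w w0 w3) v hv
    have := Qv s 0 t
    simp only [zero_smul, add_zero, zero_mul, mul_zero] at this
    exact this.symm
  have Q3 : ∀ v ∈ H3, f v = Q v := by
    intro v hv
    obtain ⟨s, t, rfl⟩ := span_of_two H3 (hd _ G3) u w u3 w3 huw v hv
    have := Qv 0 s t
    simp only [zero_smul, zero_add] at this
    rw [this, hq H3 G3 u u3 w w3, quadOn_form R, RG H1 G1 e1 u u1, RG H2 G2 e2 w w2]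
    ring
  refine ⟨Q, fun H hH => ?_⟩
  have HP : ∀ p : V, p ≠ 0 → ∀ K ∈ Γ, p ∈ K → ∀ v ∈ K, f v = hessForm f p v :=
    fun p p0 K hK pK v hv => hess_plane f p (hf p p0) K (hq K hK) pK v hv
  by_cases eH : e ∈ H
  · exact basis_case1 f Q (hessForm f e) H (hd _ hH) hdim e u w hli H1 H2 H3 e1 u1 e2 w2 u3 w3
      (hd _ G3) Q1 Q2 Q3 (HP e e0 _ G1 e1) (HP e e0 _ G2 e2) (HP e e0 _ hH eH) eH
  by_cases uH : u ∈ H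
  · exact basis_case1 f Q (hessForm f u) H (hd _ hH) hdim u e w hli2 H1 H3 H2 u1 e1 u3 w3 e2 w2
      (hd _ G2) Q1 Q3 Q2 (HP u u0 _ G1 u1) (HP u u0 _ G3 u3) (HP u u0 _ hH uH) uH
  by_cases wH : w ∈ H
  · exact basis_case1 f Q (hessForm f w) H (hd _ hH) hdim w e u hli3 H2 H3 H1 w2 e2 w3 u3 e1 u1
      (hd _ G1) Q2 Q3 Q1 (HP w w0 _ G2 w2) (HP w w0 _ G3 w3) (HP w w0 _ hH wH) wH
  exact basis_case2 f Q H (hd _ hH) hdim e u w hli H1 H2 H3 e1 u1 e2 w2 u3 w3 (hd _ G1) (hd _ G2)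
    (hd _ G3) Q1 Q2 Q3 (hq _ hH) eH uH wH

/-- Lemma: norms with many Euclidean sections: if `Γ` is a family of
2-dimensional subspaces of a 3-dimensional Banach–Minkowski space whose union has nonempty
interior and on each of which `Φ` restricts to a Euclidean norm, then there exists a
positive definite quadratic form `Q` on `V` with `Φ² = Q` on the union of the planes. -/
theorem statement13 (V : Type*) [NormedAddCommGroup V] [NormedSpace ℝ V]
    [FiniteDimensional ℝ V] (hdim : Module.finrank ℝ V = 3)
    (Φ : V → ℝ) (hΦ : IsBanachMinkowski Φ)
    (Γ : Set (Submodule ℝ V)) (hΓdim : ∀ H ∈ Γ, Module.finrank ℝ H = 2)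
    (hint : (interior (⋃ H ∈ Γ, (H : Set V))).Nonempty)
    (heucl : ∀ H ∈ Γ, ∃ q : QuadraticForm ℝ H, q.PosDef ∧
      ∀ v : H, Φ (v : V) ^ 2 = q v) :
    ∃ Q : QuadraticForm ℝ V, Q.PosDef ∧ ∀ v ∈ ⋃ H ∈ Γ, (H : Set V), Φ v ^ 2 = Q v := by
  obtain ⟨-, -, -, -, hsm, hpos⟩ := hΦ
  have hf : ∀ e : V, e ≠ 0 → ContDiffAt ℝ 2 (fun u => Φ u ^ 2) e := by
    intro e e0
    have h1 : ContDiffAt ℝ (⊤ : ℕ∞) Φ e :=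
      hsm.contDiffAt (isOpen_compl_singleton.mem_nhds e0)
    exact (h1.of_le (WithTop.coe_le_coe.2 (le_top : (2 : ℕ∞) ≤ ⊤))).pow 2
  have hq : ∀ H ∈ Γ, QuadOn (fun u => Φ u ^ 2) H := by
    intro H hH v hv w hw a b
    obtain ⟨q, -, hq⟩ := heucl H hH
    have := quadOn_form q ⟨v, hv⟩ ⟨w, hw⟩ a b
    simp only [← hq] at this
    exact this
  obtain ⟨Q, hQ⟩ := main_exists hdim (fun u => Φ u ^ 2) hf Γ hΓdim hq
  have hU : ∀ v ∈ ⋃ H ∈ Γ, (H : Set V), Φ v ^ 2 = Q v := by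
    intro v hv
    simp only [Set.mem_iUnion] at hv
    obtain ⟨H, hH, hv⟩ := hv
    exact hQ H hH v hv
  refine ⟨Q, ?_, hU⟩
  have hnt : Nontrivial V := Module.nontrivial_of_finrank_pos (R := ℝ) (by omega)
  have hne : (nhdsWithin (0 : V) {0}ᶜ).NeBot := Module.punctured_nhds_neBot ℝ V 0
  obtain ⟨e, he, e0⟩ := (dense_compl_singleton (0 : V)).inter_open_nonempty _
    isOpen_interior hint
  intro v v0
  have hp := hpos e e0 v v0
  rw [iteratedFDeriv_two_apply] at hp
  simp only [Matrix.cons_val_zero, Matrix.cons_val_one] at hp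
  rw [second_deriv _ e v (hf e e0) (Q e) (Q (e + v) - Q e - Q v) (Q v)] at hp
  · linarith
  · have hc : Filter.Tendsto (fun t : ℝ => e + t • v) (nhds 0) (nhds e) := by
      have : Continuous (fun t : ℝ => e + t • v) := by fun_prop
      simpa using this.tendsto 0
    filter_upwards [hc.eventually (isOpen_interior.mem_nhds he)] with t ht
    rw [hU _ (interior_subset ht)]
    have := quadOn_form Q e v 1 t
    rw [one_smul] at this
    rw [this]; ring
end
end

section
/- Let U ⊆ ℝ² be a nonempty connected open set and g a C^∞ Riemannian metric on U, i.e., a C^∞ map assigning to each x ∈ U a positive definite symmetric bilinear form g_x on ℝ². Let (V, Φ) be a 3-dimensional Banach–Minkowski space and f : U → V a C^∞ map such that Df_x is injective and Φ(Df_x(v))² = g_x(v, v) for all x ∈ U and v ∈ ℝ². Then there exists a positive definite quadratic form Q on V such that Q(Df_x(v)) = g_x(v, v) for all x ∈ U and v ∈ ℝ²; that is, f is isometric with respect to the Euclidean norm u ↦ √(Q(u)) on V. -/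
noncomputable section

section helpers
variable {V : Type*} [NormedAddCommGroup V] [NormedSpace ℝ V]

theorem hlp_three (F : V → ℝ) (Q R : QuadraticForm ℝ V) (K : V → Prop)
    (hR : ∀ v, K v → F v = R v) (u w : V) (s t : ℝ) (hs : s ≠ 0) (ht : t ≠ 0)
    (hKu : K u) (hKw : K w) (hK : K (s • u + t • w))
    (hu : F u = Q u) (hw : F w = Q w) (hx : F (s • u + t • w) = Q (s • u + t • w))
    (hspan : ∀ v, K v → ∃ a b : ℝ, v = a • u + b • w) : ∀ v, K v → F v = Q v := by
  intro v hv
  obtain ⟨a, b, rfl⟩ := hspan v hv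
  have e : ∀ (P : QuadraticForm ℝ V) (a b : ℝ), P (a • u + b • w)
      = a * a * P u + b * b * P w + a * b * QuadraticMap.polar P u w := by
    intro P a b
    rw [QuadraticMap.map_add P, QuadraticMap.map_smul, QuadraticMap.map_smul,
      QuadraticMap.polar_smul_left, QuadraticMap.polar_smul_right]
    simp only [smul_eq_mul]; ring
  rw [hR _ hv, e, e]
  rw [hR _ hK, e, e] at hx
  rw [hR _ hKu] at hu
  rw [hR _ hKw] at hw
  rw [hu, hw] at hx ⊢
  have : s * t * (QuadraticMap.polar R u w - QuadraticMap.polar Q u w) = 0 := by linarith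
  have h2 : QuadraticMap.polar R u w = QuadraticMap.polar Q u w := by
    have := (mul_eq_zero.1 this).resolve_left (mul_ne_zero hs ht)
    linarith
  rw [h2]

/-- dual bases -/
structure HlpDB (n1 n2 n3 : V →L[ℝ] ℝ) (e1 e2 e3 : V) : Prop where
  d11 : n1 e1 = 1
  d12 : n1 e2 = 0
  d13 : n1 e3 = 0
  d21 : n2 e1 = 0
  d22 : n2 e2 = 1
  d23 : n2 e3 = 0
  d31 : n3 e1 = 0
  d32 : n3 e2 = 0
  d33 : n3 e3 = 1
  dec : ∀ v, v = n1 v • e1 + n2 v • e2 + n3 v • e3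

theorem HlpDB.swap12 {n1 n2 n3 : V →L[ℝ] ℝ} {e1 e2 e3 : V} (h : HlpDB n1 n2 n3 e1 e2 e3) :
    HlpDB n2 n1 n3 e2 e1 e3 :=
  ⟨h.d22, h.d21, h.d23, h.d12, h.d11, h.d13, h.d32, h.d31, h.d33,
    fun v => (h.dec v).trans (by abel)⟩

theorem HlpDB.swap13 {n1 n2 n3 : V →L[ℝ] ℝ} {e1 e2 e3 : V} (h : HlpDB n1 n2 n3 e1 e2 e3) :
    HlpDB n3 n2 n1 e3 e2 e1 :=
  ⟨h.d33, h.d32, h.d31, h.d23, h.d22, h.d21, h.d13, h.d12, h.d11,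
    fun v => (h.dec v).trans (by abel)⟩

theorem HlpDB.app {n1 n2 n3 : V →L[ℝ] ℝ} {e1 e2 e3 : V} (h : HlpDB n1 n2 n3 e1 e2 e3)
    (ν : V →L[ℝ] ℝ) (v : V) : ν v = n1 v * ν e1 + n2 v * ν e2 + n3 v * ν e3 := by
  conv_lhs => rw [h.dec v]
  simp

theorem HlpDB.eq_zero {n1 n2 n3 : V →L[ℝ] ℝ} {e1 e2 e3 : V} (h : HlpDB n1 n2 n3 e1 e2 e3)
    (ν : V →L[ℝ] ℝ) (h1 : ν e1 = 0) (h2 : ν e2 = 0) (h3 : ν e3 = 0) : ν = 0 := by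
  ext v
  rw [h.app ν v, h1, h2, h3]; simp

/-- existence of Q for three planes -/
theorem hlp_exQ (F : V → ℝ) {n1 n2 n3 : V →L[ℝ] ℝ} {e1 e2 e3 : V}
    (h : HlpDB n1 n2 n3 e1 e2 e3)
    (H1 : ∃ R : QuadraticForm ℝ V, ∀ v, n1 v = 0 → F v = R v)
    (H2 : ∃ R : QuadraticForm ℝ V, ∀ v, n2 v = 0 → F v = R v)
    (H3 : ∃ R : QuadraticForm ℝ V, ∀ v, n3 v = 0 → F v = R v) :
    ∃ Q : QuadraticForm ℝ V, (∀ v, n1 v = 0 → F v = Q v) ∧ (∀ v, n2 v = 0 → F v = Q v) ∧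
      (∀ v, n3 v = 0 → F v = Q v) := by
  obtain ⟨R1, H1⟩ := H1
  obtain ⟨R2, H2⟩ := H2
  obtain ⟨R3, H3⟩ := H3
  let m (a b : V →L[ℝ] ℝ) : QuadraticForm ℝ V :=
    QuadraticMap.linMulLin a.toLinearMap b.toLinearMap
  refine ⟨F e1 • m n1 n1 + F e2 • m n2 n2 + F e3 • m n3 n3
    + (QuadraticMap.polar R3 e1 e2) • m n1 n2 + (QuadraticMap.polar R2 e1 e3) • m n1 n3
    + (QuadraticMap.polar R1 e2 e3) • m n2 n3, ?_, ?_, ?_⟩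
  all_goals
    intro v hv
    simp only [add_apply, smul_apply, m, QuadraticMap.linMulLin_apply,
      ContinuousLinearMap.coe_coe, smul_eq_mul]
  · rw [H1 v hv, H1 e2 h.d12, H1 e3 h.d13]
    conv_lhs => rw [h.dec v]
    simp only [QuadraticMap.map_add, QuadraticMap.map_smul, QuadraticMap.polar_smul_left, QuadraticMap.polar_smul_right, smul_eq_mul, hv, zero_smul, zero_add]
    ring
  · rw [H2 v hv, H2 e1 h.d21, H2 e3 h.d23]
    conv_lhs => rw [h.dec v]
    simp only [QuadraticMap.map_add, QuadraticMap.map_smul, QuadraticMap.polar_smul_left, QuadraticMap.polar_smul_right, smul_eq_mul, hv, zero_smul, add_zero]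
    ring
  · rw [H3 v hv, H3 e1 h.d31, H3 e2 h.d32]
    conv_lhs => rw [h.dec v]
    simp only [QuadraticMap.map_add, QuadraticMap.map_smul, QuadraticMap.polar_smul_left, QuadraticMap.polar_smul_right, smul_eq_mul, hv, zero_smul, add_zero]
    ring

/-- all coordinates nonzero -/
theorem hlp_good3 (F : V → ℝ) {n1 n2 n3 : V →L[ℝ] ℝ} {e1 e2 e3 : V}
    (h : HlpDB n1 n2 n3 e1 e2 e3) (Q : QuadraticForm ℝ V)
    (H1 : ∀ v, n1 v = 0 → F v = Q v) (H2 : ∀ v, n2 v = 0 → F v = Q v)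
    (H3 : ∀ v, n3 v = 0 → F v = Q v) (ν : V →L[ℝ] ℝ)
    (hν : ∃ R : QuadraticForm ℝ V, ∀ v, ν v = 0 → F v = R v)
    (h1 : ν e1 ≠ 0) (h2 : ν e2 ≠ 0) (h3 : ν e3 ≠ 0) : ∀ v, ν v = 0 → F v = Q v := by
  obtain ⟨R, hR⟩ := hν
  have hx : (-ν e1) • (ν e3 • e2 - ν e2 • e3) + ν e2 • (ν e3 • e1 - ν e1 • e3)
      = ν e3 • (ν e2 • e1 - ν e1 • e2) := by module
  refine hlp_three F Q R (fun v => ν v = 0) hR (ν e3 • e2 - ν e2 • e3) (ν e3 • e1 - ν e1 • e3)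
    (-ν e1) (ν e2) (neg_ne_zero.2 h1) h2 ?_ ?_ ?_ ?_ ?_ ?_ ?_
  · simp; ring
  · simp; ring
  · rw [hx]; simp; right; ring
  · apply H1; simp [h.d12, h.d13]
  · apply H2; simp [h.d21, h.d23]
  · rw [hx]; apply H3; simp [h.d31, h.d32]
  · intro v hv
    refine ⟨n2 v / ν e3, n1 v / ν e3, ?_⟩
    rw [h.app ν v] at hv
    have : n3 v = - (n1 v * ν e1 + n2 v * ν e2) / ν e3 := by field_simp; linarith
    conv_lhs => rw [h.dec v, this]
    match_scalars <;> field_simp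
    ring

/-- first coordinate zero, use fourth plane -/
theorem hlp_good2 (F : V → ℝ) {n1 n2 n3 : V →L[ℝ] ℝ} {e1 e2 e3 : V}
    (h : HlpDB n1 n2 n3 e1 e2 e3) (Q : QuadraticForm ℝ V)
    (H1 : ∀ v, n1 v = 0 → F v = Q v) (H2 : ∀ v, n2 v = 0 → F v = Q v)
    (n4 : V →L[ℝ] ℝ) (ha : n4 e1 ≠ 0)
    (H4 : ∀ v, n4 v = 0 → F v = Q v) (ν : V →L[ℝ] ℝ)
    (hν : ∃ R : QuadraticForm ℝ V, ∀ v, ν v = 0 → F v = R v)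
    (h1 : ν e1 = 0) (h3 : ν e3 ≠ 0)
    (hb : n4 e3 * ν e2 - n4 e2 * ν e3 ≠ 0) :
    ∀ v, ν v = 0 → F v = Q v := by
  obtain ⟨R, hR⟩ := hν
  refine hlp_three F Q R (fun v => ν v = 0) hR e1 (ν e3 • e2 - ν e2 • e3)
    (n4 e3 * ν e2 - n4 e2 * ν e3) (n4 e1) hb ha h1 ?_ ?_ ?_ ?_ ?_ ?_
  · simp; ring
  · simp [h1]; right; ring
  · apply H2; simp [h.d21]
  · apply H1; simp [h.d12, h.d13]
  · apply H4; simp; ring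
  · intro v hv
    refine ⟨n1 v, n2 v / ν e3, ?_⟩
    rw [h.app ν v] at hv
    have : n3 v = - (n2 v * ν e2) / ν e3 := by
      rw [h1] at hv
      field_simp; linarith
    conv_lhs => rw [h.dec v, this]
    match_scalars <;> field_simp

/-- parallel functionals -/
theorem hlp_par (F : V → ℝ) {n1 n2 n3 : V →L[ℝ] ℝ} {e1 e2 e3 : V}
    (h : HlpDB n1 n2 n3 e1 e2 e3) (Q : QuadraticForm ℝ V)
    (H3 : ∀ v, n3 v = 0 → F v = Q v) (ν : V →L[ℝ] ℝ)
    (h1 : ν e1 = 0) (h2 : ν e2 = 0) (h3 : ν e3 ≠ 0) : ∀ v, ν v = 0 → F v = Q v := by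
  intro v hv
  apply H3
  rw [h.app ν v, h1, h2] at hv
  simpa [h3] using hv

/-- Good unless one of three bad directions -/
theorem hlp_cover (F : V → ℝ) {n1 n2 n3 : V →L[ℝ] ℝ} {e1 e2 e3 : V}
    (h : HlpDB n1 n2 n3 e1 e2 e3) (Q : QuadraticForm ℝ V)
    (H1 : ∀ v, n1 v = 0 → F v = Q v) (H2 : ∀ v, n2 v = 0 → F v = Q v)
    (H3 : ∀ v, n3 v = 0 → F v = Q v)
    (n4 : V →L[ℝ] ℝ) (ha : n4 e1 ≠ 0) (hb : n4 e2 ≠ 0) (hc : n4 e3 ≠ 0)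
    (H4 : ∀ v, n4 v = 0 → F v = Q v) (ν : V →L[ℝ] ℝ) (hν0 : ν ≠ 0)
    (hν : ∃ R : QuadraticForm ℝ V, ∀ v, ν v = 0 → F v = R v) :
    (∀ v, ν v = 0 → F v = Q v) ∨ (ν e1 = 0 ∧ n4 e3 * ν e2 = n4 e2 * ν e3)
      ∨ (ν e2 = 0 ∧ n4 e3 * ν e1 = n4 e1 * ν e3) ∨ (ν e3 = 0 ∧ n4 e1 * ν e2 = n4 e2 * ν e1) := by
  by_cases h1 : ν e1 = 0
  · by_cases h3 : ν e3 = 0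
    · left
      by_cases h2 : ν e2 = 0
      · exact absurd (h.eq_zero ν h1 h2 h3) hν0
      · have h' : HlpDB n3 n1 n2 e3 e1 e2 := h.swap12.swap13
        exact hlp_par F h' Q H2 ν h3 h1 h2
    · by_cases hb' : n4 e3 * ν e2 = n4 e2 * ν e3
      · right; left; exact ⟨h1, hb'⟩
      · left
        exact hlp_good2 F h Q H1 H2 n4 ha H4 ν hν h1 h3 (sub_ne_zero.2 hb')
  · by_cases h2 : ν e2 = 0
    · by_cases h3 : ν e3 = 0
      · left; exact hlp_par F h.swap13 Q H1 ν h3 h2 h1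
      · by_cases hb' : n4 e3 * ν e1 = n4 e1 * ν e3
        · right; right; left; exact ⟨h2, hb'⟩
        · left
          exact hlp_good2 F h.swap12 Q H2 H1 n4 hb H4 ν hν h2 h3 (sub_ne_zero.2 hb')
    · by_cases h3 : ν e3 = 0
      · by_cases hb' : n4 e1 * ν e2 = n4 e2 * ν e1
        · right; right; right; exact ⟨h3, hb'⟩
        · left
          exact hlp_good2 F h.swap13 Q H3 H2 n4 hc H4 ν hν h3 h1 (sub_ne_zero.2 hb')
      · left; exact hlp_good3 F h Q H1 H2 H3 ν hν h1 h2 h3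

/-- bad directions do not occur -/
theorem hlp_nobad (F : V → ℝ) (hF : Continuous F) (N : Set (V →L[ℝ] ℝ)) (hN : IsPreconnected N)
    (hN0 : ∀ ν ∈ N, ν ≠ 0) {n1 n2 n3 : V →L[ℝ] ℝ} {e1 e2 e3 : V}
    (h : HlpDB n1 n2 n3 e1 e2 e3) (Q : QuadraticForm ℝ V) (hQ : Continuous Q)
    (hn1 : n1 ∈ N)
    (H1 : ∀ v, n1 v = 0 → F v = Q v)
    (n4 : V →L[ℝ] ℝ) (hb : n4 e2 ≠ 0) (hc : n4 e3 ≠ 0)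
    (hcov : ∀ ν ∈ N, (∀ v, ν v = 0 → F v = Q v) ∨ (ν e1 = 0 ∧ n4 e3 * ν e2 = n4 e2 * ν e3)
      ∨ (ν e2 = 0 ∧ n4 e3 * ν e1 = n4 e1 * ν e3) ∨ (ν e3 = 0 ∧ n4 e1 * ν e2 = n4 e2 * ν e1))
    (ν : V →L[ℝ] ℝ) (hν : ν ∈ N) (h1 : ν e1 = 0) (h2 : n4 e3 * ν e2 = n4 e2 * ν e3) :
    ∀ v, ν v = 0 → F v = Q v := by
  let S1 : Set (V →L[ℝ] ℝ) := {ν | ν e1 = 0 ∧ n4 e3 * ν e2 = n4 e2 * ν e3}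
  let S2 : Set (V →L[ℝ] ℝ) := {ν | ν e2 = 0 ∧ n4 e3 * ν e1 = n4 e1 * ν e3}
  let S3 : Set (V →L[ℝ] ℝ) := {ν | ν e3 = 0 ∧ n4 e1 * ν e2 = n4 e2 * ν e1}
  let G : Set (V →L[ℝ] ℝ) := {ν | ∀ w v, F (ν w • v - ν v • w) = Q (ν w • v - ν v • w)}
  have ev : ∀ v : V, Continuous (fun ν : V →L[ℝ] ℝ => ν v) := fun v => by fun_prop
  have cS1 : IsClosed S1 := (isClosed_eq (ev e1) continuous_const).inter
    (isClosed_eq (by fun_prop) (by fun_prop))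
  have cS2 : IsClosed S2 := (isClosed_eq (ev e2) continuous_const).inter
    (isClosed_eq (by fun_prop) (by fun_prop))
  have cS3 : IsClosed S3 := (isClosed_eq (ev e3) continuous_const).inter
    (isClosed_eq (by fun_prop) (by fun_prop))
  have cG : IsClosed G := by
    have : G = ⋂ w, ⋂ v, {ν | F (ν w • v - ν v • w) = Q (ν w • v - ν v • w)} := by
      ext; simp [G]
    rw [this]
    refine isClosed_iInter fun w => isClosed_iInter fun v => isClosed_eq ?_ ?_
    · exact hF.comp (by fun_prop)
    · exact hQ.comp (by fun_prop)
  have toG : ∀ ν : V →L[ℝ] ℝ, (∀ v, ν v = 0 → F v = Q v) → ν ∈ G := by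
    intro ν h w v
    apply h; simp; ring
  have ofG : ∀ ν : V →L[ℝ] ℝ, ν ≠ 0 → ν ∈ G → (∀ v, ν v = 0 → F v = Q v) := by
    intro ν h0 h v hv
    obtain ⟨w, hw⟩ : ∃ w, ν w ≠ 0 := by
      by_contra! hh; exact h0 (by ext v; simp [hh])
    have := h ((ν w)⁻¹ • w) v
    simpa [hv, hw] using this
  by_contra hbad
  obtain ⟨μ, hμN, hμ1, hμ2⟩ := (isPreconnected_closed_iff.1 hN) S1 (G ∪ (S2 ∪ S3)) cS1
    (cG.union (cS2.union cS3))
    (by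
      intro μ hμ
      rcases hcov μ hμ with h | h | h | h
      · exact Or.inr (Or.inl (toG μ h))
      · exact Or.inl h
      · exact Or.inr (Or.inr (Or.inl h))
      · exact Or.inr (Or.inr (Or.inr h)))
    ⟨ν, hν, h1, h2⟩ ⟨n1, hn1, Or.inl (toG _ H1)⟩
  obtain ⟨m1, m2⟩ := hμ1
  have hμ0 := hN0 μ hμN
  rcases hμ2 with hg | ⟨hg1, hg2⟩ | ⟨hg1, hg2⟩
  · apply hbad
    intro v hv
    apply ofG μ hμ0 hg
    have hν3 : ν e3 ≠ 0 := by
      intro h3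
      rw [h3, mul_zero] at h2
      exact hN0 ν hν (h.eq_zero ν h1 ((mul_eq_zero.1 h2).resolve_left hc) h3)
    rw [h.app ν v, h1] at hv
    rw [h.app μ v, m1]
    have e2' : ν e2 = n4 e2 * ν e3 / n4 e3 := by field_simp; linarith
    have e3' : μ e2 = n4 e2 * μ e3 / n4 e3 := by field_simp; linarith
    rw [e2'] at hv
    rw [e3']
    have : (n2 v * (n4 e2 / n4 e3) + n3 v) * ν e3 = 0 := by rw [← hv]; ring
    have := (mul_eq_zero.1 this).resolve_right hν3
    have h4 : n2 v * (n4 e2 * μ e3 / n4 e3) = n2 v * (n4 e2 / n4 e3) * μ e3 := by ring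
    rw [h4]
    linear_combination μ e3 * this
  · rw [hg1, mul_zero] at m2
    exact hμ0 (h.eq_zero μ m1 hg1 ((mul_eq_zero.1 m2.symm).resolve_left hb))
  · rw [hg1, mul_zero] at m2
    exact hμ0 (h.eq_zero μ m1 ((mul_eq_zero.1 m2).resolve_left hc) hg1)

theorem hlp_off (N : Set (V →L[ℝ] ℝ)) (hN : IsPreconnected N)
    (hN0 : ∀ ν ∈ N, ν ≠ 0) {n1 n2 n3 : V →L[ℝ] ℝ} {e1 e2 e3 : V}
    (h : HlpDB n1 n2 n3 e1 e2 e3) (hn1 : n1 ∈ N) (hn3 : n3 ∈ N) :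
    ∃ ν ∈ N, ν e3 ≠ 0 ∧ (ν e1 ≠ 0 ∨ ν e2 ≠ 0) := by
  by_contra! hc
  have ev : ∀ v : V, Continuous (fun ν : V →L[ℝ] ℝ => ν v) := fun v => by fun_prop
  obtain ⟨μ, hμN, hμ1, hμ2⟩ := (isPreconnected_closed_iff.1 hN) {ν | ν e3 = 0}
    {ν | ν e1 = 0 ∧ ν e2 = 0} (isClosed_eq (ev e3) continuous_const)
    ((isClosed_eq (ev e1) continuous_const).inter (isClosed_eq (ev e2) continuous_const))
    (by
      intro μ hμ
      by_cases h3 : μ e3 = 0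
      · exact Or.inl h3
      · exact Or.inr (hc μ hμ h3))
    ⟨n1, hn1, h.d13⟩ ⟨n3, hn3, h.d31, h.d32⟩
  exact hN0 μ hμN (h.eq_zero μ hμ2.1 hμ2.2 hμ1)

/-- N contains a quadrangle -/
def HlpQuad (N : Set (V →L[ℝ] ℝ)) : Prop :=
  ∃ (n1 n2 n3 : V →L[ℝ] ℝ) (e1 e2 e3 : V), HlpDB n1 n2 n3 e1 e2 e3 ∧ n1 ∈ N ∧ n2 ∈ N ∧ n3 ∈ N ∧
    ∃ n4 ∈ N, n4 e1 ≠ 0 ∧ n4 e2 ≠ 0 ∧ n4 e3 ≠ 0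

theorem hlp_q0 (N : Set (V →L[ℝ] ℝ)) {n1 n2 n3 : V →L[ℝ] ℝ} {e1 e2 e3 : V}
    (h : HlpDB n1 n2 n3 e1 e2 e3) (hn1 : n1 ∈ N) (hn2 : n2 ∈ N)
    (p : V →L[ℝ] ℝ) (hp : p ∈ N) (hp1 : p e1 ≠ 0) (hp2 : p e2 = 0) (hp3 : p e3 ≠ 0)
    (q : V →L[ℝ] ℝ) (hq : q ∈ N) (hq1 : q e1 = 0) (hq2 : q e2 ≠ 0) (hq3 : q e3 ≠ 0) :
    HlpQuad N := by
  refine ⟨n1, p, n2, e1 - (p e1 / p e3) • e3, (p e3)⁻¹ • e3, e2, ?_, hn1, hp, hn2, q, hq, ?_, ?_, hq2⟩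
  · constructor <;> (try simp [h.d11, h.d12, h.d13, h.d21, h.d22, h.d23, hp2, hp3])
    intro v
    rw [h.app p v, hp2]
    conv_lhs => rw [h.dec v]
    match_scalars <;> field_simp
    ring
  · simp [hq1, hp1, hp3, hq3]
  · simp [hp3, hq3]

theorem hlp_q1 (N : Set (V →L[ℝ] ℝ)) (hN : IsPreconnected N)
    (hN0 : ∀ ν ∈ N, ν ≠ 0) {n1 n2 n3 : V →L[ℝ] ℝ} {e1 e2 e3 : V}
    (h : HlpDB n1 n2 n3 e1 e2 e3) (hn1 : n1 ∈ N) (hn2 : n2 ∈ N) (hn3 : n3 ∈ N)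
    (p : V →L[ℝ] ℝ) (hp : p ∈ N) (hp1 : p e1 ≠ 0) (hp2 : p e2 = 0) (hp3 : p e3 ≠ 0) :
    HlpQuad N := by
  obtain ⟨q, hq, hq2, hq13⟩ := hlp_off N hN hN0 h.swap12.swap13 hn3 hn2
  by_cases hq1 : q e1 = 0
  · exact hlp_q0 N h hn1 hn2 p hp hp1 hp2 hp3 q hq hq1 hq2
      (hq13.resolve_right (fun h => h hq1))
  by_cases hq3 : q e3 = 0
  · exact hlp_q0 N h.swap13 hn3 hn2 p hp hp3 hp2 hp1 q hq hq3 hq2 hq1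
  exact ⟨n1, n2, n3, e1, e2, e3, h, hn1, hn2, hn3, q, hq, hq1, hq2, hq3⟩

theorem hlp_quad (N : Set (V →L[ℝ] ℝ)) (hN : IsPreconnected N)
    (hN0 : ∀ ν ∈ N, ν ≠ 0) {n1 n2 n3 : V →L[ℝ] ℝ} {e1 e2 e3 : V}
    (h : HlpDB n1 n2 n3 e1 e2 e3) (hn1 : n1 ∈ N) (hn2 : n2 ∈ N) (hn3 : n3 ∈ N) :
    HlpQuad N := by
  obtain ⟨p, hp, hp3, hp12⟩ := hlp_off N hN hN0 h hn1 hn3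
  by_cases hp1 : p e1 = 0
  · exact hlp_q1 N hN hN0 h.swap12 hn2 hn1 hn3 p hp (hp12.resolve_left (fun h => h hp1)) hp1 hp3
  by_cases hp2 : p e2 = 0
  · exact hlp_q1 N hN hN0 h hn1 hn2 hn3 p hp hp1 hp2 hp3
  exact ⟨n1, n2, n3, e1, e2, e3, h, hn1, hn2, hn3, p, hp, hp1, hp2, hp3⟩

theorem hlp_exDB [FiniteDimensional ℝ V] (hdim : Module.finrank ℝ V = 3)
    (N : Set (V →L[ℝ] ℝ)) (hne : N.Nonempty) (hN0 : ∀ ν ∈ N, ν ≠ 0)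
    (hno : ∀ e : V, e ≠ 0 → ∃ ν ∈ N, ν e ≠ 0) :
    ∃ n1 ∈ N, ∃ n2 ∈ N, ∃ n3 ∈ N, ∃ e1 e2 e3 : V, HlpDB n1 n2 n3 e1 e2 e3 := by
  have key : ∀ n m : V →L[ℝ] ℝ, ∃ e : V, e ≠ 0 ∧ n e = 0 ∧ m e = 0 := by
    intro n m
    have := LinearMap.ker_ne_bot_of_finrank_lt (f := n.toLinearMap.prod m.toLinearMap)
      (by simp [hdim])
    obtain ⟨e, he, he0⟩ := Submodule.exists_mem_ne_zero_of_ne_bot this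
    simp at he
    exact ⟨e, he0, he.1, he.2⟩
  obtain ⟨n1, hn1⟩ := hne
  obtain ⟨a, ha⟩ : ∃ a, n1 a ≠ 0 := by
    by_contra! hh; exact hN0 n1 hn1 (by ext v; simp [hh])
  obtain ⟨b, hb0, hb1, -⟩ := key n1 n1
  obtain ⟨n2, hn2, hb2⟩ := hno b hb0
  obtain ⟨c, hc0, hc1, hc2⟩ := key n1 n2
  obtain ⟨n3, hn3, hc3⟩ := hno c hc0
  obtain ⟨e3, h13, h23, h33⟩ : ∃ e3, n1 e3 = 0 ∧ n2 e3 = 0 ∧ n3 e3 = 1 :=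
    ⟨(n3 c)⁻¹ • c, by simp [hc1], by simp [hc2], by simp [hc3]⟩
  obtain ⟨e2, h12, h22, h32⟩ : ∃ e2, n1 e2 = 0 ∧ n2 e2 = 1 ∧ n3 e2 = 0 :=
    ⟨(n2 b)⁻¹ • (b - n3 b • e3), by simp [hb1, h13], by simp [hb2, h23], by simp [h33]⟩
  obtain ⟨e1, h11, h21, h31⟩ : ∃ e1, n1 e1 = 1 ∧ n2 e1 = 0 ∧ n3 e1 = 0 :=
    ⟨(n1 a)⁻¹ • (a - n2 a • e2 - n3 a • e3), by simp [ha, h12, h13], by simp [h22, h23],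
      by simp [h32, h33]⟩
  refine ⟨n1, hn1, n2, hn2, n3, hn3, e1, e2, e3, h11, h12, h13, h21, h22, h23, h31, h32, h33, ?_⟩
  let T : V →ₗ[ℝ] (ℝ × ℝ × ℝ) := n1.toLinearMap.prod (n2.toLinearMap.prod n3.toLinearMap)
  have hT : Function.Injective T := by
    rw [LinearMap.injective_iff_surjective_of_finrank_eq_finrank (by simp [hdim])]
    rintro ⟨x, y, z⟩
    refine ⟨x • e1 + y • e2 + z • e3, ?_⟩
    simp [T, *]
  intro v
  apply hT
  simp [T, *]

theorem hlp_alg [FiniteDimensional ℝ V] (hdim : Module.finrank ℝ V = 3)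
    (F : V → ℝ) (hF : Continuous F) (N : Set (V →L[ℝ] ℝ)) (hN : IsPreconnected N)
    (hne : N.Nonempty) (hN0 : ∀ ν ∈ N, ν ≠ 0)
    (hno : ∀ e : V, e ≠ 0 → ∃ ν ∈ N, ν e ≠ 0)
    (hR : ∀ ν ∈ N, ∃ R : QuadraticForm ℝ V, ∀ v, ν v = 0 → F v = R v) :
    ∃ Q : QuadraticForm ℝ V, (∀ ν ∈ N, ∀ v, ν v = 0 → F v = Q v) ∧
      ∃ n1 ∈ N, ∃ n2 ∈ N, ∃ v, n1 v < 0 ∧ 0 < n2 v := by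
  obtain ⟨n1, hn1, n2, hn2, n3, hn3, e1, e2, e3, h⟩ := hlp_exDB hdim N hne hN0 hno
  obtain ⟨n1, n2, n3, e1, e2, e3, h, hn1, hn2, hn3, n4, hn4, ha, hb, hc⟩ :=
    hlp_quad N hN hN0 h hn1 hn2 hn3
  obtain ⟨Q, H1, H2, H3⟩ := hlp_exQ F h (hR _ hn1) (hR _ hn2) (hR _ hn3)
  have H4 := hlp_good3 F h Q H1 H2 H3 n4 (hR _ hn4) ha hb hc
  have hQ : Continuous Q := by
    have hq : ∀ v, Q v = (QuadraticMap.associated (R := ℝ) Q) v v := fun v =>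
      (QuadraticMap.associated_eq_self_apply ℝ Q v).symm
    have : (Q : V → ℝ) = fun v => (QuadraticMap.associated (R := ℝ) Q).toContinuousBilinearMap v v := by
      ext v; simpa using hq v
    rw [this]
    fun_prop
  have hcov := fun ν hν => hlp_cover F h Q H1 H2 H3 n4 ha hb hc H4 ν (hN0 ν hν) (hR ν hν)
  refine ⟨Q, ?_, n1, hn1, n2, hn2, e2 - e1, by simp [h.d11, h.d12], by simp [h.d21, h.d22]⟩
  intro ν hν
  rcases hcov ν hν with h' | ⟨h1, h2⟩ | ⟨h1, h2⟩ | ⟨h1, h2⟩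
  · exact h'
  · exact hlp_nobad F hF N hN hN0 h Q hQ hn1 H1 n4 hb hc hcov ν hν h1 h2
  · refine hlp_nobad F hF N hN hN0 h.swap12 Q hQ hn2 H2 n4 ha hc ?_ ν hν h1 h2
    intro μ hμ
    rcases hcov μ hμ with g | g | g | g
    · exact Or.inl g
    · exact Or.inr (Or.inr (Or.inl g))
    · exact Or.inr (Or.inl g)
    · exact Or.inr (Or.inr (Or.inr ⟨g.1, g.2.symm⟩))
  · refine hlp_nobad F hF N hN hN0 h.swap13 Q hQ hn3 H3 n4 hb ha ?_ ν hν h1 h2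
    intro μ hμ
    rcases hcov μ hμ with g | g | g | g
    · exact Or.inl g
    · exact Or.inr (Or.inr (Or.inr ⟨g.1, g.2⟩))
    · exact Or.inr (Or.inr (Or.inl ⟨g.1, g.2.symm⟩))
    · exact Or.inr (Or.inl g)

/-- second derivative along a line -/
theorem hlp_hess (F : V → ℝ) (e u : V) (hF : ContDiffAt ℝ 2 F e) (a b c : ℝ)
    (h : ∀ᶠ t : ℝ in nhds 0, F (e + t • u) = a + b * t + c * t ^ 2) :
    fderiv ℝ (fderiv ℝ F) e u u = 2 * c := by
  have hline : ∀ t : ℝ, HasDerivAt (fun t : ℝ => e + t • u) u t := by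
    intro t
    simpa using ((hasDerivAt_id t).smul_const u).const_add e
  have hcont : Filter.Tendsto (fun t : ℝ => e + t • u) (nhds 0) (nhds e) := by
    have := (hline 0).continuousAt.tendsto
    simpa using this
  have hdiff : ∀ᶠ x in nhds e, DifferentiableAt ℝ F x := by
    filter_upwards [hF.eventually (by simp)] with x hx
    exact hx.differentiableAt (by simp)
  have h1 : ∀ᶠ t : ℝ in nhds 0, fderiv ℝ F (e + t • u) u = b + 2 * c * t := by
    filter_upwards [h.eventually_nhds, hcont.eventually hdiff] with t ht hd
    have d1 : HasDerivAt (fun t : ℝ => F (e + t • u)) (fderiv ℝ F (e + t • u) u) t :=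
      hd.hasFDerivAt.comp_hasDerivAt t (hline t)
    have d2 : HasDerivAt (fun t : ℝ => a + b * t + c * t ^ 2) (b + 2 * c * t) t := by
      have := (((hasDerivAt_id' t).const_mul b).const_add a).add ((hasDerivAt_pow 2 t).const_mul c)
      exact this.congr_deriv (by push_cast; ring)
    exact d1.unique (d2.congr_of_eventuallyEq ht)
  have hd : DifferentiableAt ℝ (fderiv ℝ F) e :=
    (hF.fderiv_right (m := 1) (by norm_num)).differentiableAt (by simp)
  have hd' : HasFDerivAt (fderiv ℝ F) (fderiv ℝ (fderiv ℝ F) e) (e + (0 : ℝ) • u) := by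
    simpa using hd.hasFDerivAt
  have d0 : HasDerivAt (fun t : ℝ => fderiv ℝ F (e + t • u)) (fderiv ℝ (fderiv ℝ F) e u) 0 :=
    hd'.comp_hasDerivAt (0 : ℝ) (hline 0)
  have d1 : HasDerivAt (fun t : ℝ => fderiv ℝ F (e + t • u) u) (fderiv ℝ (fderiv ℝ F) e u u) 0 := by
    have := d0.clm_apply (hasDerivAt_const (0 : ℝ) u)
    exact this.congr_deriv (by rw [map_zero, add_zero])
  have d2 : HasDerivAt (fun t : ℝ => b + 2 * c * t) (2 * c) 0 := by
    have := ((hasDerivAt_id' (0 : ℝ)).const_mul (2 * c)).const_add b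
    exact this.congr_deriv (by ring)
  exact d1.unique (d2.congr_of_eventuallyEq h1)

theorem hlp_qline (R : QuadraticForm ℝ V) (e u : V) (t : ℝ) :
    R (e + t • u) = R e + QuadraticMap.polar R e u * t + R u * t ^ 2 := by
  rw [QuadraticMap.map_add R, QuadraticMap.map_smul, QuadraticMap.polar_smul_right]
  simp only [smul_eq_mul]; ring

theorem hlp_main [FiniteDimensional ℝ V] (hdim : Module.finrank ℝ V = 3)
    (F : V → ℝ) (hF : Continuous F) (hF2 : ∀ e, e ≠ 0 → ContDiffAt ℝ 2 F e)
    (hpos : ∀ e : V, e ≠ 0 → ∀ u, u ≠ 0 → 0 < fderiv ℝ (fderiv ℝ F) e u u)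
    (N : Set (V →L[ℝ] ℝ)) (hN : IsPreconnected N)
    (hne : N.Nonempty) (hN0 : ∀ ν ∈ N, ν ≠ 0)
    (hR : ∀ ν ∈ N, ∃ R : QuadraticForm ℝ V, ∀ v, ν v = 0 → F v = R v) :
    ∃ Q : QuadraticForm ℝ V, Q.PosDef ∧ (∀ ν ∈ N, ∀ v, ν v = 0 → F v = Q v) := by
  by_cases hno : ∀ e : V, e ≠ 0 → ∃ ν ∈ N, ν e ≠ 0
  · obtain ⟨Q, hQ, n1, hn1, n2, hn2, v, hv1, hv2⟩ := hlp_alg hdim F hF N hN hne hN0 hno hR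
    refine ⟨Q, ?_, hQ⟩
    intro u hu
    have hv0 : v ≠ 0 := by rintro rfl; simp at hv2
    have hev : ∀ᶠ w in nhds v, F w = Q w := by
      have o1 : ∀ᶠ w in nhds v, n1 w < 0 := n1.continuous.continuousAt.eventually_lt_const hv1
      have o2 : ∀ᶠ w in nhds v, 0 < n2 w := n2.continuous.continuousAt.eventually_const_lt hv2
      filter_upwards [o1, o2] with w hw1 hw2
      have himg : IsPreconnected ((fun ν : V →L[ℝ] ℝ => ν w) '' N) :=
        hN.image _ (by fun_prop)
      obtain ⟨ν, hν, hνw⟩ := himg.Icc_subset ⟨n1, hn1, rfl⟩ ⟨n2, hn2, rfl⟩ ⟨hw1.le, hw2.le⟩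
      exact hQ ν hν w hνw
    have hcont : Filter.Tendsto (fun t : ℝ => v + t • u) (nhds 0) (nhds v) := by
      have : Continuous (fun t : ℝ => v + t • u) := by fun_prop
      simpa using this.tendsto 0
    have := hlp_hess F v u (hF2 v hv0) (Q v) (QuadraticMap.polar Q v u) (Q u) (by
      filter_upwards [hcont.eventually hev] with t ht
      rw [ht, hlp_qline])
    have h2 := hpos v hv0 u hu
    linarith
  · push Not at hno
    obtain ⟨e, he, hcom⟩ := hno
    let B : LinearMap.BilinMap ℝ V ℝ := (2⁻¹ : ℝ) • 
      (ContinuousLinearMap.coeLM ℝ).comp (fderiv ℝ (fderiv ℝ F) e).toLinearMap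
    have hB : ∀ u, B.toQuadraticMap u = 2⁻¹ * fderiv ℝ (fderiv ℝ F) e u u := by
      intro u; simp [B]
    refine ⟨B.toQuadraticMap, ?_, ?_⟩
    · intro u hu
      rw [hB]
      have := hpos e he u hu
      positivity
    · intro ν hν u hu
      obtain ⟨R, hR⟩ := hR ν hν
      rw [hB, hlp_hess F e u (hF2 e he) (R e) (QuadraticMap.polar R e u) (R u), hR u hu]
      · ring
      · filter_upwards with t
        rw [hR, hlp_qline]
        simp [hcom ν hν, hu]

end helpers

theorem hlp_cont {V : Type*} [NormedAddCommGroup V] [NormedSpace ℝ V] [FiniteDimensional ℝ V]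
    (Φ : V → ℝ) (hΦ : IsBanachMinkowski Φ) : Continuous Φ := by
  obtain ⟨-, -, hh, hadd, -, -⟩ := hΦ
  have hc : ConvexOn ℝ Set.univ Φ := by
    refine ⟨convex_univ, ?_⟩
    intro x _ y _ a b ha hb _
    calc Φ (a • x + b • y) ≤ Φ (a • x) + Φ (b • y) := hadd _ _
      _ = a • Φ x + b • Φ y := by rw [hh a ha, hh b hb]; rfl
  exact continuousOn_univ.1 (hc.continuousOn isOpen_univ)

open Matrix in
theorem hlp_normal {V : Type*} [NormedAddCommGroup V] [NormedSpace ℝ V] [FiniteDimensional ℝ V]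
    (hdim : Module.finrank ℝ V = 3) :
    ∃ n : ((ℝ × ℝ) →L[ℝ] V) → (V →L[ℝ] ℝ), Continuous n ∧
      ∀ A : (ℝ × ℝ) →L[ℝ] V, Function.Injective A → n A ≠ 0 ∧ ∀ v, n A v = 0 ↔ ∃ w, A w = v := by
  let b := Module.finBasisOfFinrankEq ℝ V hdim
  let T : V ≃L[ℝ] (Fin 3 → ℝ) := b.equivFunL
  let c : ((ℝ × ℝ) →L[ℝ] V) → (Fin 3 → ℝ) := fun A => T (A (1, 0)) ⨯₃ T (A (0, 1))
  let n : ((ℝ × ℝ) →L[ℝ] V) → (V →L[ℝ] ℝ) := fun A =>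
    ∑ i, c A i • (ContinuousLinearMap.proj (R := ℝ) (φ := fun _ : Fin 3 => ℝ) i).comp
      (T : V →L[ℝ] (Fin 3 → ℝ))
  have hn : ∀ A v, n A v = T v ⬝ᵥ c A := by
    intro A v
    simp [n, dotProduct, Fin.sum_univ_three, mul_comm]
  refine ⟨n, ?_, ?_⟩
  · have hc : Continuous c := by
      refine continuous_pi fun i => ?_
      have hT : ∀ (w : ℝ × ℝ) (i : Fin 3),
          Continuous fun A : (ℝ × ℝ) →L[ℝ] V => T (A w) i := by
        intro w i
        exact (continuous_apply i).comp (T.continuous.comp (by fun_prop))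
      have h1 := hT (1, 0)
      have h2 := hT (0, 1)
      simp only [c, cross_apply]
      fin_cases i <;> simp <;> 
      exact ((h1 _).mul (h2 _)).sub ((h1 _).mul (h2 _))
    refine continuous_finsetSum _ fun i _ => ?_
    exact ((continuous_apply i).comp hc).smul continuous_const
  · intro A hA
    have hc0 : c A ≠ 0 := by
      simp only [c]
      rw [crossProduct_ne_zero_iff_linearIndependent, LinearIndependent.pair_iff]
      intro s t hst
      have : T (A (s, t)) = 0 := by
        rw [← hst, ← map_smul, ← map_smul, ← map_smul, ← map_smul, ← map_add, ← map_add]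
        simp
      have h2 : A (s, t) = A 0 := by
        rw [map_zero]; exact (map_eq_zero_iff T T.injective).1 this
      have := hA h2
      simpa using this
    have hn0 : n A ≠ 0 := by
      intro h0
      apply hc0
      have : T (T.symm (c A)) ⬝ᵥ c A = 0 := by rw [← hn, h0]; rfl
      simpa using this
    refine ⟨hn0, ?_⟩
    have hle : LinearMap.range A.toLinearMap ≤ LinearMap.ker (n A).toLinearMap := by
      rintro _ ⟨w, rfl⟩
      have hw : A w = w.1 • A (1, 0) + w.2 • A (0, 1) := by
        rw [← map_smul, ← map_smul, ← map_add]; simp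
      simp only [LinearMap.mem_ker, ContinuousLinearMap.coe_coe]
      rw [hn, hw, map_add, map_smul, map_smul, add_dotProduct, smul_dotProduct, smul_dotProduct]
      simp only [c, dot_self_cross, dot_cross_self]
      simp
    have hr : Module.finrank ℝ (LinearMap.range A.toLinearMap) = 2 := by
      rw [LinearMap.finrank_range_of_inj hA]; simp
    have hk : Module.finrank ℝ (LinearMap.ker (n A).toLinearMap) = 2 := by
      have h1 := (n A).toLinearMap.finrank_range_add_finrank_ker
      have h2 : LinearMap.range (n A).toLinearMap = ⊤ := by
        apply LinearMap.range_eq_top.2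
        apply LinearMap.surjective
        intro h; apply hn0; ext v; exact congrArg (fun l => l v) h
      rw [h2, finrank_top, hdim] at h1
      simp at h1
      omega
    have heq := Submodule.eq_of_le_of_finrank_eq hle (hr.trans hk.symm)
    intro v
    have : v ∈ LinearMap.ker (n A).toLinearMap ↔ v ∈ LinearMap.range A.toLinearMap := by rw [heq]
    simpa using this

/-- Proposition: Riemannian surfaces in Banach–Minkowski 3-space: if a
connected Riemannian surface `(U, g)` is isometrically immersed by `f` into a
3-dimensional Banach–Minkowski space `(V, Φ)`, then there is a positive definite quadratic
form `Q` on `V` such that `f` is isometric for the Euclidean norm `√Q`. -/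
theorem statement15 (U : Set (ℝ × ℝ)) (hUne : U.Nonempty) (hUopen : IsOpen U)
    (hUconn : IsConnected U)
    (g : (ℝ × ℝ) → ((ℝ × ℝ) →L[ℝ] ((ℝ × ℝ) →L[ℝ] ℝ)))
    (hgsmooth : ContDiffOn ℝ (⊤ : ℕ∞) g U)
    (hgsymm : ∀ x ∈ U, ∀ v w : ℝ × ℝ, g x v w = g x w v)
    (hgpos : ∀ x ∈ U, ∀ v : ℝ × ℝ, v ≠ 0 → 0 < g x v v)
    (V : Type*) [NormedAddCommGroup V] [NormedSpace ℝ V] [FiniteDimensional ℝ V]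
    (hdim : Module.finrank ℝ V = 3)
    (Φ : V → ℝ) (hΦ : IsBanachMinkowski Φ)
    (f : ℝ × ℝ → V) (hfsmooth : ContDiffOn ℝ (⊤ : ℕ∞) f U)
    (hfinj : ∀ x ∈ U, Function.Injective ⇑(fderiv ℝ f x))
    (hfiso : ∀ x ∈ U, ∀ v : ℝ × ℝ, Φ (fderiv ℝ f x v) ^ 2 = g x v v) :
    ∃ Q : QuadraticForm ℝ V, Q.PosDef ∧
      ∀ x ∈ U, ∀ v : ℝ × ℝ, Q (fderiv ℝ f x v) = g x v v := by
  obtain ⟨n, hn, hnA⟩ := hlp_normal hdim (V := V)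
  have hcΦ := hlp_cont Φ hΦ
  obtain ⟨-, -, -, -, hsm, hpd⟩ := hΦ
  have hF2 : ∀ e : V, e ≠ 0 → ContDiffAt ℝ 2 (fun u => Φ u ^ 2) e := by
    intro e he
    have h1 : ContDiffAt ℝ (⊤ : ℕ∞) Φ e :=
      hsm.contDiffAt (isOpen_compl_singleton.mem_nhds he)
    exact (contDiffAt_infty.1 h1 2).pow 2
  have hcD : ContinuousOn (fderiv ℝ f) U :=
    hfsmooth.continuousOn_fderiv_of_isOpen hUopen (by simp)
  obtain ⟨Q, hQ, hQN⟩ := hlp_main hdim (fun u => Φ u ^ 2) (by fun_prop) hF2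
    (by
      intro e he u hu
      have := hpd e he u hu
      rw [iteratedFDeriv_two_apply] at this
      simpa using this)
    ((fun x => n (fderiv ℝ f x)) '' U)
    (hUconn.isPreconnected.image _ (hn.comp_continuousOn hcD))
    (hUne.image _)
    (by rintro _ ⟨x, hx, rfl⟩; exact (hnA _ (hfinj x hx)).1)
    (by
      rintro _ ⟨x, hx, rfl⟩
      obtain ⟨L, hL⟩ := (fderiv ℝ f x).toLinearMap.exists_leftInverse_of_injective
        (LinearMap.ker_eq_bot.2 (hfinj x hx))
      let B : LinearMap.BilinMap ℝ (ℝ × ℝ) ℝ :=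
        (ContinuousLinearMap.coeLM ℝ).comp (g x).toLinearMap
      refine ⟨B.toQuadraticMap.comp L, ?_⟩
      intro v hv
      obtain ⟨w, rfl⟩ := ((hnA _ (hfinj x hx)).2 v).1 hv
      have hw : L (fderiv ℝ f x w) = w := congrArg (fun l => l w) hL
      simp [B, hw, hfiso x hx w])
  refine ⟨Q, hQ, ?_⟩
  intro x hx v
  rw [← hfiso x hx v]
  exact (hQN _ ⟨x, hx, rfl⟩ _ (((hnA _ (hfinj x hx)).2 _).2 ⟨v, rfl⟩)).symm
end
end

section
/- Let φ be a Finsler metric on an open set U ⊆ ℝ² that is monochromatic: for all x, y ∈ U there is a linear bijection A : ℝ² → ℝ² with φ(y, A(v)) = φ(x, v) for all v ∈ ℝ². Let p ∈ U and, for i = 1, 2, let (V_i, Φ_i) be a 3-dimensional Banach–Minkowski space and f_i : U → V_i an isometric embedding of (U, φ). For each i choose a nonzero λ_i ∈ V_i* vanishing on range(D(f_i)_p) and set S_i(v, w) := λ_i(D²(f_i)_p(v, w)) and d_i := S_i(e₁,e₁)·S_i(e₂,e₂) − S_i(e₁,e₂)², where e₁, e₂ is the standard basis of ℝ². Then d₁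 > 0 if and only if d₂ > 0, and d₁ = 0 if and only if d₂ = 0; equivalently, the second fundamental forms of f₁ and f₂ at p are of the same type (both definite, both degenerate, or both indefinite). -/
noncomputable section

def IsFinslerMetric (U : Set (ℝ × ℝ)) (φ : ℝ × ℝ → ℝ × ℝ → ℝ) : Prop :=
  ContDiffOn ℝ (⊤ : ℕ∞) (fun q : (ℝ × ℝ) × ℝ × ℝ => φ q.1 q.2) (U ×ˢ {(0 : ℝ × ℝ)}ᶜ) ∧
  ∀ x ∈ U, IsBanachMinkowski (φ x)

def IsIsometricEmbedding (U : Set (ℝ × ℝ)) (φ : ℝ × ℝ → ℝ × ℝ → ℝ)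
    {V : Type*} [NormedAddCommGroup V] [NormedSpace ℝ V] (Φ : V → ℝ)
    (f : ℝ × ℝ → V) : Prop :=
  ContDiffOn ℝ (⊤ : ℕ∞) f U ∧ Set.InjOn f U ∧ ∀ x ∈ U, ∀ v : ℝ × ℝ, Φ (fderiv ℝ f x v) = φ x v


open Set Filter Topology

lemma chain2 {W : Type*} [NormedAddCommGroup W] [NormedSpace ℝ W] (F : W → ℝ) (g : ℝ → W)
    (hF : ContDiffAt ℝ 2 F (g 0)) (hg : ContDiffAt ℝ 2 g 0) :
    deriv (fun t => F (g t)) 0 = fderiv ℝ F (g 0) (deriv g 0) ∧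
    deriv (deriv (fun t => F (g t))) 0 =
      fderiv ℝ (fderiv ℝ F) (g 0) (deriv g 0) (deriv g 0)
        + fderiv ℝ F (g 0) (deriv (deriv g) 0) := by
  have h1 : ∀ᶠ t in 𝓝 (0:ℝ), deriv (fun t => F (g t)) t = fderiv ℝ F (g t) (deriv g t) := by
    have e1 := (hF.eventually (by simp))
    have e2 := hg.continuousAt.eventually e1
    have e3 := hg.eventually (by simp)
    filter_upwards [e2, e3] with t a b
    exact ((a.differentiableAt (by simp)).hasFDerivAt.comp_hasDerivAt t
      (b.differentiableAt (by simp)).hasDerivAt).deriv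
  refine ⟨h1.self_of_nhds, ?_⟩
  rw [Filter.EventuallyEq.deriv_eq h1]
  have hF' : ContDiffAt ℝ 1 (fderiv ℝ F) (g 0) := hF.fderiv_right (by norm_num)
  have hg' : ContDiffAt ℝ 1 (deriv g) 0 := by
    have := hg.fderiv_right (m := 1) (by norm_num)
    have h2 := this.clm_apply (contDiffAt_const (c := (1:ℝ)))
    exact h2
  have a := (hF'.differentiableAt (by simp)).hasFDerivAt.comp_hasDerivAt (0:ℝ)
      (hg.differentiableAt (by simp)).hasDerivAt
  have b := (hg'.differentiableAt (by simp)).hasDerivAt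
  exact (a.clm_apply b).deriv

lemma curve2 {W : Type*} [NormedAddCommGroup W] [NormedSpace ℝ W]
    (h : ℝ × ℝ → (ℝ × ℝ →L[ℝ] W)) (p k v : ℝ × ℝ) (hh : ContDiffAt ℝ 2 h p) :
    ContDiffAt ℝ 2 (fun t : ℝ => h (p + t • k) v) 0 ∧
    deriv (fun t : ℝ => h (p + t • k) v) 0 = fderiv ℝ h p k v ∧
    deriv (deriv (fun t : ℝ => h (p + t • k) v)) 0 = fderiv ℝ (fderiv ℝ h) p k k v := by
  have hl : ∀ t : ℝ, HasDerivAt (fun t : ℝ => p + t • k) k t := by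
    intro t
    have := ((hasDerivAt_id t).smul_const k).const_add p
    simpa using this
  have hlc : ContDiff ℝ 2 (fun t : ℝ => p + t • k) := by fun_prop
  have h0 : p + (0:ℝ) • k = p := by simp
  have hh0 : ContDiffAt ℝ 2 h (p + (0:ℝ) • k) := by rw [h0]; exact hh
  have h1 : ∀ᶠ t in 𝓝 (0:ℝ), deriv (fun t : ℝ => h (p + t • k) v) t
      = fderiv ℝ h (p + t • k) k v := by
    have e1 := hh0.eventually (by simp)
    have e2 := (hlc.continuous.continuousAt (x := (0:ℝ))).eventually e1
    filter_upwards [e2] with t a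
    have := (a.differentiableAt (by simp)).hasFDerivAt.comp_hasDerivAt t (hl t)
    have := this.clm_apply (hasDerivAt_const t v)
    simpa using this.deriv
  refine ⟨?_, ?_, ?_⟩
  · have := hh0.comp (0:ℝ) hlc.contDiffAt
    exact this.clm_apply contDiffAt_const
  · simpa using h1.self_of_nhds
  · rw [Filter.EventuallyEq.deriv_eq h1]
    have hF' : ContDiffAt ℝ 1 (fderiv ℝ h) (p + (0:ℝ) • k) := hh0.fderiv_right (by norm_num)
    have := (hF'.differentiableAt (by simp)).hasFDerivAt.comp_hasDerivAt (0:ℝ) (hl 0)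
    have := this.clm_apply (hasDerivAt_const (0:ℝ) k)
    have := this.clm_apply (hasDerivAt_const (0:ℝ) v)
    simpa using this.deriv

structure Hom2 (F : ℝ × ℝ → ℝ) : Prop where
  pos : ∀ v, v ≠ 0 → 0 < F v
  hom : ∀ t : ℝ, 0 ≤ t → ∀ v, F (t • v) = t ^ 2 * F v
  smooth : ∀ v, v ≠ 0 → ContDiffAt ℝ 2 F v

def IsQuad (F : ℝ × ℝ → ℝ) : Prop :=
  ∃ a b c : ℝ, ∀ v, F v = a * v.1 ^ 2 + b * (v.1 * v.2) + c * v.2 ^ 2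

lemma Hom2.diff {F : ℝ × ℝ → ℝ} (h : Hom2 F) {v} (hv : v ≠ 0) : DifferentiableAt ℝ F v :=
  (h.smooth v hv).differentiableAt (by simp)

lemma Hom2.cont {F : ℝ × ℝ → ℝ} (h : Hom2 F) {v} (hv : v ≠ 0) :
    ContinuousAt (fderiv ℝ F) v :=
  ((h.smooth v hv).fderiv_right (m := 1) (by norm_num)).continuousAt

lemma Hom2.euler {F : ℝ × ℝ → ℝ} (h : Hom2 F) {v} (hv : v ≠ 0) :
    fderiv ℝ F v v = 2 * F v := by
  have h1 : HasDerivAt (fun t : ℝ => t • v) v 1 := by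
    simpa using (hasDerivAt_id (1:ℝ)).smul_const v
  have hd : HasFDerivAt F (fderiv ℝ F v) ((1:ℝ) • v) := by
    rw [one_smul]; exact (h.diff hv).hasFDerivAt
  have h2 := hd.comp_hasDerivAt (1:ℝ) h1
  have h3 : HasDerivAt (fun t : ℝ => t ^ 2 * F v) (2 * F v) 1 := by
    simpa using (hasDerivAt_pow 2 (1:ℝ)).mul_const (F v)
  have h4 : (fun t : ℝ => t ^ 2 * F v) =ᶠ[𝓝 1] (F ∘ fun t : ℝ => t • v) := by
    filter_upwards [lt_mem_nhds (show (0:ℝ) < 1 by norm_num)] with t ht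
    simp [h.hom t ht.le v]
  exact (h2.congr_of_eventuallyEq h4).unique h3

/-- density -/
lemma dens (s1 s2 : ℝ) (hs : (s1, s2) ≠ (0, 0)) (h : ℝ × ℝ → ℝ)
    (hc : ∀ v, v ≠ 0 → ContinuousAt h v)
    (h0 : ∀ v : ℝ × ℝ, v ≠ 0 → (s1 * v.1 + s2 * v.2) * h v = 0) :
    ∀ v, v ≠ 0 → h v = 0 := by
  intro v hv
  by_contra hne
  have hev : ∀ᶠ w in 𝓝 v, h w ≠ 0 ∧ w ≠ 0 :=
    ((hc v hv).eventually_ne hne).and (eventually_ne_nhds hv)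
  have hcur : Tendsto (fun t : ℝ => v + t • (s1, s2)) (𝓝 0) (𝓝 v) := by
    have : Continuous (fun t : ℝ => v + t • (s1, s2)) := by fun_prop
    simpa using this.tendsto 0
  have h1 := hcur.eventually hev
  have h2 : ∀ᶠ t in 𝓝 (0:ℝ), (s1 * v.1 + s2 * v.2) + t * (s1^2 + s2^2) = 0 := by
    filter_upwards [h1] with t ht
    have := (mul_eq_zero.1 (h0 _ ht.2)).resolve_right ht.1
    simp at this
    linarith
  have h3 : HasDerivAt (fun t : ℝ => (s1 * v.1 + s2 * v.2) + t * (s1^2 + s2^2))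
      (s1^2 + s2^2) 0 := by
    simpa using ((hasDerivAt_id (0:ℝ)).mul_const (s1^2 + s2^2)).const_add (s1 * v.1 + s2 * v.2)
  have h4 := h3.unique ((hasDerivAt_const (0:ℝ) (0:ℝ)).congr_of_eventuallyEq h2)
  apply hs
  have a : s1 = 0 := by nlinarith [sq_nonneg s1, sq_nonneg s2]
  have b : s2 = 0 := by nlinarith [sq_nonneg s1, sq_nonneg s2]
  rw [a, b]

lemma quad_div (a b α β γ : ℝ) (hab : (a, b) ≠ (0, 0))
    (h : α * a ^ 2 + β * (a * b) + γ * b ^ 2 = 0) :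
    ∃ l m : ℝ, ∀ x y : ℝ, α * x ^ 2 + β * (x * y) + γ * y ^ 2
      = (b * x - a * y) * (l * x + m * y) := by
  by_cases hb : b = 0
  · have ha : a ≠ 0 := by rintro rfl; exact hab (by rw [hb])
    subst hb
    have : α = 0 := by
      have : α * a ^ 2 = 0 := by linarith
      simpa [ha] using this
    subst this
    refine ⟨-β / a, -γ / a, fun x y => ?_⟩
    field_simp; ring
  · refine ⟨α / b, (β + a * α / b) / b, fun x y => ?_⟩
    have : γ = -(α * a ^ 2 + β * (a * b)) / b ^ 2 := by field_simp; linarith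
    rw [this]; field_simp; ring

lemma lin_div (s1 s2 : ℝ) (hs : (s1, s2) ≠ (0, 0)) (α β γ : ℝ) (ψ : ℝ × ℝ → ℝ)
    (hc : ∀ v, v ≠ 0 → ContinuousAt ψ v)
    (h : ∀ v : ℝ × ℝ, v ≠ 0 → (s1 * v.1 + s2 * v.2) * ψ v
      = α * v.1 ^ 2 + β * (v.1 * v.2) + γ * v.2 ^ 2) :
    ∃ l m : ℝ, ∀ v : ℝ × ℝ, v ≠ 0 → ψ v = l * v.1 + m * v.2 := by
  have hne : ((-s2, s1) : ℝ × ℝ) ≠ 0 := by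
    intro h; simp [Prod.ext_iff] at h; exact hs (by rw [h.1, h.2])
  have h0 := h (-s2, s1) hne
  obtain ⟨l, m, hlm⟩ := quad_div (-s2) s1 α β γ hne (by rw [← h0]; ring)
  refine ⟨l, m, fun v hv => ?_⟩
  have := dens s1 s2 hs (fun v => ψ v - (l * v.1 + m * v.2))
    (fun v hv => (hc v hv).sub (by fun_prop))
    (fun v hv => by
      have a := h v hv
      have b := hlm v.1 v.2
      rw [mul_sub, a, b]; ring) v hv
  linarith

lemma killing {F : ℝ × ℝ → ℝ} (h : Hom2 F) (a b c d : ℝ)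
    (hL : ∀ v : ℝ × ℝ, v ≠ 0 → fderiv ℝ F v (a * v.1 + b * v.2, c * v.1 + d * v.2) = 0)
    (hq : ¬ IsQuad F) : a = 0 ∧ b = 0 ∧ c = 0 ∧ d = 0 := by
  by_contra hne
  let Q : ℝ × ℝ → ℝ := fun v => c * v.1 ^ 2 + (d - a) * (v.1 * v.2) - b * v.2 ^ 2
  have hQd : Differentiable ℝ Q := by
    intro v; simp only [Q]; fun_prop
  have hQ' : ∀ v w : ℝ × ℝ, fderiv ℝ Q v w
      = 2 * c * v.1 * w.1 + (d - a) * (v.1 * w.2 + v.2 * w.1) - 2 * b * v.2 * w.2 := by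
    intro v w
    have h1 : HasDerivAt (fun t : ℝ => v + t • w) w 0 := by
      simpa using ((hasDerivAt_id (0:ℝ)).smul_const w).const_add v
    have h2 : HasFDerivAt Q (fderiv ℝ Q v) (v + (0:ℝ) • w) := by
      simpa using (hQd v).hasFDerivAt
    have h3 := h2.comp_hasDerivAt (0:ℝ) h1
    have e1 : HasDerivAt (fun t : ℝ => v.1 + t * w.1) w.1 0 := by
      simpa using ((hasDerivAt_id (0:ℝ)).mul_const w.1).const_add v.1
    have e2 : HasDerivAt (fun t : ℝ => v.2 + t * w.2) w.2 0 := by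
      simpa using ((hasDerivAt_id (0:ℝ)).mul_const w.2).const_add v.2
    have h4 := (((e1.pow 2).const_mul c).add ((e1.mul e2).const_mul (d - a))).sub
      ((e2.pow 2).const_mul b)
    have h5 : (Q ∘ fun t : ℝ => v + t • w) = fun t : ℝ => c * (v.1 + t * w.1) ^ 2
      + (d - a) * ((v.1 + t * w.1) * (v.2 + t * w.2)) - b * (v.2 + t * w.2) ^ 2 := by
      funext t; simp [Q]
    rw [h5] at h3
    rw [h3.unique h4]
    simp; ring
  -- Step 1
  have hQ0 : ∀ v : ℝ × ℝ, v ≠ 0 → Q v ≠ 0 := by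
    rintro ⟨x, y⟩ hv hQv
    simp only [Q] at hQv
    have hr : 0 < x ^ 2 + y ^ 2 := by
      rcases eq_or_ne x 0 with rfl | hx
      · have : y ≠ 0 := by rintro rfl; exact hv rfl
        positivity
      · positivity
    set μ := (x * (a * x + b * y) + y * (c * x + d * y)) / (x ^ 2 + y ^ 2) with hμ
    have e1 : a * x + b * y = μ * x := by
      rw [hμ]; field_simp; linear_combination (-y) * hQv
    have e2 : c * x + d * y = μ * y := by
      rw [hμ]; field_simp; linear_combination (x) * hQv
    have e3 := hL (x, y) hv
    simp only [e1, e2] at e3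
    have e4 : ((μ * x, μ * y) : ℝ × ℝ) = μ • (x, y) := by simp
    rw [e4, map_smul, h.euler hv, smul_eq_mul] at e3
    have hμ0 : μ = 0 := by
      have := h.pos _ hv
      rcases mul_eq_zero.1 e3 with h | h
      · exact h
      · linarith
    rw [hμ0, zero_mul] at e1 e2
    set α := (a * y - b * x) / (x ^ 2 + y ^ 2) with hα
    set β := (c * y - d * x) / (x ^ 2 + y ^ 2) with hβ
    have fa : a = α * y := by rw [hα]; field_simp; linear_combination x * e1
    have fb : b = -α * x := by rw [hα]; field_simp; linear_combination y * e1
    have fc : c = β * y := by rw [hβ]; field_simp; linear_combination x * e2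
    have fd : d = -β * x := by rw [hβ]; field_simp; linear_combination y * e2
    have hu : ((α, β) : ℝ × ℝ) ≠ 0 := by
      intro hu
      have h1 : α = 0 := congrArg Prod.fst hu
      have h2 : β = 0 := congrArg Prod.snd hu
      apply hne
      rw [fa, fb, fc, fd, h1, h2]; simp
    have hs : ((y, -x) : ℝ × ℝ) ≠ (0, 0) := by
      intro hs
      simp [Prod.ext_iff] at hs
      rw [hs.1, hs.2] at hr; simp at hr
    have := dens y (-x) hs (fun v => fderiv ℝ F v (α, β))
      (fun v hv => (h.cont hv).clm_apply continuousAt_const)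
      (fun v hv => by
        have := hL v hv
        have e : ((a * v.1 + b * v.2, c * v.1 + d * v.2) : ℝ × ℝ)
            = (y * v.1 + -x * v.2) • (α, β) := by
          rw [fa, fb, fc, fd]
          ext <;> simp <;> ring
        rw [e, map_smul] at this
        exact this) (α, β) hu
    simp only [h.euler hu] at this
    have := h.pos _ hu
    linarith
  let R : ℝ × ℝ → ℝ := fun v => F v / Q v
  have hRd : ∀ v, v ≠ 0 → DifferentiableAt ℝ R v := fun v hv =>
    by
    have := (h.diff hv).fun_mul ((hQd v).fun_inv (hQ0 v hv))
    simpa only [R, div_eq_mul_inv] using this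
  have hR' : ∀ v, v ≠ 0 → ∀ w, fderiv ℝ F v w = R v * fderiv ℝ Q v w + Q v * fderiv ℝ R v w := by
    intro v hv w
    have e : F =ᶠ[𝓝 v] fun v => R v * Q v := by
      filter_upwards [eventually_ne_nhds hv] with w hw
      simp only [R]; rw [div_mul_cancel₀ _ (hQ0 w hw)]
    rw [e.fderiv_eq, fderiv_fun_mul (hRd v hv) (hQd v)]
    simp
  have hRhom : ∀ t : ℝ, 0 < t → ∀ v, v ≠ 0 → R (t • v) = R v := by
    intro t ht v hv
    have : Q (t • v) = t ^ 2 * Q v := by simp [Q]; ring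
    simp only [R]
    rw [this, h.hom t ht.le]
    have := hQ0 v hv
    field_simp
  have hne0 : ∀ v : ℝ × ℝ, v ∈ Metric.sphere (0 : ℝ × ℝ) 1 → v ≠ 0 := by
    rintro v hv rfl
    simp at hv
  obtain ⟨m, hm, hmax⟩ := (isCompact_sphere (0 : ℝ × ℝ) 1).exists_isMaxOn
    ⟨(1, 0), by simp [Prod.norm_def]⟩
    (f := R) (fun v hv => (hRd v (hne0 v hv)).continuousAt.continuousWithinAt)
  have hloc : IsLocalMax R m := by
    filter_upwards [eventually_ne_nhds (hne0 m hm)] with w hw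
    have hn : 0 < ‖w‖ := norm_pos_iff.2 hw
    rw [← hRhom (‖w‖⁻¹) (by positivity) w hw]
    apply hmax
    simp [norm_smul, hn.ne']
  have hm0 := hne0 m hm
  have htr : a + d = 0 := by
    have e := hR' m hm0 (a * m.1 + b * m.2, c * m.1 + d * m.2)
    rw [hL m hm0, hloc.fderiv_eq_zero, hQ'] at e
    have e2 : R m * ((a + d) * Q m) = 0 := by
      simp at e
      rcases e with e | e
      · rw [e]; simp
      · simp only [Q]; rw [show (a + d) * (c * m.1 ^ 2 + (d - a) * (m.1 * m.2) - b * m.2 ^ 2) = 0 by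
          linear_combination e]; simp
    have hR0 : R m ≠ 0 := div_ne_zero (h.pos m hm0).ne' (hQ0 m hm0)
    simpa [hR0, hQ0 m hm0] using e2
  have hfz : ∀ v, v ≠ 0 → fderiv ℝ R v = 0 := by
    intro v hv
    have e1 := hR' v hv (a * v.1 + b * v.2, c * v.1 + d * v.2)
    have e2 := hR' v hv v
    rw [hL v hv, hQ'] at e1
    rw [h.euler hv, hQ'] at e2
    have hRQ : R v * Q v = F v := div_mul_cancel₀ _ (hQ0 v hv)
    have f1 : fderiv ℝ R v (a * v.1 + b * v.2, c * v.1 + d * v.2) = 0 := by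
      have : Q v * fderiv ℝ R v (a * v.1 + b * v.2, c * v.1 + d * v.2) = 0 := by
        have hd : d = -a := by linarith
        simp only at e1
        rw [hd] at e1 ⊢
        linear_combination -e1
      simpa [hQ0 v hv] using this
    have f2 : fderiv ℝ R v v = 0 := by
      have : Q v * fderiv ℝ R v v = 0 := by
        simp only [Q] at hRQ e2 ⊢
        linear_combination -e2 - 2 * hRQ
      simpa [hQ0 v hv] using this
    ext1
    · ext
      have : Q v • ((1:ℝ), (0:ℝ)) = (c * v.1 + d * v.2) • v
          - v.2 • (a * v.1 + b * v.2, c * v.1 + d * v.2) := by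
        ext <;> simp [Q] <;> ring
      have := congrArg (fderiv ℝ R v) this
      rw [map_sub, map_smul, map_smul, map_smul, f1, f2] at this
      simpa [hQ0 v hv] using this
    · ext
      have : Q v • ((0:ℝ), (1:ℝ)) = v.1 • (a * v.1 + b * v.2, c * v.1 + d * v.2)
          - (a * v.1 + b * v.2) • v := by
        ext <;> simp [Q] <;> ring
      have := congrArg (fderiv ℝ R v) this
      rw [map_sub, map_smul, map_smul, map_smul, f1, f2] at this
      simpa [hQ0 v hv] using this
  have hconn : IsPreconnected ({0}ᶜ : Set (ℝ × ℝ)) :=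
    (isConnected_compl_singleton_of_one_lt_rank (by
      rw [← Module.finrank_eq_rank]; simp) (0 : ℝ × ℝ)).isPreconnected
  have hconst := fun v (hv : v ∈ ({0}ᶜ : Set (ℝ × ℝ))) =>
    isOpen_compl_singleton.is_const_of_fderiv_eq_zero hconn
    (fun v hv => (hRd v hv).differentiableWithinAt) (fun v hv => hfz v hv)
    hv (show m ∈ ({0}ᶜ : Set (ℝ × ℝ)) from hm0)
  apply hq
  refine ⟨R m * c, R m * (d - a), - R m * b, fun v => ?_⟩
  by_cases hv : v = 0
  · subst hv
    have := h.hom 0 le_rfl 0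
    simp at this ⊢; exact this
  · have e1 := hconst v hv
    have : F v = R v * Q v := (div_mul_cancel₀ _ (hQ0 v hv)).symm
    rw [this, e1]; simp only [Q]; ring

lemma dichotomy {F : ℝ × ℝ → ℝ} (h : Hom2 F) (hq : ¬ IsQuad F)
    (C₁ C₂ : ℝ × ℝ →ₗ[ℝ] ℝ × ℝ)
    (hC : ∀ v : ℝ × ℝ, v ≠ 0 → fderiv ℝ F v (v.2 • C₁ v - v.1 • C₂ v) = 0) :
    ∃ u : ℝ × ℝ, (∀ v, C₁ v = v.1 • u) ∧ (∀ v, C₂ v = v.2 • u) := by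
  have hlin : ∀ (C : ℝ × ℝ →ₗ[ℝ] ℝ × ℝ) (v : ℝ × ℝ), C v = v.1 • C (1, 0) + v.2 • C (0, 1) := by
    intro C v
    rw [← map_smul, ← map_smul, ← map_add]; simp
  obtain ⟨p, r, h1⟩ : ∃ x y, C₁ (1, 0) = (x, y) := ⟨_, _, rfl⟩
  obtain ⟨q, s, h2⟩ : ∃ x y, C₁ (0, 1) = (x, y) := ⟨_, _, rfl⟩
  obtain ⟨p', r', h3⟩ : ∃ x y, C₂ (1, 0) = (x, y) := ⟨_, _, rfl⟩
  obtain ⟨q', s', h4⟩ : ∃ x y, C₂ (0, 1) = (x, y) := ⟨_, _, rfl⟩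
  have hP : ∀ v : ℝ × ℝ, v.2 • C₁ v - v.1 • C₂ v =
      (-p' * v.1 ^ 2 + (p - q') * (v.1 * v.2) + q * v.2 ^ 2,
       -r' * v.1 ^ 2 + (r - s') * (v.1 * v.2) + s * v.2 ^ 2) := by
    intro v
    rw [hlin C₁, hlin C₂, h1, h2, h3, h4]
    ext <;> simp <;> ring
  simp only [hP] at hC
  -- root
  obtain ⟨x, y, hxy, hroot⟩ : ∃ x y : ℝ, x ^ 2 + y ^ 2 = 1 ∧
      x * (-r' * x ^ 2 + (r - s') * (x * y) + s * y ^ 2)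
        - y * (-p' * x ^ 2 + (p - q') * (x * y) + q * y ^ 2) = 0 := by
    let cc : ℝ → ℝ := fun t => Real.cos t * (-r' * Real.cos t ^ 2 + (r - s') * (Real.cos t * Real.sin t) + s * Real.sin t ^ 2)
        - Real.sin t * (-p' * Real.cos t ^ 2 + (p - q') * (Real.cos t * Real.sin t) + q * Real.sin t ^ 2)
    have hcc : Continuous cc := by simp only [cc]; fun_prop
    have hodd : cc Real.pi = - cc 0 := by simp [cc]
    have : (0:ℝ) ∈ Set.uIcc (cc 0) (cc Real.pi) := by
      rw [hodd, Set.mem_uIcc]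
      rcases le_total (cc 0) 0 with h | h
      · left; constructor <;> linarith
      · right; constructor <;> linarith
    obtain ⟨t, -, ht⟩ := intermediate_value_uIcc hcc.continuousOn this
    exact ⟨Real.cos t, Real.sin t, by simp, ht⟩
  have hv0 : ((x, y) : ℝ × ℝ) ≠ 0 := by
    intro h; simp [Prod.ext_iff] at h; rw [h.1, h.2] at hxy; simp at hxy
  set P1 := -p' * x ^ 2 + (p - q') * (x * y) + q * y ^ 2 with hP1
  set P2 := -r' * x ^ 2 + (r - s') * (x * y) + s * y ^ 2 with hP2
  have hμ : ((P1, P2) : ℝ × ℝ) = (x * P1 + y * P2) • (x, y) := by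
    ext
    · simp; linear_combination (-P1) * hxy - y * hroot
    · simp; linear_combination (-P2) * hxy + x * hroot
  have e := hC (x, y) hv0
  simp only [← hP1, ← hP2] at e
  rw [hμ, map_smul, h.euler hv0, smul_eq_mul] at e
  have hμ0 : x * P1 + y * P2 = 0 := by
    have := h.pos _ hv0
    rcases mul_eq_zero.1 e with h | h
    · exact h
    · linarith
  rw [hμ0, zero_smul] at hμ
  have z1 : P1 = 0 := congrArg Prod.fst hμ
  have z2 : P2 = 0 := congrArg Prod.snd hμ
  obtain ⟨l1, m1, hd1⟩ := quad_div x y _ _ _ hv0 (hP1.symm.trans z1)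
  obtain ⟨l2, m2, hd2⟩ := quad_div x y _ _ _ hv0 (hP2.symm.trans z2)
  have hs : ((y, -x) : ℝ × ℝ) ≠ (0, 0) := by
    intro h; simp [Prod.ext_iff] at h; rw [h.1, h.2] at hxy; simp at hxy
  have hk := killing h l1 m1 l2 m2 (dens y (-x) hs _
      (fun v hv => (h.cont hv).clm_apply (by fun_prop))
      (fun v hv => by
        have := hC v hv
        rw [hd1, hd2] at this
        have e : (((y * v.1 - x * v.2) * (l1 * v.1 + m1 * v.2),
           (y * v.1 - x * v.2) * (l2 * v.1 + m2 * v.2)) : ℝ × ℝ) =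
           (y * v.1 + -x * v.2) • (l1 * v.1 + m1 * v.2, l2 * v.1 + m2 * v.2) := by
          ext <;> simp only [Prod.smul_mk, smul_eq_mul] <;> ring
        rw [e, map_smul] at this
        exact this)) hq
  obtain ⟨rfl, rfl, rfl, rfl⟩ := hk
  simp only [zero_mul, add_zero, mul_zero] at hd1 hd2
  have a1 := hd1 1 0
  have a2 := hd1 0 1
  have a3 := hd1 1 1
  have b1 := hd2 1 0
  have b2 := hd2 0 1
  have b3 := hd2 1 1
  simp at a1 a2 a3 b1 b2 b3
  refine ⟨(p, r), fun v => ?_, fun v => ?_⟩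
  · rw [hlin C₁, h1, h2, a2, b2]; simp
  · rw [hlin C₂, h3, h4, a1, b1]
    have : q' = p := by linarith
    have : s' = r := by linarith
    subst_vars; simp

lemma exists_split {V : Type*} [NormedAddCommGroup V] [NormedSpace ℝ V] [FiniteDimensional ℝ V]
    (hdim : Module.finrank ℝ V = 3) (D : ℝ × ℝ →L[ℝ] V) (hD : ∀ v, v ≠ 0 → D v ≠ 0)
    (lam : V →ₗ[ℝ] ℝ) (hlam : lam ≠ 0) (hlamD : ∀ v, lam (D v) = 0) :
    ∃ (n : V) (π : V →ₗ[ℝ] ℝ × ℝ), lam n = 1 ∧ ∀ x, x = D (π x) + lam x • n := by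
  obtain ⟨n, hn⟩ : ∃ n, lam n = 1 := by
    obtain ⟨y, hy⟩ : ∃ y, lam y ≠ 0 := by
      by_contra! h
      exact hlam (LinearMap.ext h)
    exact ⟨(lam y)⁻¹ • y, by simp [hy]⟩
  have hDk : LinearMap.ker (D : ℝ × ℝ →ₗ[ℝ] V) = ⊥ := by
    rw [LinearMap.ker_eq_bot']
    intro m hm
    by_contra hne
    exact hD m hne hm
  obtain ⟨ρ, hρ⟩ := LinearMap.exists_leftInverse_of_injective (D : ℝ × ℝ →ₗ[ℝ] V) hDk
  have hrange : LinearMap.range (D : ℝ × ℝ →ₗ[ℝ] V) = LinearMap.ker lam := by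
    apply Submodule.eq_of_le_of_finrank_eq
    · rintro _ ⟨v, rfl⟩
      exact hlamD v
    · have h1 := LinearMap.finrank_range_of_inj (LinearMap.ker_eq_bot.1 hDk)
      have h2 := lam.finrank_range_add_finrank_ker
      have h3 : LinearMap.range lam = ⊤ := LinearMap.range_eq_top.2 (LinearMap.surjective hlam)
      rw [h3, finrank_top, hdim] at h2
      rw [h1]
      simp at h2 ⊢
      omega
  refine ⟨n, ρ ∘ₗ (LinearMap.id - lam.smulRight n), hn, fun x => ?_⟩
  have : x - lam x • n ∈ LinearMap.range (D : ℝ × ℝ →ₗ[ℝ] V) := by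
    rw [hrange]; simp [hn]
  obtain ⟨v, hv⟩ := this
  have h2 : ρ (x - lam x • n) = v := by rw [← hv]; exact LinearMap.congr_fun hρ v
  have h3 : (ρ ∘ₗ (LinearMap.id - lam.smulRight n)) x = v := by
    rw [← h2]; simp
  rw [h3]
  have hv' : D v = x - lam x • n := hv
  rw [hv']; abel

section
variable {V : Type*} [NormedAddCommGroup V] [NormedSpace ℝ V]

lemma comp_fderiv (F : V → ℝ) (hF : ∀ y, y ≠ 0 → ContDiffAt ℝ 2 F y)
    (D : ℝ × ℝ →L[ℝ] V) (hD : ∀ v, v ≠ 0 → D v ≠ 0) (v : ℝ × ℝ) (hv : v ≠ 0) (w : ℝ × ℝ) :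
    fderiv ℝ (fun v => F (D v)) v w = fderiv ℝ F (D v) (D w) := by
  have := ((hF _ (hD v hv)).differentiableAt (by simp)).hasFDerivAt.comp v D.hasFDerivAt
  have h2 : fderiv ℝ (fun v => F (D v)) v = _ := this.fderiv
  rw [h2]; simp

/-- derivative of `v ↦ F'(D v) n`. -/
lemma hasFDeriv_psi (F : V → ℝ) (hF : ∀ y, y ≠ 0 → ContDiffAt ℝ 2 F y)
    (D : ℝ × ℝ →L[ℝ] V) (hD : ∀ v, v ≠ 0 → D v ≠ 0) (n : V) (v : ℝ × ℝ) (hv : v ≠ 0) :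
    DifferentiableAt ℝ (fun v => fderiv ℝ F (D v) n) v ∧
    ∀ w, fderiv ℝ (fun v => fderiv ℝ F (D v) n) v w = fderiv ℝ (fderiv ℝ F) (D v) (D w) n := by
  have h1 : ContDiffAt ℝ 1 (fderiv ℝ F) (D v) := (hF _ (hD v hv)).fderiv_right (by norm_num)
  have h2 := (h1.differentiableAt (by simp)).hasFDerivAt.comp v D.hasFDerivAt
  have h3 := h2.clm_apply (hasFDerivAt_const n v)
  refine ⟨h3.differentiableAt, fun w => ?_⟩
  have h4 : fderiv ℝ (fun v => fderiv ℝ F (D v) n) v = _ := h3.fderiv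
  rw [h4]; simp

lemma comp_fderiv2 (F : V → ℝ) (hF : ∀ y, y ≠ 0 → ContDiffAt ℝ 2 F y)
    (D : ℝ × ℝ →L[ℝ] V) (hD : ∀ v, v ≠ 0 → D v ≠ 0) (v : ℝ × ℝ) (hv : v ≠ 0) (w z : ℝ × ℝ) :
    fderiv ℝ (fderiv ℝ (fun v => F (D v))) v w z = fderiv ℝ (fderiv ℝ F) (D v) (D w) (D z) := by
  have hFD : ContDiffAt ℝ 2 (fun v => F (D v)) v :=
    (hF _ (hD v hv)).comp v D.contDiff.contDiffAt
  have h1 : ContDiffAt ℝ 1 (fderiv ℝ (fun v => F (D v))) v := hFD.fderiv_right (by norm_num)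
  have h2 := (h1.differentiableAt (by simp)).hasFDerivAt.clm_apply (hasFDerivAt_const z v)
  have h3 : (fun v => fderiv ℝ (fun v => F (D v)) v z) =ᶠ[𝓝 v]
      fun v => fderiv ℝ F (D v) (D z) := by
    filter_upwards [eventually_ne_nhds hv] with x hx
    exact comp_fderiv F hF D hD x hx z
  rw [← (hasFDeriv_psi F hF D hD (D z) v hv).2 w, ← h3.fderiv_eq]
  have h4 : fderiv ℝ (fun v => fderiv ℝ (fun v => F (D v)) v z) v = _ := h2.fderiv
  rw [h4]; simp

lemma symm2 (F : V → ℝ) (hF : ∀ y, y ≠ 0 → ContDiffAt ℝ 2 F y) (y : V) (hy : y ≠ 0) (a b : V) :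
    fderiv ℝ (fderiv ℝ F) y a b = fderiv ℝ (fderiv ℝ F) y b a :=
  ((hF y hy).isSymmSndFDerivAt (by simp)) a b

/-- If `ψ = 0` then mixed second derivatives vanish. -/
lemma psi_zero (F : V → ℝ) (hF : ∀ y, y ≠ 0 → ContDiffAt ℝ 2 F y)
    (D : ℝ × ℝ →L[ℝ] V) (hD : ∀ v, v ≠ 0 → D v ≠ 0) (n : V)
    (h : ∀ v, v ≠ 0 → fderiv ℝ F (D v) n = 0) (v : ℝ × ℝ) (hv : v ≠ 0) (w : ℝ × ℝ) :
    fderiv ℝ (fderiv ℝ F) (D v) (D w) n = 0 ∧ fderiv ℝ (fderiv ℝ F) (D v) n (D w) = 0 := by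
  have h1 : fderiv ℝ (fderiv ℝ F) (D v) (D w) n = 0 := by
    rw [← (hasFDeriv_psi F hF D hD n v hv).2 w]
    have : (fun v => fderiv ℝ F (D v) n) =ᶠ[𝓝 v] fun _ => 0 := by
      filter_upwards [eventually_ne_nhds hv] with x hx
      exact h x hx
    rw [this.fderiv_eq]; simp
  exact ⟨h1, by rw [symm2 F hF _ (hD v hv), h1]⟩

lemma stageI (F : V → ℝ) (hF : ∀ y, y ≠ 0 → ContDiffAt ℝ 2 F y)
    (hF2 : ∀ y, y ≠ 0 → ∀ w, w ≠ 0 → 0 < fderiv ℝ (fderiv ℝ F) y w w)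
    (D : ℝ × ℝ →L[ℝ] V) (hD : ∀ v, v ≠ 0 → D v ≠ 0)
    (h0 : Hom2 (fun v => F (D v))) (hq : ¬ IsQuad (fun v => F (D v)))
    (lam : V →ₗ[ℝ] ℝ) (n : V) (π : V →ₗ[ℝ] ℝ × ℝ) (hn : lam n = 1)
    (hlamD : ∀ v, lam (D v) = 0)
    (hπ : ∀ x, x = D (π x) + lam x • n)
    (D2 : ℝ × ℝ →L[ℝ] ℝ × ℝ →L[ℝ] V) (hsym : ∀ k l, D2 k l = D2 l k)
    (hd : lam (D2 (1, 0) (1, 0)) * lam (D2 (0, 1) (0, 1)) - lam (D2 (1, 0) (0, 1)) ^ 2 ≠ 0)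
    (B : ℝ × ℝ →L[ℝ] ℝ × ℝ →L[ℝ] ℝ × ℝ) (BB : ℝ × ℝ → ℝ × ℝ →L[ℝ] ℝ × ℝ)
    (D3 : ℝ × ℝ → ℝ × ℝ →L[ℝ] V)
    (h1 : ∀ k v, v ≠ 0 → fderiv ℝ F (D v) (D2 k v) = fderiv ℝ (fun v => F (D v)) v (B k v))
    (h2 : ∀ k v, v ≠ 0 → fderiv ℝ (fderiv ℝ F) (D v) (D2 k v) (D2 k v)
        + fderiv ℝ F (D v) (D3 k v)
      = fderiv ℝ (fderiv ℝ (fun v => F (D v))) v (B k v) (B k v)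
        + fderiv ℝ (fun v => F (D v)) v (BB k v)) : False := by
  set s11 := lam (D2 (1, 0) (1, 0)) with hs11
  set s22 := lam (D2 (0, 1) (0, 1)) with hs22
  set s12 := lam (D2 (1, 0) (0, 1)) with hs12
  set d := s11 * s22 - s12 ^ 2 with hdd
  have hS : ∀ k v : ℝ × ℝ, lam (D2 k v) = s11 * k.1 * v.1 + s12 * (k.1 * v.2 + k.2 * v.1)
      + s22 * k.2 * v.2 := by
    intro k v
    have e1 : k = k.1 • ((1:ℝ), (0:ℝ)) + k.2 • ((0:ℝ), (1:ℝ)) := by simp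
    have e2 : v = v.1 • ((1:ℝ), (0:ℝ)) + v.2 • ((0:ℝ), (1:ℝ)) := by simp
    conv_lhs => rw [e1, e2]
    simp only [map_add, map_smul, _root_.add_apply, _root_.smul_apply,
      smul_eq_mul]
    rw [hsym (0, 1) (1, 0), ← hs11, ← hs22, ← hs12]; ring
  let k1 : ℝ × ℝ := (s22 / d, - s12 / d)
  let k2 : ℝ × ℝ := (- s12 / d, s11 / d)
  have hk1 : ∀ v, lam (D2 k1 v) = v.1 := by
    intro v; rw [hS]; simp only [k1]; field_simp; rw [hdd]; ring
  have hk2 : ∀ v, lam (D2 k2 v) = v.2 := by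
    intro v; rw [hS]; simp only [k2]; field_simp; rw [hdd]; ring
  -- first order
  let C : ℝ × ℝ → (ℝ × ℝ →ₗ[ℝ] ℝ × ℝ) := fun k =>
    (B k : ℝ × ℝ →ₗ[ℝ] ℝ × ℝ) - π ∘ₗ (D2 k : ℝ × ℝ →ₗ[ℝ] V)
  have hC : ∀ k v, v ≠ 0 → lam (D2 k v) * fderiv ℝ F (D v) n
      = fderiv ℝ (fun v => F (D v)) v (C k v) := by
    intro k v hv
    have e := h1 k v hv
    rw [hπ (D2 k v), map_add, map_smul, ← comp_fderiv F hF D hD v hv] at e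
    simp only [C, LinearMap.sub_apply, LinearMap.comp_apply, ContinuousLinearMap.coe_coe, map_sub]
    rw [← e, smul_eq_mul]
    ring
  obtain ⟨u, hu1, hu2⟩ := dichotomy h0 hq (C k1) (C k2) (by
    intro v hv
    have e1 := hC k1 v hv
    have e2 := hC k2 v hv
    rw [hk1] at e1
    rw [hk2] at e2
    rw [map_sub, map_smul, map_smul, ← e1, ← e2, smul_eq_mul, smul_eq_mul]; ring)
  let n' := n - D u
  have hn' : n' ≠ 0 := by
    intro h
    have : lam n' = 0 := by rw [h, map_zero]
    simp only [n', map_sub, hn, hlamD] at this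
    norm_num at this
  have hψ : ∀ v, v ≠ 0 → fderiv ℝ F (D v) n' = 0 := by
    intro v hv
    have e1 := hC k1 v hv
    have e2 := hC k2 v hv
    rw [hk1, hu1, map_smul, smul_eq_mul, comp_fderiv F hF D hD v hv] at e1
    rw [hk2, hu2, map_smul, smul_eq_mul, comp_fderiv F hF D hD v hv] at e2
    simp only [n', map_sub]
    by_cases hv1 : v.1 = 0
    · have hv2 : v.2 ≠ 0 := fun h => hv (Prod.ext hv1 h)
      rw [mul_left_cancel₀ hv2 e2, sub_self]
    · rw [mul_left_cancel₀ hv1 e1, sub_self]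
  -- decomposition with n', for k1, k2, k1+k2
  have hdec : ∀ k, (∃ c1 c2 : ℝ, k = c1 • k1 + c2 • k2) → ∀ v,
      D2 k v = D (B k v) + lam (D2 k v) • n' := by
    have hb1 : ∀ v, D2 k1 v = D (B k1 v) + lam (D2 k1 v) • n' := by
      intro v
      have e := hu1 v
      simp only [C, LinearMap.sub_apply, LinearMap.comp_apply, ContinuousLinearMap.coe_coe] at e
      have e' : B k1 v = v.1 • u + π (D2 k1 v) := by rw [← e]; abel
      conv_lhs => rw [hπ (D2 k1 v)]
      rw [e', hk1]; simp only [n', map_add, map_smul, smul_sub]; abel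
    have hb2 : ∀ v, D2 k2 v = D (B k2 v) + lam (D2 k2 v) • n' := by
      intro v
      have e := hu2 v
      simp only [C, LinearMap.sub_apply, LinearMap.comp_apply, ContinuousLinearMap.coe_coe] at e
      have e' : B k2 v = v.2 • u + π (D2 k2 v) := by rw [← e]; abel
      conv_lhs => rw [hπ (D2 k2 v)]
      rw [e', hk2]; simp only [n', map_add, map_smul, smul_sub]; abel
    rintro k ⟨c1, c2, rfl⟩ v
    simp only [map_add, map_smul, _root_.add_apply, _root_.smul_apply]
    conv_lhs => rw [hb1, hb2]
    simp only [smul_add, add_smul, smul_smul, smul_eq_mul]; abel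
  let q : ℝ × ℝ → ℝ := fun v => fderiv ℝ (fderiv ℝ F) (D v) n' n'
  let E : ℝ × ℝ → (ℝ × ℝ →ₗ[ℝ] ℝ × ℝ) := fun k =>
    (BB k : ℝ × ℝ →ₗ[ℝ] ℝ × ℝ) - (π ∘ₗ (D3 k : ℝ × ℝ →ₗ[ℝ] V)
      + (lam ∘ₗ (D3 k : ℝ × ℝ →ₗ[ℝ] V)).smulRight u)
  have hE : ∀ k, (∃ c1 c2 : ℝ, k = c1 • k1 + c2 • k2) → ∀ v, v ≠ 0 →
      lam (D2 k v) ^ 2 * q v = fderiv ℝ (fun v => F (D v)) v (E k v) := by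
    intro k hk v hv
    have e := h2 k v hv
    have e3 : fderiv ℝ F (D v) (D3 k v) =
        fderiv ℝ (fun v => F (D v)) v (π (D3 k v) + lam (D3 k v) • u) := by
      rw [comp_fderiv F hF D hD v hv]
      have : D3 k v = D (π (D3 k v) + lam (D3 k v) • u) + lam (D3 k v) • n' := by
        conv_lhs => rw [hπ (D3 k v)]
        simp only [n', map_add, map_smul, smul_sub]; abel
      conv_lhs => rw [this]
      rw [map_add _ (D _), map_smul, hψ v hv]; simp
    rw [e3, comp_fderiv2 F hF D hD v hv] at e
    rw [hdec k hk v] at e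
    have hz := psi_zero F hF D hD n' hψ v hv (B k v)
    simp only [map_add, map_smul, _root_.add_apply, _root_.smul_apply,
      smul_eq_mul, hz.1, hz.2] at e
    simp only [E, q, LinearMap.sub_apply, LinearMap.comp_apply, LinearMap.add_apply,
      ContinuousLinearMap.coe_coe, map_sub, LinearMap.smulRight_apply, map_add, map_smul,
      smul_eq_mul]
    have hlk : lam (D (B k v)) + lam (D2 k v) * lam n' = lam (D2 k v) := by
      rw [hlamD]; simp [n', hn, hlamD]
    linarith
  have E1 : ∀ v, v ≠ 0 → v.1 ^ 2 * q v = fderiv ℝ (fun v => F (D v)) v (E k1 v) := by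
    intro v hv
    rw [← hE k1 ⟨1, 0, by simp⟩ v hv, hk1]
  have E2 : ∀ v, v ≠ 0 → v.2 ^ 2 * q v = fderiv ℝ (fun v => F (D v)) v (E k2 v) := by
    intro v hv
    rw [← hE k2 ⟨0, 1, by simp⟩ v hv, hk2]
  have E3 : ∀ v, v ≠ 0 → (v.1 + v.2) ^ 2 * q v
      = fderiv ℝ (fun v => F (D v)) v (E (k1 + k2) v) := by
    intro v hv
    rw [← hE (k1 + k2) ⟨1, 1, by simp⟩ v hv]
    simp [hk1, hk2]
  let M : ℝ × ℝ →ₗ[ℝ] ℝ × ℝ := (1/2 : ℝ) • (E (k1 + k2) - E k1 - E k2)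
  have EM : ∀ v, v ≠ 0 → v.1 * v.2 * q v = fderiv ℝ (fun v => F (D v)) v (M v) := by
    intro v hv
    simp only [M, LinearMap.smul_apply, LinearMap.sub_apply, map_smul, map_sub, smul_eq_mul]
    rw [← E1 v hv, ← E2 v hv, ← E3 v hv]; ring
  obtain ⟨u1, a1, a2⟩ := dichotomy h0 hq (E k1) M (by
    intro v hv
    rw [map_sub, map_smul, map_smul, ← E1 v hv, ← EM v hv, smul_eq_mul, smul_eq_mul]; ring)
  obtain ⟨u2, b1, b2⟩ := dichotomy h0 hq M (E k2) (by
    intro v hv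
    rw [map_sub, map_smul, map_smul, ← E2 v hv, ← EM v hv, smul_eq_mul, smul_eq_mul]; ring)
  have hu : u1 = 0 := by
    have e1 := a2 (0, 1)
    rw [b1 (0, 1)] at e1
    simpa using e1.symm
  have hv : ((1:ℝ), (0:ℝ)) ≠ 0 := by simp
  have e := E1 (1, 0) hv
  rw [a1, hu] at e
  have := hF2 _ (hD _ hv) n' hn'
  simp [q] at e
  linarith
end

def Gf (a b c : ℝ) : ℝ × ℝ →L[ℝ] ℝ × ℝ →L[ℝ] ℝ :=
  (ContinuousLinearMap.fst ℝ ℝ ℝ).smulRight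
    ((2 * a) • ContinuousLinearMap.fst ℝ ℝ ℝ + b • ContinuousLinearMap.snd ℝ ℝ ℝ)
  + (ContinuousLinearMap.snd ℝ ℝ ℝ).smulRight
    (b • ContinuousLinearMap.fst ℝ ℝ ℝ + (2 * c) • ContinuousLinearMap.snd ℝ ℝ ℝ)

lemma Gf_apply (a b c : ℝ) (v w : ℝ × ℝ) :
    Gf a b c v w = v.1 * (2 * a * w.1 + b * w.2) + v.2 * (b * w.1 + 2 * c * w.2) := by
  simp [Gf]; ring

lemma quad_fderiv (F : ℝ × ℝ → ℝ) (a b c : ℝ)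
    (h : ∀ v, F v = a * v.1 ^ 2 + b * (v.1 * v.2) + c * v.2 ^ 2) :
    fderiv ℝ F = fun v => Gf a b c v := by
  funext v
  have hF : F = fun v => a * v.1 ^ 2 + b * (v.1 * v.2) + c * v.2 ^ 2 := funext h
  have h1 : HasFDerivAt (fun v : ℝ × ℝ => v.1) (ContinuousLinearMap.fst ℝ ℝ ℝ) v := hasFDerivAt_fst
  have h2 : HasFDerivAt (fun v : ℝ × ℝ => v.2) (ContinuousLinearMap.snd ℝ ℝ ℝ) v := hasFDerivAt_snd
  have h3 := (((h1.fun_mul h1).const_mul a).fun_add ((h1.fun_mul h2).const_mul b)).fun_add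
    ((h2.fun_mul h2).const_mul c)
  have hF' : F = fun v => a * (v.1 * v.1) + b * (v.1 * v.2) + c * (v.2 * v.2) := by
    rw [hF]; funext v; ring
  rw [hF', h3.fderiv]
  apply ContinuousLinearMap.ext
  intro w
  rw [Gf_apply]; simp; ring

lemma quad_fderiv2 (F : ℝ × ℝ → ℝ) (a b c : ℝ)
    (h : ∀ v, F v = a * v.1 ^ 2 + b * (v.1 * v.2) + c * v.2 ^ 2) (v : ℝ × ℝ) :
    fderiv ℝ (fderiv ℝ F) v = Gf a b c := by
  rw [quad_fderiv F a b c h]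
  exact (Gf a b c).fderiv

lemma IsQuad.sub {f g : ℝ × ℝ → ℝ} (hf : IsQuad f) (hg : IsQuad g) : IsQuad (fun v => f v - g v) := by
  obtain ⟨a, b, c, h⟩ := hf
  obtain ⟨a', b', c', h'⟩ := hg
  exact ⟨a - a', b - b', c - c', fun v => by simp only [h, h']; ring⟩

lemma isQuad_lin (a b c : ℝ) (A C : ℝ × ℝ →ₗ[ℝ] ℝ × ℝ) : IsQuad (fun v => Gf a b c (A v) (C v)) := by
  have hlin : ∀ (C : ℝ × ℝ →ₗ[ℝ] ℝ × ℝ) (v : ℝ × ℝ), C v = v.1 • C (1, 0) + v.2 • C (0, 1) := by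
    intro C v
    rw [← map_smul, ← map_smul, ← map_add]; simp
  refine ⟨Gf a b c (A (1, 0)) (C (1, 0)), Gf a b c (A (1, 0)) (C (0, 1))
    + Gf a b c (A (0, 1)) (C (1, 0)), Gf a b c (A (0, 1)) (C (0, 1)), fun v => ?_⟩
  simp only
  rw [hlin A v, hlin C v]
  simp only [map_add, map_smul, _root_.add_apply, _root_.smul_apply, smul_eq_mul]
  ring

lemma Gf_det {F : ℝ × ℝ → ℝ} (hF : Hom2 F) (a b c : ℝ)
    (h : ∀ v, F v = a * v.1 ^ 2 + b * (v.1 * v.2) + c * v.2 ^ 2) : 0 < 4 * a * c - b ^ 2 := by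
  have ha := hF.pos (1, 0) (by simp)
  rw [h] at ha
  simp at ha
  have h2 := hF.pos (-b, 2 * a) (by simp [Prod.ext_iff, ha.ne'])
  rw [h] at h2
  simp only at h2
  have : 0 < a * (4 * a * c - b ^ 2) := by linarith
  exact (mul_pos_iff_of_pos_left ha).1 this

lemma qconst (s1 s2 : ℝ) (hs : (s1, s2) ≠ (0, 0)) (q : ℝ × ℝ → ℝ)
    (hc : ∀ v, v ≠ 0 → ContinuousAt q v) (Q : ℝ × ℝ → ℝ) (hQ : IsQuad Q)
    (h : ∀ v : ℝ × ℝ, v ≠ 0 → (s1 * v.1 + s2 * v.2) ^ 2 * q v = Q v) :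
    ∃ c, ∀ v, v ≠ 0 → q v = c := by
  obtain ⟨α, β, γ, hQ⟩ := hQ
  obtain ⟨l, m, hlm⟩ := lin_div s1 s2 hs α β γ (fun v => (s1 * v.1 + s2 * v.2) * q v)
    (fun v hv => ContinuousAt.mul (by fun_prop) (hc v hv))
    (fun v hv => by rw [← hQ, ← h v hv]; ring)
  have hne : ((-s2, s1) : ℝ × ℝ) ≠ 0 := by
    intro h; simp [Prod.ext_iff] at h; exact hs (by rw [h.1, h.2])
  have h0 := hlm _ hne
  simp only at h0
  have hr : s1 ^ 2 + s2 ^ 2 ≠ 0 := by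
    intro hr
    apply hs
    have a : s1 = 0 := by nlinarith [sq_nonneg s1, sq_nonneg s2]
    have b : s2 = 0 := by nlinarith [sq_nonneg s1, sq_nonneg s2]
    rw [a, b]
  set c := (l * s1 + m * s2) / (s1 ^ 2 + s2 ^ 2) with hcdef
  have hl : l = c * s1 := by rw [hcdef]; field_simp; linear_combination s2 * h0
  have hm : m = c * s2 := by rw [hcdef]; field_simp; linear_combination -s1 * h0
  refine ⟨c, fun v hv => ?_⟩
  have := dens s1 s2 hs (fun v => q v - c) (fun v hv => (hc v hv).sub continuousAt_const)
    (fun v hv => by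
      have e := hlm v hv
      rw [hl, hm] at e
      linear_combination e) v hv
  linarith

section
variable {V : Type*} [NormedAddCommGroup V] [NormedSpace ℝ V]

lemma stageII (F : V → ℝ) (hF : ∀ y, y ≠ 0 → ContDiffAt ℝ 2 F y)
    (hF2 : ∀ y, y ≠ 0 → ∀ w, w ≠ 0 → 0 < fderiv ℝ (fderiv ℝ F) y w w)
    (D : ℝ × ℝ →L[ℝ] V) (hD : ∀ v, v ≠ 0 → D v ≠ 0)
    (h0 : Hom2 (fun v => F (D v))) (a b c : ℝ)
    (hq : ∀ v, F (D v) = a * v.1 ^ 2 + b * (v.1 * v.2) + c * v.2 ^ 2)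
    (lam : V →ₗ[ℝ] ℝ) (n : V) (π : V →ₗ[ℝ] ℝ × ℝ) (hn : lam n = 1)
    (hlamD : ∀ v, lam (D v) = 0)
    (hπ : ∀ x, x = D (π x) + lam x • n)
    (D2 : ℝ × ℝ →L[ℝ] ℝ × ℝ →L[ℝ] V) 
    (D3 : ℝ × ℝ → ℝ × ℝ →L[ℝ] V)
    (P1 P2 : ℝ × ℝ → ℝ × ℝ → ℝ) (hP1 : ∀ k, IsQuad (P1 k)) (hP2 : ∀ k, IsQuad (P2 k))
    (h1 : ∀ k v, v ≠ 0 → fderiv ℝ F (D v) (D2 k v) = P1 k v)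
    (h2 : ∀ k v, v ≠ 0 → fderiv ℝ (fderiv ℝ F) (D v) (D2 k v) (D2 k v)
        + fderiv ℝ F (D v) (D3 k v) = P2 k v) :
    ∃ q : ℝ, 0 < q ∧ ∃ π' : V →ₗ[ℝ] ℝ × ℝ,
      (∀ k v, v ≠ 0 → P1 k v = Gf a b c v (π' (D2 k v))) ∧
      (∀ k v, v ≠ 0 → P2 k v = Gf a b c (π' (D2 k v)) (π' (D2 k v))
        + Gf a b c v (π' (D3 k v)) + q * lam (D2 k v) ^ 2) := by
  have hG : ∀ v, v ≠ 0 → ∀ w, fderiv ℝ F (D v) (D w) = Gf a b c v w := by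
    intro v hv w
    rw [← comp_fderiv F hF D hD v hv, quad_fderiv _ a b c hq]
  have hG2 : ∀ v, v ≠ 0 → ∀ w z, fderiv ℝ (fderiv ℝ F) (D v) (D w) (D z) = Gf a b c w z := by
    intro v hv w z
    rw [← comp_fderiv2 F hF D hD v hv, quad_fderiv2 _ a b c hq]
  have hdet := Gf_det h0 a b c hq
  have hψc : ∀ v, v ≠ 0 → ContinuousAt (fun v => fderiv ℝ F (D v) n) v := fun v hv =>
    (hasFDeriv_psi F hF D hD n v hv).1.continuousAt
  have hlinl : ∀ (C : ℝ × ℝ →ₗ[ℝ] ℝ) (v : ℝ × ℝ), C v = C (1, 0) * v.1 + C (0, 1) * v.2 := by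
    intro C v
    have : v = v.1 • ((1:ℝ), (0:ℝ)) + v.2 • ((0:ℝ), (1:ℝ)) := by simp
    conv_lhs => rw [this]
    rw [map_add, map_smul, map_smul]; simp; ring
  have renorm : ∀ (C : ℝ × ℝ →ₗ[ℝ] ℝ) (Q : ℝ × ℝ → ℝ), IsQuad Q → C ≠ 0 →
      (∀ v, v ≠ 0 → C v * fderiv ℝ F (D v) n = Q v) →
      ∃ (n' : V) (π' : V →ₗ[ℝ] ℝ × ℝ), lam n' = 1 ∧ (∀ x, x = D (π' x) + lam x • n') ∧
        ∀ v, v ≠ 0 → fderiv ℝ F (D v) n' = 0 := by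
    rintro C Q ⟨α, β, γ, hQ⟩ hC0 hC
    have hs : (C (1, 0), C (0, 1)) ≠ (0, 0) := by
      intro hs
      simp only [Prod.mk.injEq] at hs
      apply hC0
      apply LinearMap.ext
      intro v; rw [hlinl, hs.1, hs.2]; simp
    obtain ⟨l, m, hlm⟩ := lin_div _ _ hs α β γ _ hψc
      (fun v hv => by rw [← hlinl, hC v hv, hQ])
    let u : ℝ × ℝ := ((2 * c * l - b * m) / (4 * a * c - b ^ 2),
      (2 * a * m - b * l) / (4 * a * c - b ^ 2))
    have hu : ∀ v, Gf a b c v u = l * v.1 + m * v.2 := by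
      intro v; rw [Gf_apply]; simp only [u, div_eq_mul_inv]
      have hi : (4 * a * c - b ^ 2) * (4 * a * c - b ^ 2)⁻¹ = 1 := mul_inv_cancel₀ hdet.ne'
      linear_combination (l * v.1 + m * v.2) * hi
    refine ⟨n - D u, π + lam.smulRight u, by simp [hn, hlamD], fun x => ?_, fun v hv => ?_⟩
    · conv_lhs => rw [hπ x]
      simp only [LinearMap.add_apply, LinearMap.smulRight_apply, map_add, map_smul, smul_sub]
      abel
    · rw [map_sub, hlm v hv, hG v hv, hu, sub_self]
  obtain ⟨n', π', hn', hπ', hor⟩ : ∃ (n' : V) (π' : V →ₗ[ℝ] ℝ × ℝ), lam n' = 1 ∧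
      (∀ x, x = D (π' x) + lam x • n') ∧
        ((∀ v, v ≠ 0 → fderiv ℝ F (D v) n' = 0) ∨
          (∀ k v, lam (D2 k v) = 0 ∧ lam (D3 k v) = 0)) := by
    by_cases hc1 : ∃ k, lam ∘ₗ (D2 k : ℝ × ℝ →ₗ[ℝ] V) ≠ 0
    · obtain ⟨k, hk⟩ := hc1
      obtain ⟨n', π', x1, x2, x3⟩ := renorm _ _
        ((hP1 k).sub (isQuad_lin a b c LinearMap.id (π ∘ₗ (D2 k : ℝ × ℝ →ₗ[ℝ] V)))) hk
        (fun v hv => by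
          have e := h1 k v hv
          rw [hπ (D2 k v), map_add, map_smul, hG v hv, smul_eq_mul] at e
          simp only [LinearMap.comp_apply, ContinuousLinearMap.coe_coe, LinearMap.id_apply]
          rw [← e]; ring)
      exact ⟨n', π', x1, x2, Or.inl x3⟩
    · push Not at hc1
      have hS0 : ∀ k v, lam (D2 k v) = 0 := fun k v => LinearMap.congr_fun (hc1 k) v
      by_cases hc2 : ∃ k, lam ∘ₗ (D3 k : ℝ × ℝ →ₗ[ℝ] V) ≠ 0
      · obtain ⟨k, hk⟩ := hc2
        obtain ⟨n', π', x1, x2, x3⟩ := renorm _ _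
          (((hP2 k).sub (isQuad_lin a b c LinearMap.id (π ∘ₗ (D3 k : ℝ × ℝ →ₗ[ℝ] V)))).sub
            (isQuad_lin a b c (π ∘ₗ (D2 k : ℝ × ℝ →ₗ[ℝ] V)) (π ∘ₗ (D2 k : ℝ × ℝ →ₗ[ℝ] V)))) hk
          (fun v hv => by
            have e := h2 k v hv
            have e2 := hπ (D2 k v)
            rw [hS0, zero_smul, add_zero] at e2
            rw [hπ (D3 k v), map_add, map_smul, hG v hv, smul_eq_mul, e2, hG2 v hv] at e
            simp only [LinearMap.comp_apply, ContinuousLinearMap.coe_coe, LinearMap.id_apply]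
            rw [← e]; ring)
        exact ⟨n', π', x1, x2, Or.inl x3⟩
      · push Not at hc2
        exact ⟨n, π, hn, hπ, Or.inr fun k v => ⟨hS0 k v, LinearMap.congr_fun (hc2 k) v⟩⟩
  have hn'0 : n' ≠ 0 := by
    rintro rfl
    simp at hn'
  have r1 : ∀ k v, v ≠ 0 → P1 k v = Gf a b c v (π' (D2 k v)) := by
    intro k v hv
    rw [← h1 k v hv]
    conv_lhs => rw [hπ' (D2 k v)]
    rw [map_add, map_smul, hG v hv]
    rcases hor with h | h
    · rw [h v hv]; simp
    · rw [(h k v).1]; simp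
  have r2 : ∀ k v, v ≠ 0 → P2 k v = Gf a b c (π' (D2 k v)) (π' (D2 k v))
        + Gf a b c v (π' (D3 k v))
        + fderiv ℝ (fderiv ℝ F) (D v) n' n' * lam (D2 k v) ^ 2 := by
    intro k v hv
    rw [← h2 k v hv, ← hG2 v hv, ← hG v hv]
    have e2 := hπ' (D2 k v)
    have e3 := hπ' (D3 k v)
    rcases hor with h | h
    · have hz := psi_zero F hF D hD n' h v hv (π' (D2 k v))
      have f2 : fderiv ℝ (fderiv ℝ F) (D v) (D2 k v) (D2 k v) = 
        fderiv ℝ (fderiv ℝ F) (D v) (D (π' (D2 k v)) + lam (D2 k v) • n')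
          (D (π' (D2 k v)) + lam (D2 k v) • n') := by rw [← e2]
      have f3 : fderiv ℝ F (D v) (D3 k v) =
        fderiv ℝ F (D v) (D (π' (D3 k v)) + lam (D3 k v) • n') := by rw [← e3]
      rw [f2, f3]
      simp only [map_add, map_smul, _root_.add_apply, _root_.smul_apply,
        smul_eq_mul, hz.1, hz.2, h v hv]
      ring
    · rw [(h k v).1, zero_smul, add_zero] at e2
      rw [(h k v).2, zero_smul, add_zero] at e3
      rw [(h k v).1, ← e2, ← e3]; ring
  have hqc : ∀ v, v ≠ 0 → ContinuousAt (fun v => fderiv ℝ (fderiv ℝ F) (D v) n' n') v := by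
    intro v hv
    have h1 : ContDiffAt ℝ 1 (fderiv ℝ F) (D v) := (hF _ (hD v hv)).fderiv_right (by norm_num)
    have h2 : ContDiffAt ℝ 0 (fderiv ℝ (fderiv ℝ F)) (D v) := h1.fderiv_right (by norm_num)
    have h3 : ContinuousAt (fun v => fderiv ℝ (fderiv ℝ F) (D v)) v :=
      ContinuousAt.comp (f := D) h2.continuousAt D.continuous.continuousAt
    exact (h3.clm_apply continuousAt_const).clm_apply continuousAt_const
  by_cases hc1 : ∃ k, lam ∘ₗ (D2 k : ℝ × ℝ →ₗ[ℝ] V) ≠ 0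
  · obtain ⟨k, hk⟩ := hc1
    set C := lam ∘ₗ (D2 k : ℝ × ℝ →ₗ[ℝ] V) with hC
    have hs : (C (1, 0), C (0, 1)) ≠ (0, 0) := by
      intro hs
      simp only [Prod.mk.injEq] at hs
      apply hk
      apply LinearMap.ext
      intro v; rw [hlinl, hs.1, hs.2]; simp
    obtain ⟨q, hq⟩ := qconst _ _ hs _ hqc _
      (((hP2 k).sub (isQuad_lin a b c LinearMap.id (π' ∘ₗ (D3 k : ℝ × ℝ →ₗ[ℝ] V)))).sub
            (isQuad_lin a b c (π' ∘ₗ (D2 k : ℝ × ℝ →ₗ[ℝ] V)) (π' ∘ₗ (D2 k : ℝ × ℝ →ₗ[ℝ] V))))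
      (fun v hv => by
        rw [← hlinl]
        simp only [hC, LinearMap.comp_apply, ContinuousLinearMap.coe_coe, LinearMap.id_apply]
        rw [r2 k v hv]; ring)
    refine ⟨q, ?_, π', r1, fun k v hv => by rw [r2 k v hv, hq v hv]⟩
    have hv : ((1:ℝ), (0:ℝ)) ≠ 0 := by simp
    rw [← hq _ hv]
    exact hF2 _ (hD _ hv) _ hn'0
  · push Not at hc1
    have hS0 : ∀ k v, lam (D2 k v) = 0 := fun k v => LinearMap.congr_fun (hc1 k) v
    refine ⟨1, one_pos, π', r1, fun k v hv => ?_⟩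
    rw [r2 k v hv, hS0]; ring
end

lemma final_alg {V₁ V₂ : Type*} [NormedAddCommGroup V₁] [NormedSpace ℝ V₁]
    [NormedAddCommGroup V₂] [NormedSpace ℝ V₂] (a b c : ℝ) (hdet : 0 < 4 * a * c - b ^ 2)
    (lam₁ : V₁ →ₗ[ℝ] ℝ) (lam₂ : V₂ →ₗ[ℝ] ℝ)
    (π₁ : V₁ →ₗ[ℝ] ℝ × ℝ) (π₂ : V₂ →ₗ[ℝ] ℝ × ℝ)
    (D2₁ : ℝ × ℝ →L[ℝ] ℝ × ℝ →L[ℝ] V₁) (hs₁ : ∀ k l, D2₁ k l = D2₁ l k)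
    (D2₂ : ℝ × ℝ →L[ℝ] ℝ × ℝ →L[ℝ] V₂) (hs₂ : ∀ k l, D2₂ k l = D2₂ l k)
    (D3₁ : ℝ × ℝ →L[ℝ] ℝ × ℝ →L[ℝ] ℝ × ℝ →L[ℝ] V₁)
    (ht₁ : ∀ k l v, D3₁ k l v = D3₁ l k v) (ht₁' : ∀ k l v, D3₁ k l v = D3₁ k v l)
    (D3₂ : ℝ × ℝ →L[ℝ] ℝ × ℝ →L[ℝ] ℝ × ℝ →L[ℝ] V₂)
    (ht₂ : ∀ k l v, D3₂ k l v = D3₂ l k v) (ht₂' : ∀ k l v, D3₂ k l v = D3₂ k v l)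
    (q₁ q₂ : ℝ)
    (h1 : ∀ k v, v ≠ 0 → Gf a b c v (π₁ (D2₁ k v)) = Gf a b c v (π₂ (D2₂ k v)))
    (h2 : ∀ k v, v ≠ 0 → Gf a b c (π₁ (D2₁ k v)) (π₁ (D2₁ k v))
        + Gf a b c v (π₁ (D3₁ k k v)) + q₁ * lam₁ (D2₁ k v) ^ 2
        = Gf a b c (π₂ (D2₂ k v)) (π₂ (D2₂ k v))
        + Gf a b c v (π₂ (D3₂ k k v)) + q₂ * lam₂ (D2₂ k v) ^ 2) :
    q₁ * (lam₁ (D2₁ (1, 0) (1, 0)) * lam₁ (D2₁ (0, 1) (0, 1)) - lam₁ (D2₁ (1, 0) (0, 1)) ^ 2)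
    = q₂ * (lam₂ (D2₂ (1, 0) (1, 0)) * lam₂ (D2₂ (0, 1) (0, 1)) - lam₂ (D2₂ (1, 0) (0, 1)) ^ 2) := by
  have h1' : ∀ k v, Gf a b c v (π₁ (D2₁ k v)) = Gf a b c v (π₂ (D2₂ k v)) := by
    intro k v
    by_cases hv : v = 0
    · rw [hv]; simp
    · exact h1 k v hv
  have hpol : ∀ k v w, Gf a b c v (π₁ (D2₁ k w) - π₂ (D2₂ k w))
      = - Gf a b c w (π₁ (D2₁ k v) - π₂ (D2₂ k v)) := by
    intro k v w
    have e1 := h1' k v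
    have e2 := h1' k w
    have e3 := h1' k (v + w)
    simp only [map_add, map_sub, _root_.add_apply] at e1 e2 e3 ⊢
    linarith
  have hsw : ∀ k v w, Gf a b c v (π₁ (D2₁ k w) - π₂ (D2₂ k w))
      = Gf a b c v (π₁ (D2₁ w k) - π₂ (D2₂ w k)) := by
    intro k v w; rw [hs₁ k w, hs₂ k w]
  have hz : ∀ k v w, Gf a b c v (π₁ (D2₁ k w) - π₂ (D2₂ k w)) = 0 := by
    intro k v w
    have x1 := hsw k v w
    have x2 := hpol w v k
    have x3 := hsw w k v
    have x4 := hpol v k w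
    have x5 := hsw v w k
    have x6 := hpol k w v
    linarith
  have hT : ∀ k w, π₁ (D2₁ k w) = π₂ (D2₂ k w) := by
    intro k w
    have e1 := hz k (1, 0) w
    have e2 := hz k (0, 1) w
    rw [Gf_apply] at e1 e2
    rw [← sub_eq_zero]
    set z := π₁ (D2₁ k w) - π₂ (D2₂ k w)
    simp at e1 e2
    ext
    · have : (4 * a * c - b ^ 2) * z.1 = 0 := by linear_combination 2 * c * e1 - b * e2
      simpa [hdet.ne'] using this
    · have : (4 * a * c - b ^ 2) * z.2 = 0 := by linear_combination 2 * a * e2 - b * e1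
      simpa [hdet.ne'] using this
  have h2' : ∀ k v, Gf a b c v (π₁ (D3₁ k k v)) + q₁ * lam₁ (D2₁ k v) ^ 2
        = Gf a b c v (π₂ (D3₂ k k v)) + q₂ * lam₂ (D2₂ k v) ^ 2 := by
    intro k v
    by_cases hv : v = 0
    · rw [hv]; simp
    · have := h2 k v hv
      rw [hT] at this
      linarith
  obtain ⟨X, hX⟩ : ∃ X : ℝ × ℝ, X = (1, 0) := ⟨_, rfl⟩
  obtain ⟨Y, hY⟩ : ∃ Y : ℝ × ℝ, Y = (0, 1) := ⟨_, rfl⟩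
  rw [← hX, ← hY]
  have m1 := h2' X Y
  have m2 := h2' Y X
  have m3 := h2' (X + Y) (X + Y)
  have m4 := h2' (X - Y) (X - Y)
  have m5 := h2' (X + Y) (X - Y)
  have m6 := h2' (X - Y) (X + Y)
  have s1 : D3₁ X Y X = D3₁ X X Y := ht₁' _ _ _
  have s2 : D3₁ Y X X = D3₁ X X Y := by rw [ht₁, ht₁']
  have s3 : D3₁ Y X Y = D3₁ X Y Y := ht₁ _ _ _
  have s4 : D3₁ Y Y X = D3₁ X Y Y := by rw [ht₁', ht₁]
  have t1 : D3₂ X Y X = D3₂ X X Y := ht₂' _ _ _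
  have t2 : D3₂ Y X X = D3₂ X X Y := by rw [ht₂, ht₂']
  have t3 : D3₂ Y X Y = D3₂ X Y Y := ht₂ _ _ _
  have t4 : D3₂ Y Y X = D3₂ X Y Y := by rw [ht₂', ht₂]
  simp only [map_add, map_sub, _root_.add_apply, _root_.sub_apply, s1, s2, s3, s4, t1, t2, t3, t4,
    hs₁ Y X, hs₂ Y X] at m1 m2 m3 m4 m5 m6
  linear_combination -m1 - m2 + (1/8) * (m3 - m5 - m6 + m4)

lemma nat_le_smooth (n : ℕ) : ((n : ℕ∞) : WithTop ℕ∞) ≤ ((⊤ : ℕ∞) : WithTop ℕ∞) :=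
  WithTop.coe_le_coe.2 le_top

lemma two_le_smooth : (2 : WithTop ℕ∞) ≤ ((⊤ : ℕ∞) : WithTop ℕ∞) := nat_le_smooth 2

section BM
variable {V : Type*} [NormedAddCommGroup V] [NormedSpace ℝ V]

lemma bm_smooth {Φ : V → ℝ} (h : IsBanachMinkowski Φ) (y : V) (hy : y ≠ 0) :
    ContDiffAt ℝ 2 (fun u => Φ u ^ 2) y := by
  have h1 : ContDiffAt ℝ (⊤ : ℕ∞) Φ y := h.2.2.2.2.1.contDiffAt (isOpen_compl_singleton.mem_nhds hy)
  exact (h1.of_le two_le_smooth).pow 2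

lemma bm_pos2 {Φ : V → ℝ} (h : IsBanachMinkowski Φ) (y : V) (hy : y ≠ 0) (w : V) (hw : w ≠ 0) :
    0 < fderiv ℝ (fderiv ℝ (fun u => Φ u ^ 2)) y w w := by
  have := h.2.2.2.2.2 y hy w hw
  rw [iteratedFDeriv_two_apply] at this
  simpa using this

lemma bm_cont [FiniteDimensional ℝ V] {Φ : V → ℝ} (h : IsBanachMinkowski Φ) : Continuous Φ := by
  have hc : ConvexOn ℝ univ Φ := by
    refine ⟨convex_univ, ?_⟩
    intro x _ y _ a b ha hb _
    calc Φ (a • x + b • y) ≤ Φ (a • x) + Φ (b • y) := h.2.2.2.1 _ _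
      _ = a • Φ x + b • Φ y := by rw [h.2.2.1 a ha, h.2.2.1 b hb]; rfl
  exact hc.locallyLipschitz.continuous

lemma bm_hom2 {Φ : ℝ × ℝ → ℝ} (h : IsBanachMinkowski Φ) : Hom2 (fun u => Φ u ^ 2) where
  pos v hv := pow_pos (h.2.1 v hv) 2
  hom t ht v := by simp only [h.2.2.1 t ht v]; ring
  smooth v hv := bm_smooth h v hv

lemma bm_nonneg {Φ : V → ℝ} (h : IsBanachMinkowski Φ) (v : V) : 0 ≤ Φ v := by
  by_cases hv : v = 0
  · rw [hv, h.1]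
  · exact (h.2.1 v hv).le

lemma bm_lower {Φ : ℝ × ℝ → ℝ} (h : IsBanachMinkowski Φ) : ∃ m : ℝ, 0 < m ∧ ∀ v, m * ‖v‖ ≤ Φ v := by
  have hs : IsCompact (Metric.sphere (0 : ℝ × ℝ) 1) := isCompact_sphere 0 1
  obtain ⟨x, hx, hmin⟩ := hs.exists_isMinOn (NormedSpace.sphere_nonempty.2 zero_le_one)
    (bm_cont h).continuousOn
  have hx0 : x ≠ 0 := by
    rintro rfl
    simp at hx
  refine ⟨Φ x, h.2.1 x hx0, fun v => ?_⟩
  by_cases hv : v = 0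
  · simp [hv, h.1]
  have hn : 0 < ‖v‖ := norm_pos_iff.2 hv
  have h1 := h.2.2.1 (‖v‖⁻¹) (by positivity) v
  have h2 : Φ x ≤ Φ (‖v‖⁻¹ • v) := hmin (by simp [norm_smul, hn.ne'])
  rw [h1] at h2
  calc Φ x * ‖v‖ ≤ (‖v‖⁻¹ * Φ v) * ‖v‖ := by gcongr
    _ = Φ v := by field_simp
end BM

lemma fins_cd {U : Set (ℝ × ℝ)} (hU : IsOpen U) {φ : ℝ × ℝ → ℝ × ℝ → ℝ} (hφ : IsFinslerMetric U φ)
    (x : ℝ × ℝ) (hx : x ∈ U) (v : ℝ × ℝ) (hv : v ≠ 0) :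
    ContDiffAt ℝ 2 (fun q : (ℝ × ℝ) × ℝ × ℝ => φ q.1 q.2) (x, v) := by
  have h1 := hφ.1.contDiffAt (x := (x, v))
    ((hU.prod isOpen_compl_singleton).mem_nhds ⟨hx, hv⟩)
  exact h1.of_le two_le_smooth

lemma fins_cd' {U : Set (ℝ × ℝ)} (hU : IsOpen U) {φ : ℝ × ℝ → ℝ × ℝ → ℝ} (hφ : IsFinslerMetric U φ)
    (x : ℝ × ℝ) (hx : x ∈ U) (v : ℝ × ℝ) (hv : v ≠ 0) :
    ContDiffAt ℝ 2 (fun y => φ y v ^ 2) x := by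
  have h1 := fins_cd hU hφ x hx v hv
  have h2 : ContDiffAt ℝ 2 (fun y : ℝ × ℝ => (y, v)) x := by fun_prop
  exact (h1.comp x h2).pow 2

lemma close_aut {U : Set (ℝ × ℝ)} (hU : IsOpen U) {φ : ℝ × ℝ → ℝ × ℝ → ℝ} (hφ : IsFinslerMetric U φ)
    (hmono : ∀ x ∈ U, ∀ y ∈ U, ∃ A : (ℝ × ℝ) ≃ₗ[ℝ] (ℝ × ℝ),
      ∀ v : ℝ × ℝ, φ y (A v) = φ x v)
    (p : ℝ × ℝ) (hp : p ∈ U) (N : Set (ℝ × ℝ →L[ℝ] ℝ × ℝ))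
    (hN : N ∈ 𝓝 (ContinuousLinearMap.id ℝ (ℝ × ℝ))) :
    ∀ᶠ x in 𝓝 p, ∃ A ∈ N, ∀ v, φ p (A v) = φ x v := by
  by_contra hcon
  have hfr : ∃ᶠ x in 𝓝 p, x ∈ U ∧ ¬ ∃ A ∈ N, ∀ v, φ p (A v) = φ x v := by
    have h1 := (not_eventually.1 hcon).and_eventually (hU.mem_nhds hp)
    exact h1.mono fun x hx => ⟨hx.2, hx.1⟩
  obtain ⟨xs, hxs, hxs'⟩ := exists_seq_forall_of_frequently hfr
  have hA : ∀ n, ∃ A : ℝ × ℝ →L[ℝ] ℝ × ℝ, ∀ v, φ p (A v) = φ (xs n) v := by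
    intro n
    obtain ⟨A, hA⟩ := hmono (xs n) (hxs' n).1 p hp
    exact ⟨LinearMap.toContinuousLinearMap A.toLinearMap, hA⟩
  choose A hA using hA
  have hbm := hφ.2 p hp
  obtain ⟨m, hm, hlow⟩ := bm_lower hbm
  have hconv : ∀ v, Tendsto (fun n => φ (xs n) v) atTop (𝓝 (φ p v)) := by
    intro v
    by_cases hv : v = 0
    · subst hv
      have : (fun n => φ (xs n) 0) = fun _ => φ p 0 := by
        funext n; rw [(hφ.2 _ (hxs' n).1).1, hbm.1]
      rw [this]; exact tendsto_const_nhds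
    · have h1 := (fins_cd hU hφ p hp v hv).continuousAt
      have h2 : ContinuousAt (fun y : ℝ × ℝ => (y, v)) p := by fun_prop
      have h3 : ContinuousAt (fun y : ℝ × ℝ => φ y v) p := ContinuousAt.comp (g := fun q : (ℝ × ℝ) × ℝ × ℝ => φ q.1 q.2) (f := fun y : ℝ × ℝ => (y, v)) h1 h2
      exact h3.tendsto.comp hxs
  have hbd : ∀ v, ∃ C, ∀ n, ‖A n v‖ ≤ C := by
    intro v
    obtain ⟨C, hC⟩ := (hconv v).bddAbove_range
    refine ⟨C / m, fun n => ?_⟩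
    rw [le_div_iff₀ hm]
    calc ‖A n v‖ * m = m * ‖A n v‖ := mul_comm _ _
      _ ≤ φ p (A n v) := hlow _
      _ = φ (xs n) v := hA n v
      _ ≤ C := hC ⟨n, rfl⟩
  obtain ⟨C, hC⟩ := banach_steinhaus hbd
  obtain ⟨L, -, ψ, hψ, hL⟩ := tendsto_subseq_of_bounded (x := A)
    (Metric.isBounded_closedBall (x := (0 : ℝ × ℝ →L[ℝ] ℝ × ℝ)) (r := C))
    (fun n => by simpa using hC n)
  have hLv : ∀ v, φ p (L v) = φ p v := by
    intro v
    have h1 : Tendsto (fun n => A (ψ n) v) atTop (𝓝 (L v)) :=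
      ((ContinuousLinearMap.apply ℝ (ℝ × ℝ) v).continuous.tendsto L).comp hL
    have h2 := ((bm_cont hbm).tendsto _).comp h1
    have h3 := (hconv v).comp hψ.tendsto_atTop
    have h4 : (φ p ∘ fun n => A (ψ n) v) = (fun n => φ (xs n) v) ∘ ψ := by
      funext n; exact hA _ _
    rw [h4] at h2
    exact tendsto_nhds_unique h2 h3
  have hLi : Function.Injective (L : ℝ × ℝ →ₗ[ℝ] ℝ × ℝ) := by
    rw [← LinearMap.ker_eq_bot, LinearMap.ker_eq_bot']
    intro v hv
    by_contra hne
    have := hbm.2.1 v hne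
    rw [← hLv v] at this
    have hv' : L v = 0 := hv
    rw [hv', hbm.1] at this
    exact lt_irrefl _ this
  let e := LinearEquiv.ofInjectiveEndo (L : ℝ × ℝ →ₗ[ℝ] ℝ × ℝ) hLi
  let M : ℝ × ℝ →L[ℝ] ℝ × ℝ := LinearMap.toContinuousLinearMap e.symm.toLinearMap
  have hLM : ∀ v, L (M v) = v := fun v => e.apply_symm_apply v
  have hML : ∀ v, M (L v) = v := fun v => e.symm_apply_apply v
  have hMv : ∀ v, φ p (M v) = φ p v := by
    intro v; rw [← hLv (M v), hLM]
  have ht : Tendsto (fun n => M.comp (A (ψ n))) atTop (𝓝 (ContinuousLinearMap.id ℝ (ℝ × ℝ))) := by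
    have h1 : M.comp L = ContinuousLinearMap.id ℝ (ℝ × ℝ) := ContinuousLinearMap.ext fun v => by simp [hML]
    rw [← h1]
    have h2 : Continuous (fun B : ℝ × ℝ →L[ℝ] ℝ × ℝ => M.comp B) := by fun_prop
    exact (h2.tendsto L).comp hL
  obtain ⟨n, hn⟩ := (ht.eventually hN).exists
  exact (hxs' (ψ n)).2 ⟨_, hn, fun v => by
    rw [ContinuousLinearMap.comp_apply, hMv, hA]⟩

lemma finite_jet {F : ℝ × ℝ → ℝ} (h : Hom2 F) (hq : ¬ IsQuad F) :
    ∃ (s : Finset {v : ℝ × ℝ // v ≠ 0}) (K : (s → ℝ) →L[ℝ] (ℝ × ℝ →L[ℝ] ℝ × ℝ)),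
      ∀ B : ℝ × ℝ →L[ℝ] ℝ × ℝ, K (fun i => fderiv ℝ F i.1.1 (B i.1.1)) = B := by
  classical
  let ell : {v : ℝ × ℝ // v ≠ 0} → (ℝ × ℝ →L[ℝ] ℝ × ℝ) →ₗ[ℝ] ℝ := fun v =>
    ((fderiv ℝ F v.1).comp (ContinuousLinearMap.apply ℝ (ℝ × ℝ) v.1) :
      (ℝ × ℝ →L[ℝ] ℝ × ℝ) →L[ℝ] ℝ)
  have hell : ∀ v B, ell v B = fderiv ℝ F v.1 (B v.1) := fun v B => rfl
  let Kr : Finset {v : ℝ × ℝ // v ≠ 0} → Submodule ℝ (ℝ × ℝ →L[ℝ] ℝ × ℝ) := fun s =>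
    s.inf (fun i => LinearMap.ker (ell i))
  obtain ⟨_, ⟨s, rfl⟩, hs⟩ := (wellFounded_lt :
    WellFounded ((· < ·) : Submodule ℝ (ℝ × ℝ →L[ℝ] ℝ × ℝ) → _ → Prop)).has_min (range Kr)
      ⟨_, ⟨∅, rfl⟩⟩
  have hker : ∀ B, (∀ i ∈ s, ell i B = 0) → B = 0 := by
    intro B hB
    have hBs : B ∈ Kr s := by
      simp only [Kr, Submodule.mem_finsetInf]
      exact fun i hi => hB i hi
    have hall : ∀ i, ell i B = 0 := by
      intro i
      have hle : Kr (insert i s) ≤ Kr s := Finset.inf_mono (Finset.subset_insert i s)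
      have heq : Kr (insert i s) = Kr s := by
        by_contra hne
        exact hs _ ⟨_, rfl⟩ (lt_of_le_of_ne hle hne)
      rw [← heq] at hBs
      simp only [Kr, Submodule.mem_finsetInf] at hBs
      exact hBs i (Finset.mem_insert_self i s)
    have hBx : ∀ v : ℝ × ℝ, B v = ((B (1, 0)).1 * v.1 + (B (0, 1)).1 * v.2,
        (B (1, 0)).2 * v.1 + (B (0, 1)).2 * v.2) := by
      intro v
      have : v = v.1 • ((1 : ℝ), (0 : ℝ)) + v.2 • ((0 : ℝ), (1 : ℝ)) := by ext <;> simp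
      conv_lhs => rw [this]
      rw [map_add, map_smul, map_smul]
      ext <;> simp <;> ring
    obtain ⟨h1, h2, h3, h4⟩ := killing h (B (1, 0)).1 (B (0, 1)).1 (B (1, 0)).2 (B (0, 1)).2
      (fun v hv => by rw [← hBx v]; exact hall ⟨v, hv⟩) hq
    refine ContinuousLinearMap.ext fun v => ?_
    rw [hBx v, h1, h2, h3, h4]; simp
  let J : (ℝ × ℝ →L[ℝ] ℝ × ℝ) →ₗ[ℝ] (s → ℝ) := LinearMap.pi (fun i => ell i.1)
  have hJ : LinearMap.ker J = ⊥ := by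
    rw [LinearMap.ker_eq_bot']
    intro B hB
    exact hker B fun i hi => congrFun hB ⟨i, hi⟩
  obtain ⟨K, hK⟩ := LinearMap.exists_leftInverse_of_injective J hJ
  refine ⟨s, LinearMap.toContinuousLinearMap K, fun B => ?_⟩
  exact LinearMap.congr_fun hK B

lemma lift_aut {U : Set (ℝ × ℝ)} (hU : IsOpen U) {φ : ℝ × ℝ → ℝ × ℝ → ℝ} (hφ : IsFinslerMetric U φ)
    (hmono : ∀ x ∈ U, ∀ y ∈ U, ∃ A : (ℝ × ℝ) ≃ₗ[ℝ] (ℝ × ℝ),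
      ∀ v : ℝ × ℝ, φ y (A v) = φ x v)
    (p : ℝ × ℝ) (hp : p ∈ U) (hq : ¬ IsQuad (fun v => φ p v ^ 2)) :
    ∃ 𝒜 : ℝ × ℝ → (ℝ × ℝ →L[ℝ] ℝ × ℝ), ContDiffAt ℝ 2 𝒜 p ∧
      𝒜 p = ContinuousLinearMap.id ℝ (ℝ × ℝ) ∧
      ∀ᶠ x in 𝓝 p, ∀ v, φ x v ^ 2 = φ p (𝒜 x v) ^ 2 := by
  have hH := bm_hom2 (hφ.2 p hp)
  obtain ⟨s, K, hK⟩ := finite_jet hH hq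
  let I := ContinuousLinearMap.id ℝ (ℝ × ℝ)
  let Ψ : (ℝ × ℝ →L[ℝ] ℝ × ℝ) → (ℝ × ℝ →L[ℝ] ℝ × ℝ) :=
    fun A => K (fun i => φ p (A i.1.1) ^ 2)
  have hap : ∀ v : ℝ × ℝ, ContDiffAt ℝ 2 (fun A : ℝ × ℝ →L[ℝ] ℝ × ℝ => A v) I := by
    intro v; exact (ContinuousLinearMap.apply ℝ (ℝ × ℝ) v).contDiff.contDiffAt
  have hΨ : ContDiffAt ℝ 2 Ψ I := by
    refine K.contDiff.contDiffAt.comp I ?_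
    rw [contDiffAt_pi]
    intro i
    exact ContDiffAt.comp (g := fun v => φ p v ^ 2) I (hH.smooth (I i.1.1) i.1.2) (hap i.1.1)
  have hΨ' : HasFDerivAt Ψ ((ContinuousLinearEquiv.refl ℝ (ℝ × ℝ →L[ℝ] ℝ × ℝ) :
      (ℝ × ℝ →L[ℝ] ℝ × ℝ) →L[ℝ] (ℝ × ℝ →L[ℝ] ℝ × ℝ))) I := by
    have h1 : HasFDerivAt (fun (A : ℝ × ℝ →L[ℝ] ℝ × ℝ) (i : s) => φ p (A i.1.1) ^ 2)
        (ContinuousLinearMap.pi fun i : s => (fderiv ℝ (fun v => φ p v ^ 2) i.1.1).comp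
          (ContinuousLinearMap.apply ℝ (ℝ × ℝ) i.1.1)) I := by
      rw [hasFDerivAt_pi]
      intro i
      have a := ((hH.smooth i.1.1 i.1.2).differentiableAt (by simp)).hasFDerivAt
      exact HasFDerivAt.comp (g := fun v => φ p v ^ 2)
        (f := fun A : ℝ × ℝ →L[ℝ] ℝ × ℝ => A i.1.1) I a
        (ContinuousLinearMap.apply ℝ (ℝ × ℝ) i.1.1).hasFDerivAt
    have h2 := K.hasFDerivAt.comp I h1
    have h3 : K.comp (ContinuousLinearMap.pi fun i : s =>
        (fderiv ℝ (fun v => φ p v ^ 2) i.1.1).comp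
          (ContinuousLinearMap.apply ℝ (ℝ × ℝ) i.1.1)) =
      (ContinuousLinearEquiv.refl ℝ (ℝ × ℝ →L[ℝ] ℝ × ℝ) :
      (ℝ × ℝ →L[ℝ] ℝ × ℝ) →L[ℝ] (ℝ × ℝ →L[ℝ] ℝ × ℝ)) :=
      ContinuousLinearMap.ext fun B => hK B
    rw [← h3]; exact h2
  let inv := hΨ.localInverse hΨ' (by simp)
  have hinv : ContDiffAt ℝ 2 inv (Ψ I) := hΨ.to_localInverse hΨ' (by simp)
  have hleft : ∀ᶠ A in 𝓝 I, inv (Ψ A) = A :=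
    (hΨ.hasStrictFDerivAt' hΨ' (by simp)).eventually_left_inverse
  refine ⟨fun x => inv (K (fun i => φ x i.1.1 ^ 2)), ?_, ?_, ?_⟩
  · refine ContDiffAt.comp (g := inv) (f := fun x => K (fun i => φ x i.1.1 ^ 2)) p hinv ?_
    refine K.contDiff.contDiffAt.comp p ?_
    rw [contDiffAt_pi]
    intro i
    exact fins_cd' hU hφ p hp i.1.1 i.1.2
  · exact hleft.self_of_nhds
  · filter_upwards [close_aut hU hφ hmono p hp _ hleft] with x hx v
    obtain ⟨A, hA, hAv⟩ := hx
    have h1 : K (fun i => φ x i.1.1 ^ 2) = Ψ A := by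
      simp only [Ψ, hAv]
    have h2 : inv (Ψ A) = A := hA
    rw [h1, h2, hAv]

section Emb
variable {V : Type*} [NormedAddCommGroup V] [NormedSpace ℝ V]

lemma smooth_sym {f : ℝ × ℝ → V} {p : ℝ × ℝ} (hf : ContDiffAt ℝ (⊤ : ℕ∞) f p) (k l : ℝ × ℝ) :
    fderiv ℝ (fderiv ℝ f) p k l = fderiv ℝ (fderiv ℝ f) p l k := by
  have h : IsSymmSndFDerivAt ℝ f p := hf.isSymmSndFDerivAt
    (by rw [minSmoothness_of_isRCLikeNormedField]; exact two_le_smooth)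
  exact h k l

lemma smooth_fd {f : ℝ × ℝ → V} {p : ℝ × ℝ} (hf : ContDiffAt ℝ (⊤ : ℕ∞) f p) :
    ContDiffAt ℝ (⊤ : ℕ∞) (fderiv ℝ f) p := hf.fderiv_right (by simp)

lemma smooth_sym3 {f : ℝ × ℝ → V} {p : ℝ × ℝ} {U : Set (ℝ × ℝ)} (hU : IsOpen U) (hp : p ∈ U)
    (hf : ContDiffOn ℝ (⊤ : ℕ∞) f U) (k l v : ℝ × ℝ) :
    fderiv ℝ (fderiv ℝ (fderiv ℝ f)) p k l v = fderiv ℝ (fderiv ℝ (fderiv ℝ f)) p k v l := by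
  have hfp : ∀ x ∈ U, ContDiffAt ℝ (⊤ : ℕ∞) f x := fun x hx => hf.contDiffAt (hU.mem_nhds hx)
  have hd : DifferentiableAt ℝ (fderiv ℝ (fderiv ℝ f)) p :=
    (smooth_fd (smooth_fd (hfp p hp))).differentiableAt (by simp)
  have key : ∀ l v : ℝ × ℝ, fderiv ℝ (fun x => fderiv ℝ (fderiv ℝ f) x l v) p k
      = fderiv ℝ (fderiv ℝ (fderiv ℝ f)) p k l v := by
    intro l v
    have h1 := (hd.hasFDerivAt.clm_apply (hasFDerivAt_const l p)).clm_apply (hasFDerivAt_const v p)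
    rw [h1.fderiv]
    simp
  rw [← key l v, ← key v l]
  have : (fun x => fderiv ℝ (fderiv ℝ f) x l v) =ᶠ[𝓝 p] (fun x => fderiv ℝ (fderiv ℝ f) x v l) := by
    filter_upwards [hU.mem_nhds hp] with x hx
    exact smooth_sym (hfp x hx) l v
  rw [this.fderiv_eq]

lemma emb_derivs {U : Set (ℝ × ℝ)} (hU : IsOpen U) {φ : ℝ × ℝ → ℝ × ℝ → ℝ}
    {Φ : V → ℝ} (hΦ : IsBanachMinkowski Φ) {f : ℝ × ℝ → V} (hf : IsIsometricEmbedding U φ Φ f)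
    {p : ℝ × ℝ} (hp : p ∈ U) (k v : ℝ × ℝ) (hv : fderiv ℝ f p v ≠ 0) :
    deriv (fun t : ℝ => φ (p + t • k) v ^ 2) 0 =
      fderiv ℝ (fun y => Φ y ^ 2) (fderiv ℝ f p v) (fderiv ℝ (fderiv ℝ f) p k v) ∧
    deriv (deriv (fun t : ℝ => φ (p + t • k) v ^ 2)) 0 =
      fderiv ℝ (fderiv ℝ (fun y => Φ y ^ 2)) (fderiv ℝ f p v)
        (fderiv ℝ (fderiv ℝ f) p k v) (fderiv ℝ (fderiv ℝ f) p k v)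
      + fderiv ℝ (fun y => Φ y ^ 2) (fderiv ℝ f p v)
        (fderiv ℝ (fderiv ℝ (fderiv ℝ f)) p k k v) := by
  have hfp : ContDiffAt ℝ (⊤ : ℕ∞) f p := hf.1.contDiffAt (hU.mem_nhds hp)
  obtain ⟨c1, c2, c3⟩ := curve2 (fderiv ℝ f) p k v ((smooth_fd hfp).of_le two_le_smooth)
  have h0 : p + (0:ℝ) • k = p := by simp
  have hl : Continuous (fun t : ℝ => p + t • k) := by fun_prop
  have hev : (fun t : ℝ => φ (p + t • k) v ^ 2) =ᶠ[𝓝 0]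
      (fun t : ℝ => Φ (fderiv ℝ f (p + t • k) v) ^ 2) := by
    have := (ContinuousAt.tendsto (hl.continuousAt (x := (0:ℝ)))).eventually (p := fun x => x ∈ U)
      (by rw [h0]; exact hU.mem_nhds hp)
    filter_upwards [this] with t ht
    rw [hf.2.2 _ ht]
  have hc := chain2 (fun y => Φ y ^ 2) (fun t : ℝ => fderiv ℝ f (p + t • k) v)
    (bm_smooth hΦ _ (by simpa using hv)) c1
  rw [c2, c3] at hc
  simp only [h0] at hc
  rw [hev.deriv_eq, hev.deriv.deriv_eq]
  exact hc

lemma emb_ne {U : Set (ℝ × ℝ)} {φ : ℝ × ℝ → ℝ × ℝ → ℝ} (hφ : IsFinslerMetric U φ)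
    {Φ : V → ℝ} (hΦ : IsBanachMinkowski Φ) {f : ℝ × ℝ → V} (hf : IsIsometricEmbedding U φ Φ f)
    {p : ℝ × ℝ} (hp : p ∈ U) (v : ℝ × ℝ) (hv : v ≠ 0) : fderiv ℝ f p v ≠ 0 := by
  intro h
  have h1 := hf.2.2 p hp v
  rw [h, hΦ.1] at h1
  exact ((hφ.2 p hp).2.1 v hv).ne h1

lemma emb_quad [FiniteDimensional ℝ V] (hdim : Module.finrank ℝ V = 3)
    {U : Set (ℝ × ℝ)} (hU : IsOpen U) {φ : ℝ × ℝ → ℝ × ℝ → ℝ} (hφ : IsFinslerMetric U φ)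
    (hmono : ∀ x ∈ U, ∀ y ∈ U, ∃ A : (ℝ × ℝ) ≃ₗ[ℝ] (ℝ × ℝ),
      ∀ v : ℝ × ℝ, φ y (A v) = φ x v)
    {Φ : V → ℝ} (hΦ : IsBanachMinkowski Φ) {f : ℝ × ℝ → V} (hf : IsIsometricEmbedding U φ Φ f)
    {p : ℝ × ℝ} (hp : p ∈ U) (lam : V →ₗ[ℝ] ℝ) (hlam : lam ≠ 0)
    (hlamD : ∀ v, lam (fderiv ℝ f p v) = 0)
    (hd : lam (fderiv ℝ (fderiv ℝ f) p (1, 0) (1, 0)) * lam (fderiv ℝ (fderiv ℝ f) p (0, 1) (0, 1))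
      - lam (fderiv ℝ (fderiv ℝ f) p (1, 0) (0, 1)) ^ 2 ≠ 0) :
    IsQuad (fun v => φ p v ^ 2) := by
  by_contra hq
  have hD := emb_ne hφ hΦ hf hp
  have hfp : ContDiffAt ℝ (⊤ : ℕ∞) f p := hf.1.contDiffAt (hU.mem_nhds hp)
  have hF0 : (fun v => (fun y => Φ y ^ 2) (fderiv ℝ f p v)) = fun v => φ p v ^ 2 := by
    funext v; simp only [hf.2.2 p hp v]
  obtain ⟨n, π, hn, hπ⟩ := exists_split hdim (fderiv ℝ f p) hD lam hlam hlamD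
  obtain ⟨𝒜, hA, hAp, hAe⟩ := lift_aut hU hφ hmono p hp hq
  have hH := bm_hom2 (hφ.2 p hp)
  have hl : ∀ k, Continuous (fun t : ℝ => p + t • k) := fun k => by fun_prop
  have h0 : ∀ k, p + (0:ℝ) • k = p := by simp
  have key : ∀ k v : ℝ × ℝ, v ≠ 0 →
    deriv (fun t : ℝ => φ (p + t • k) v ^ 2) 0 =
      fderiv ℝ (fun y => φ p y ^ 2) v (fderiv ℝ 𝒜 p k v) ∧
    deriv (deriv (fun t : ℝ => φ (p + t • k) v ^ 2)) 0 =
      fderiv ℝ (fderiv ℝ (fun y => φ p y ^ 2)) v (fderiv ℝ 𝒜 p k v) (fderiv ℝ 𝒜 p k v)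
      + fderiv ℝ (fun y => φ p y ^ 2) v (fderiv ℝ (fderiv ℝ 𝒜) p k k v) := by
    intro k v hv
    obtain ⟨c1, c2, c3⟩ := curve2 𝒜 p k v hA
    have hev : (fun t : ℝ => φ (p + t • k) v ^ 2) =ᶠ[𝓝 0]
        (fun t : ℝ => φ p (𝒜 (p + t • k) v) ^ 2) := by
      have := (ContinuousAt.tendsto ((hl k).continuousAt (x := (0:ℝ)))).eventually
        (p := fun x => ∀ v, φ x v ^ 2 = φ p (𝒜 x v) ^ 2) (by rw [h0]; exact hAe)
      filter_upwards [this] with t ht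
      rw [ht]
    have hc := chain2 (fun y => φ p y ^ 2) (fun t : ℝ => 𝒜 (p + t • k) v)
      (hH.smooth _ (by simpa [hAp] using hv)) c1
    rw [c2, c3] at hc
    simp only [h0, hAp, ContinuousLinearMap.id_apply] at hc
    rw [hev.deriv_eq, hev.deriv.deriv_eq]
    exact hc
  refine stageI (fun y => Φ y ^ 2) (bm_smooth hΦ) (bm_pos2 hΦ) (fderiv ℝ f p) hD
    (by rw [hF0]; exact hH) (by rw [hF0]; exact hq) lam n π hn hlamD hπ
    (fderiv ℝ (fderiv ℝ f) p) (smooth_sym hfp) hd (fderiv ℝ 𝒜 p)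
    (fun k => fderiv ℝ (fderiv ℝ 𝒜) p k k) (fun k => fderiv ℝ (fderiv ℝ (fderiv ℝ f)) p k k) ?_ ?_
  · intro k v hv
    rw [hF0, ← (emb_derivs hU hΦ hf hp k v (hD v hv)).1, (key k v hv).1]
  · intro k v hv
    rw [hF0, ← (emb_derivs hU hΦ hf hp k v (hD v hv)).2, (key k v hv).2]
end Emb

lemma quad_derivs {U : Set (ℝ × ℝ)} (hU : IsOpen U) {φ : ℝ × ℝ → ℝ × ℝ → ℝ}
    (hφ : IsFinslerMetric U φ)
    (hmono : ∀ x ∈ U, ∀ y ∈ U, ∃ A : (ℝ × ℝ) ≃ₗ[ℝ] (ℝ × ℝ),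
      ∀ v : ℝ × ℝ, φ y (A v) = φ x v)
    (p : ℝ × ℝ) (hp : p ∈ U) (hq : IsQuad (fun v => φ p v ^ 2)) (k : ℝ × ℝ) :
    IsQuad (fun v => deriv (fun t : ℝ => φ (p + t • k) v ^ 2) 0) ∧
    IsQuad (fun v => deriv (deriv (fun t : ℝ => φ (p + t • k) v ^ 2)) 0) := by
  have hx : ∀ x ∈ U, ∀ v : ℝ × ℝ, φ x v ^ 2 = v.1 ^ 2 * φ x (1, 0) ^ 2
      + v.1 * v.2 * (φ x (1, 1) ^ 2 - φ x (1, 0) ^ 2 - φ x (0, 1) ^ 2)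
      + v.2 ^ 2 * φ x (0, 1) ^ 2 := by
    intro x hx v
    obtain ⟨A, hA⟩ := hmono x hx p hp
    obtain ⟨a, b, c, h⟩ := hq
    have hAx : ∀ v : ℝ × ℝ, A v = (v.1 * (A (1, 0)).1 + v.2 * (A (0, 1)).1,
        v.1 * (A (1, 0)).2 + v.2 * (A (0, 1)).2) := by
      intro v
      have : v = v.1 • ((1 : ℝ), (0 : ℝ)) + v.2 • ((0 : ℝ), (1 : ℝ)) := by ext <;> simp
      conv_lhs => rw [this]
      rw [map_add, map_smul, map_smul]
      ext <;> simp
    have h' : ∀ v, φ x v ^ 2 = a * (A v).1 ^ 2 + b * ((A v).1 * (A v).2) + c * (A v).2 ^ 2 := by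
      intro v; rw [← hA v]; exact h (A v)
    rw [h' v, h' (1, 1), h' (1, 0), h' (0, 1), hAx v, hAx (1, 1)]
    simp only
    ring
  have hl : ContDiff ℝ 2 (fun t : ℝ => p + t • k) := by fun_prop
  have h0 : p + (0:ℝ) • k = p := by simp
  have hc : ∀ v : ℝ × ℝ, v ≠ 0 → ContDiffAt ℝ 2 (fun t : ℝ => φ (p + t • k) v ^ 2) 0 := by
    intro v hv
    exact ContDiffAt.comp (g := fun y => φ y v ^ 2) (f := fun t : ℝ => p + t • k) 0
      (by rw [h0]; exact fins_cd' hU hφ p hp v hv) hl.contDiffAt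
  have hα := hc (1, 0) (by simp)
  have hγ := hc (0, 1) (by simp)
  have hε := hc (1, 1) (by simp)
  set α := fun t : ℝ => φ (p + t • k) (1, 0) ^ 2 with hαd
  set γ := fun t : ℝ => φ (p + t • k) (0, 1) ^ 2 with hγd
  set ε := fun t : ℝ => φ (p + t • k) (1, 1) ^ 2 with hεd
  have hev : ∀ v : ℝ × ℝ, (fun t : ℝ => φ (p + t • k) v ^ 2) =ᶠ[𝓝 0]
      (fun t => v.1 ^ 2 * α t + v.1 * v.2 * (ε t - α t - γ t) + v.2 ^ 2 * γ t) := by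
    intro v
    have := (ContinuousAt.tendsto (hl.continuous.continuousAt (x := (0:ℝ)))).eventually (p := fun x => x ∈ U)
      (by rw [h0]; exact hU.mem_nhds hp)
    filter_upwards [this] with t ht
    exact hx _ ht v
  have lin1 : ∀ (a b c : ℝ → ℝ) (x y z t : ℝ), DifferentiableAt ℝ a t → DifferentiableAt ℝ b t →
      DifferentiableAt ℝ c t → deriv (fun t => x * a t + y * (b t - a t - c t) + z * c t) t
        = x * deriv a t + y * (deriv b t - deriv a t - deriv c t) + z * deriv c t := by
    intro a b c x y z t ha hb hc
    exact (((ha.hasDerivAt.const_mul x).add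
      (((hb.hasDerivAt.sub ha.hasDerivAt).sub hc.hasDerivAt).const_mul y)).add
      (hc.hasDerivAt.const_mul z)).deriv
  have hdd : ∀ g : ℝ → ℝ, ContDiffAt ℝ 2 g 0 → DifferentiableAt ℝ (deriv g) 0 := by
    intro g hg
    have := hg.fderiv_right (m := 1) (by norm_num)
    have h2 := this.clm_apply (contDiffAt_const (c := (1:ℝ)))
    exact ContDiffAt.differentiableAt (n := 1) h2 (by simp)
  have hev2 : ∀ v : ℝ × ℝ, deriv (fun t : ℝ => φ (p + t • k) v ^ 2) =ᶠ[𝓝 0]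
      (fun t => v.1 ^ 2 * deriv α t + v.1 * v.2 * (deriv ε t - deriv α t - deriv γ t)
        + v.2 ^ 2 * deriv γ t) := by
    intro v
    refine (hev v).deriv.trans ?_
    filter_upwards [hα.eventually (by simp), hγ.eventually (by simp),
      hε.eventually (by simp)] with t h1 h2 h3
    exact lin1 _ _ _ _ _ _ _ (h1.differentiableAt (by simp)) (h3.differentiableAt (by simp))
      (h2.differentiableAt (by simp))
  constructor
  · refine ⟨deriv α 0, deriv ε 0 - deriv α 0 - deriv γ 0, deriv γ 0, fun v => ?_⟩
    simp only
    rw [(hev2 v).self_of_nhds]; ring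
  · refine ⟨deriv (deriv α) 0, deriv (deriv ε) 0 - deriv (deriv α) 0 - deriv (deriv γ) 0,
      deriv (deriv γ) 0, fun v => ?_⟩
    simp only
    rw [(hev2 v).deriv_eq, lin1 _ _ _ _ _ _ _ (hdd _ hα) (hdd _ hε) (hdd _ hγ)]; ring

lemma emb_stageII {V : Type*} [NormedAddCommGroup V] [NormedSpace ℝ V]
    [FiniteDimensional ℝ V] (hdim : Module.finrank ℝ V = 3)
    {U : Set (ℝ × ℝ)} (hU : IsOpen U) {φ : ℝ × ℝ → ℝ × ℝ → ℝ} (hφ : IsFinslerMetric U φ)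
    (hmono : ∀ x ∈ U, ∀ y ∈ U, ∃ A : (ℝ × ℝ) ≃ₗ[ℝ] (ℝ × ℝ),
      ∀ v : ℝ × ℝ, φ y (A v) = φ x v)
    {Φ : V → ℝ} (hΦ : IsBanachMinkowski Φ) {f : ℝ × ℝ → V} (hf : IsIsometricEmbedding U φ Φ f)
    {p : ℝ × ℝ} (hp : p ∈ U) (lam : V →ₗ[ℝ] ℝ) (hlam : lam ≠ 0)
    (hlamD : ∀ v, lam (fderiv ℝ f p v) = 0) (a b c : ℝ)
    (hq : ∀ v : ℝ × ℝ, φ p v ^ 2 = a * v.1 ^ 2 + b * (v.1 * v.2) + c * v.2 ^ 2) :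
    ∃ q : ℝ, 0 < q ∧ ∃ π' : V →ₗ[ℝ] ℝ × ℝ,
      (∀ k v, v ≠ 0 → deriv (fun t : ℝ => φ (p + t • k) v ^ 2) 0
        = Gf a b c v (π' (fderiv ℝ (fderiv ℝ f) p k v))) ∧
      (∀ k v, v ≠ 0 → deriv (deriv (fun t : ℝ => φ (p + t • k) v ^ 2)) 0
        = Gf a b c (π' (fderiv ℝ (fderiv ℝ f) p k v)) (π' (fderiv ℝ (fderiv ℝ f) p k v))
          + Gf a b c v (π' (fderiv ℝ (fderiv ℝ (fderiv ℝ f)) p k k v))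
          + q * lam (fderiv ℝ (fderiv ℝ f) p k v) ^ 2) := by
  have hD := emb_ne hφ hΦ hf hp
  have hF0 : (fun v => (fun y => Φ y ^ 2) (fderiv ℝ f p v)) = fun v => φ p v ^ 2 := by
    funext v; simp only [hf.2.2 p hp v]
  obtain ⟨n, π, hn, hπ⟩ := exists_split hdim (fderiv ℝ f p) hD lam hlam hlamD
  have hqd := quad_derivs hU hφ hmono p hp ⟨a, b, c, hq⟩
  exact stageII (fun y => Φ y ^ 2) (bm_smooth hΦ) (bm_pos2 hΦ) (fderiv ℝ f p) hD
    (by rw [hF0]; exact bm_hom2 (hφ.2 p hp)) a b c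
    (fun v => by rw [← hq v]; exact congrFun hF0 v) lam n π hn hlamD hπ
    (fderiv ℝ (fderiv ℝ f) p) (fun k => fderiv ℝ (fderiv ℝ (fderiv ℝ f)) p k k)
    (fun k v => deriv (fun t : ℝ => φ (p + t • k) v ^ 2) 0)
    (fun k v => deriv (deriv (fun t : ℝ => φ (p + t • k) v ^ 2)) 0)
    (fun k => (hqd k).1) (fun k => (hqd k).2)
    (fun k v hv => (emb_derivs hU hΦ hf hp k v (hD v hv)).1.symm)
    (fun k v hv => (emb_derivs hU hΦ hf hp k v (hD v hv)).2.symm)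


/-- Corollary: well-defined type of the second fundamental form for
monochromatic metrics: for two isometric embeddings `f₁, f₂` of a monochromatic Finsler
surface into 3-dimensional Banach–Minkowski spaces, the determinants `d₁, d₂` of the
scalar second fundamental forms at `p` have the same sign: `d₁ > 0 ↔ d₂ > 0` and
`d₁ = 0 ↔ d₂ = 0`. -/
theorem statement16 (U : Set (ℝ × ℝ)) (hU : IsOpen U)
    (φ : ℝ × ℝ → ℝ × ℝ → ℝ) (hφ : IsFinslerMetric U φ)
    (hmono : ∀ x ∈ U, ∀ y ∈ U, ∃ A : (ℝ × ℝ) ≃ₗ[ℝ] (ℝ × ℝ),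
      ∀ v : ℝ × ℝ, φ y (A v) = φ x v)
    (p : ℝ × ℝ) (hp : p ∈ U)
    (V₁ : Type*) [NormedAddCommGroup V₁] [NormedSpace ℝ V₁] [FiniteDimensional ℝ V₁]
    (hdim₁ : Module.finrank ℝ V₁ = 3)
    (Φ₁ : V₁ → ℝ) (hΦ₁ : IsBanachMinkowski Φ₁)
    (f₁ : ℝ × ℝ → V₁) (hf₁ : IsIsometricEmbedding U φ Φ₁ f₁)
    (V₂ : Type*) [NormedAddCommGroup V₂] [NormedSpace ℝ V₂] [FiniteDimensional ℝ V₂]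
    (hdim₂ : Module.finrank ℝ V₂ = 3)
    (Φ₂ : V₂ → ℝ) (hΦ₂ : IsBanachMinkowski Φ₂)
    (f₂ : ℝ × ℝ → V₂) (hf₂ : IsIsometricEmbedding U φ Φ₂ f₂)
    (lam₁ : V₁ →ₗ[ℝ] ℝ) (hlam₁ : lam₁ ≠ 0)
    (hlam₁H : ∀ u ∈ Set.range (fderiv ℝ f₁ p), lam₁ u = 0)
    (lam₂ : V₂ →ₗ[ℝ] ℝ) (hlam₂ : lam₂ ≠ 0)
    (hlam₂H : ∀ u ∈ Set.range (fderiv ℝ f₂ p), lam₂ u = 0)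
    (d₁ d₂ : ℝ)
    (hd₁ : d₁ = lam₁ (iteratedFDeriv ℝ 2 f₁ p ![(1, 0), (1, 0)]) *
        lam₁ (iteratedFDeriv ℝ 2 f₁ p ![(0, 1), (0, 1)]) -
        lam₁ (iteratedFDeriv ℝ 2 f₁ p ![(1, 0), (0, 1)]) ^ 2)
    (hd₂ : d₂ = lam₂ (iteratedFDeriv ℝ 2 f₂ p ![(1, 0), (1, 0)]) *
        lam₂ (iteratedFDeriv ℝ 2 f₂ p ![(0, 1), (0, 1)]) -
        lam₂ (iteratedFDeriv ℝ 2 f₂ p ![(1, 0), (0, 1)]) ^ 2) :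
    (0 < d₁ ↔ 0 < d₂) ∧ (d₁ = 0 ↔ d₂ = 0) := by
  have hfd₁ := hf₁.1.contDiffAt (hU.mem_nhds hp)
  have hfd₂ := hf₂.1.contDiffAt (hU.mem_nhds hp)
  have hl₁ : ∀ v, lam₁ (fderiv ℝ f₁ p v) = 0 := fun v => hlam₁H _ ⟨v, rfl⟩
  have hl₂ : ∀ v, lam₂ (fderiv ℝ f₂ p v) = 0 := fun v => hlam₂H _ ⟨v, rfl⟩
  simp only [iteratedFDeriv_two_apply, Matrix.cons_val_zero, Matrix.cons_val_one] at hd₁ hd₂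
  by_cases hq : IsQuad (fun v => φ p v ^ 2)
  · obtain ⟨a, b, c, habc⟩ := hq
    have hdet : 0 < 4 * a * c - b ^ 2 := Gf_det (bm_hom2 (hφ.2 p hp)) a b c habc
    obtain ⟨q₁, hq₁, π₁, h11, h12⟩ :=
      emb_stageII hdim₁ hU hφ hmono hΦ₁ hf₁ hp lam₁ hlam₁ hl₁ a b c habc
    obtain ⟨q₂, hq₂, π₂, h21, h22⟩ :=
      emb_stageII hdim₂ hU hφ hmono hΦ₂ hf₂ hp lam₂ hlam₂ hl₂ a b c habc
    have key := final_alg a b c hdet lam₁ lam₂ π₁ π₂ _ (smooth_sym hfd₁) _ (smooth_sym hfd₂)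
      (fderiv ℝ (fderiv ℝ (fderiv ℝ f₁)) p)
      (fun k l v => by rw [smooth_sym (smooth_fd hfd₁) k l])
      (fun k l v => smooth_sym3 hU hp hf₁.1 k l v)
      (fderiv ℝ (fderiv ℝ (fderiv ℝ f₂)) p)
      (fun k l v => by rw [smooth_sym (smooth_fd hfd₂) k l])
      (fun k l v => smooth_sym3 hU hp hf₂.1 k l v) q₁ q₂
      (fun k v hv => by rw [← h11 k v hv, ← h21 k v hv])
      (fun k v hv => by rw [← h12 k v hv, ← h22 k v hv])
    rw [← hd₁, ← hd₂] at key
    refine ⟨?_, ?_⟩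
    · rw [← mul_pos_iff_of_pos_left hq₁, key, mul_pos_iff_of_pos_left hq₂]
    · have e1 : q₁ * d₁ = 0 ↔ d₁ = 0 := by simp [hq₁.ne']
      have e2 : q₂ * d₂ = 0 ↔ d₂ = 0 := by simp [hq₂.ne']
      rw [← e1, key, e2]
  · have z₁ : d₁ = 0 := by
      by_contra hne
      exact hq (emb_quad hdim₁ hU hφ hmono hΦ₁ hf₁ hp lam₁ hlam₁ hl₁ (by rw [← hd₁]; exact hne))
    have z₂ : d₂ = 0 := by
      by_contra hne
      exact hq (emb_quad hdim₂ hU hφ hmono hΦ₂ hf₂ hp lam₂ hlam₂ hl₂ (by rw [← hd₂]; exact hne))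
    simp [z₁, z₂]
end
end
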